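/- arXiv:math/9911161 — 4 statements merged into one kernel-verified Lean document; each statement's English description precedes it below -/
import Mathlib

section
/- Let U′ be a smooth projective variety over ℂ of dimension m ≥ 1 and let π : U′ → ℙ^N_ℂ be a finite morphism whose image U (with its reduced structure) is an irreducible closed subvariety of dimension m that is nondegenerate, i.e. not contained in any hyperplane of ℙ^N. Let A ⊂ ℙ^N be a linear subspace meeting U properly and nontrivially, i.e. dim(A ∩ U) = dim A + m − N ≥ 0, and let B ⊊ A be a proper linear subspace. Then the scheme-theoretic intersection B ∩ U is a proper closed subscheme of the scheme-theoretic intersection A ∩ U (the inclusion of closed subschemes of ℙ^N is strict). -/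
open AlgebraicGeometry MvPolynomial CategoryTheory CategoryTheory.Limits

attribute [local instance] MvPolynomial.gradedAlgebra

/-- Projective `N`-space over `ℂ`. -/
noncomputable abbrev ProjSpace (n : ℕ) : Scheme :=
  Proj (homogeneousSubmodule (Fin (n + 1)) ℂ)

/-- The structure morphism `ℙⁿ_ℂ ⟶ Spec ℂ`. -/
noncomputable def ProjSpace.structMap (n : ℕ) :
    ProjSpace n ⟶ Spec (CommRingCat.of ℂ) :=
  Proj.toSpecZero (homogeneousSubmodule (Fin (n + 1)) ℂ) ≫
    Spec.map (CommRingCat.ofHom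
      (algebraMap ℂ (homogeneousSubmodule (Fin (n + 1)) ℂ 0)))

/-- The set of points of `ℙ^N` lying on the linear subspace which is the
projectivization of the linear subspace `W ⊆ ℂ^{N+1}`: the common zero set of all
the linear forms vanishing on `W`. -/
def linearSupport (N : ℕ) (W : Submodule ℂ (Fin (N + 1) → ℂ)) :
    Set ↥(ProjSpace N) :=
  {x | ∀ l ∈ homogeneousSubmodule (Fin (N + 1)) ℂ 1,
    (∀ w ∈ W, eval w l = 0) → l ∈ x.asHomogeneousIdeal}

theorem exists_valuationSubring_of_transcendental {F K : Type*} [Field F] [Field K] [Algebra F K]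
    {t : K} (ht : Transcendental F t) :
    ∃ V : ValuationSubring K, (∀ c : F, V.valuation (algebraMap F K c) ≤ 1) ∧
      V.valuation t < 1 := by
  let A := Algebra.adjoin F {t}
  let t' : A.toSubring := ⟨t, Algebra.subset_adjoin rfl⟩
  have hne : Ideal.span {t'} ≠ ⊤ := by
    rw [Ne, Ideal.span_singleton_eq_top, isUnit_iff_exists_inv]
    rintro ⟨⟨b, hb⟩, hbt⟩
    have hb' : b ∈ (Polynomial.aeval (R := F) t).range :=
      Algebra.adjoin_singleton_eq_range_aeval F t ▸ (show b ∈ Algebra.adjoin F {t} from hb)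
    obtain ⟨p, rfl⟩ := hb'
    have h1 : t * Polynomial.aeval t p = 1 := congrArg Subtype.val hbt
    have h2 := (transcendental_iff.mp ht) (Polynomial.X * p - 1) (by simp [h1])
    have h3 := congrArg (Polynomial.eval 0) h2
    simp at h3
  obtain ⟨V, hV, hV'⟩ := Ideal.image_subset_nonunits_valuationSubring _ hne
  refine ⟨V, fun c ↦ (V.valuation_le_one_iff _).mpr (hV (A.algebraMap_mem c)), ?_⟩
  exact V.mem_nonunits_iff.mp (hV' ⟨t', Ideal.subset_span rfl, rfl⟩)

theorem valuation_le_one_of_isIntegral_adjoin {k K : Type*} [Field k] [Field K] [Algebra k K]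
    (V : ValuationSubring K) (hV : ∀ c : k, V.valuation (algebraMap k K c) ≤ 1) {s : Set K}
    (hs : ∀ y ∈ s, V.valuation y ≤ 1) {a : K} (ha : IsIntegral (Algebra.adjoin k s) a) :
    V.valuation a ≤ 1 := by
  have hle : Algebra.adjoin k s ≤
      ({ V.toSubring with algebraMap_mem' := fun c ↦ (V.valuation_le_one_iff _).mp (hV c) } :
        Subalgebra k K) :=
    Algebra.adjoin_le fun y hy ↦ (V.valuation_le_one_iff _).mp (hs y hy)
  obtain ⟨p, hp, hpa⟩ := ha
  let g : Algebra.adjoin k s →+* V :=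
    { toFun := fun b ↦ ⟨b, hle b.2⟩
      map_one' := rfl, map_mul' := fun _ _ ↦ rfl, map_zero' := rfl, map_add' := fun _ _ ↦ rfl }
  have : IsIntegral V a := ⟨p.map g, hp.map g, by rw [Polynomial.eval₂_map]; exact hpa⟩
  obtain ⟨b, rfl⟩ := IsIntegrallyClosed.isIntegral_iff.mp this
  exact (V.valuation_le_one_iff _).mpr b.2

theorem transcendental_of_valuation_lt_one {F K : Type*} [Field F] [Field K] [Algebra F K]
    (V : ValuationSubring K) (hV : ∀ c : F, V.valuation (algebraMap F K c) ≤ 1) {h : K}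
    (hh : V.valuation h < 1) (h0 : h ≠ 0) : Transcendental F h := by
  intro halg
  have : V.valuation h⁻¹ ≤ 1 :=
    valuation_le_one_of_isIntegral_adjoin V hV (s := {h}) (by rintro _ rfl; exact hh.le)
      (isIntegral_algebraMap (x := (⟨h⁻¹, halg.isIntegral.inv_mem_adjoin⟩ :
        Algebra.adjoin F {h})))
  have h2 : V.valuation (h * h⁻¹) < 1 := by
    rw [map_mul]
    exact mul_lt_one_of_lt_of_le hh this
  simp [h0] at h2

/-- The elements of a valuation ring whose residue is a constant of `k`. -/
def constantResidue {k K : Type*} [Field k] [Field K] [Algebra k K] (V : ValuationSubring K)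
    (hV : ∀ c : k, V.valuation (algebraMap k K c) ≤ 1) : Subalgebra k K where
  carrier := {a | ∃ c : k, V.valuation (a - algebraMap k K c) < 1}
  algebraMap_mem' c := ⟨c, by simp⟩
  add_mem' := by
    rintro a b ⟨c, hc⟩ ⟨d, hd⟩
    refine ⟨c + d, ?_⟩
    rw [map_add, add_sub_add_comm]
    exact Valuation.map_add_lt _ hc hd
  mul_mem' := by
    rintro a b ⟨c, hc⟩ ⟨d, hd⟩
    refine ⟨c * d, ?_⟩
    have ha : V.valuation a ≤ 1 := by
      rw [← sub_add_cancel a (algebraMap k K c)]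
      exact Valuation.map_add_le _ hc.le (hV c)
    have : a * b - algebraMap k K (c * d) =
        a * (b - algebraMap k K d) + (a - algebraMap k K c) * algebraMap k K d := by
      rw [map_mul]; ring
    rw [this]
    refine Valuation.map_add_lt _ ?_ ?_ <;> rw [map_mul]
    · exact mul_comm (V.valuation a) _ ▸ mul_lt_one_of_lt_of_le hd ha
    · exact mul_lt_one_of_lt_of_le hc (hV d)

theorem isIntegral_adjoin_mem_constantResidue {k K : Type*} [Field k] [IsAlgClosed k] [Field K]
    [Algebra k K] (V : ValuationSubring K)
    (hV : ∀ c : k, V.valuation (algebraMap k K c) ≤ 1)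
    {s : Set K} (hs : ∀ y ∈ s, V.valuation y < 1) {a : K}
    (ha : IsIntegral (Algebra.adjoin k s) a) :
    ∃ c : k, V.valuation (a - algebraMap k K c) < 1 := by
  have hle : Algebra.adjoin k s ≤ constantResidue V hV :=
    Algebra.adjoin_le fun y hy ↦ ⟨0, by simpa using hs y hy⟩
  have haV : V.valuation a ≤ 1 :=
    valuation_le_one_of_isIntegral_adjoin V hV (fun y hy ↦ (hs y hy).le) ha
  obtain ⟨p, hp, hpa⟩ := ha
  choose! c hc using fun i ↦ hle (p.coeff i).2
  let d := p.natDegree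
  let c' : ℕ → k := fun i ↦ if i = d then 1 else c i
  have hc' : ∀ i, V.valuation (algebraMap _ K (p.coeff i) - algebraMap k K (c' i)) < 1 := by
    intro i
    by_cases hi : i = d
    · subst hi
      have : p.coeff d = 1 := hp
      simp [c', this]
    · simpa [c', hi] using hc i
  let q : Polynomial k := ∑ i ∈ Finset.range (d + 1), Polynomial.monomial i (c' i)
  have hqd : q.coeff d = 1 := by
    simp [q, Polynomial.coeff_monomial, c']
  have hq0 : q ≠ 0 := by
    intro h; simp [h] at hqd
  have hqa : V.valuation (Polynomial.aeval a q) < 1 := by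
    have h1 : Polynomial.aeval a q = -(Polynomial.eval₂ (algebraMap _ K) a p - Polynomial.aeval a q) := by
      rw [hpa]; ring
    rw [h1, Valuation.map_neg, Polynomial.eval₂_eq_sum_range]
    simp only [q, map_sum, Polynomial.aeval_monomial, d]
    rw [← Finset.sum_sub_distrib]
    refine Valuation.map_sum_lt _ one_ne_zero fun i _ ↦ ?_
    rw [← sub_mul, map_mul, map_pow]
    exact mul_lt_one_of_lt_of_le (hc' i) (pow_le_one' haV i)
  by_contra! hcon
  have hroots : ∀ s : Multiset k, V.valuation ((s.map fun r ↦ a - algebraMap k K r).prod) ≥ 1 := by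
    intro s
    induction s using Multiset.induction_on with
    | empty => simp
    | cons r s ih =>
      rw [Multiset.map_cons, Multiset.prod_cons, map_mul]
      exact one_le_mul (hcon r) ih
  have hqs := (IsAlgClosed.splits q).eq_prod_roots
  have hlc : V.valuation (algebraMap k K q.leadingCoeff) = 1 := by
    have hlc0 : q.leadingCoeff ≠ 0 := Polynomial.leadingCoeff_ne_zero.mpr hq0
    have h1 : V.valuation (algebraMap k K q.leadingCoeff) *
        V.valuation (algebraMap k K q.leadingCoeff⁻¹) = 1 := by
      rw [← map_mul, ← map_mul, mul_inv_cancel₀ hlc0, map_one, map_one]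
    refine le_antisymm (hV _) ?_
    rw [← h1]
    exact mul_le_of_le_one_right' (hV _)
  have h3 : Polynomial.aeval a q =
      algebraMap k K q.leadingCoeff * (q.roots.map fun r ↦ a - algebraMap k K r).prod := by
    conv_lhs => rw [hqs]
    rw [map_mul, Polynomial.aeval_C, map_multiset_prod, Multiset.map_map]
    simp
  rw [h3, map_mul, hlc, one_mul] at hqa
  exact absurd (hroots q.roots) (not_le.mpr hqa)

theorem sum_mul_mem_span_of_integral {k K ι : Type*} [Field k] [IsAlgClosed k] [Field K]
    [Algebra k K] [Fintype ι] (y : K) (z a : ι → K)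
    (hy : Transcendental (IntermediateField.adjoin k (Set.range z)) y)
    (ha : ∀ j, IsIntegral (Algebra.adjoin k (Set.range fun j ↦ y * z j)) (a j))
    (hinf : ∀ c : ι → k, ∀ V : ValuationSubring K,
      (∀ c : k, V.valuation (algebraMap k K c) ≤ 1) → V.valuation y⁻¹ ≤ 1 →
      (∀ j, V.valuation (z j) ≤ 1) →
      V.valuation (∑ j, z j * (a j - algebraMap k K (c j))) ≤ 1) :
    ∃ c : ι → k, (∀ j, a j = 0 → c j = 0) ∧ ∑ j, z j * a j = ∑ j, algebraMap k K (c j) * z j := by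
  set F := IntermediateField.adjoin k (Set.range z)
  have hkF : ∀ V : ValuationSubring K, (∀ c : F, V.valuation (algebraMap F K c) ≤ 1) →
      ∀ c : k, V.valuation (algebraMap k K c) ≤ 1 := fun V hV c ↦ hV (algebraMap k F c)
  have hzF : ∀ V : ValuationSubring K, (∀ c : F, V.valuation (algebraMap F K c) ≤ 1) →
      ∀ j, V.valuation (z j) ≤ 1 := fun V hV j ↦
    hV ⟨z j, IntermediateField.subset_adjoin k _ ⟨j, rfl⟩⟩
  obtain ⟨V, hVF, hVy⟩ := exists_valuationSubring_of_transcendental hy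
  have hyz : ∀ w ∈ Set.range fun j ↦ y * z j, V.valuation w < 1 := by
    rintro _ ⟨j, rfl⟩
    simp only [map_mul]
    exact mul_lt_one_of_lt_of_le hVy (hzF V hVF j)
  choose c hc using fun j ↦ isIntegral_adjoin_mem_constantResidue V (hkF V hVF) hyz (ha j)
  have hsum : V.valuation (∑ j, z j * (a j - algebraMap k K (c j))) < 1 := by
    refine Valuation.map_sum_lt _ one_ne_zero fun j _ ↦ ?_
    rw [map_mul]
    exact mul_comm (V.valuation (z j)) _ ▸ mul_lt_one_of_lt_of_le (hc j) (hzF V hVF j)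
  set h := ∑ j, z j * (a j - algebraMap k K (c j)) with hdef
  have h0 : h = 0 := by
    by_contra h0
    have htr : Transcendental F h := transcendental_of_valuation_lt_one V hVF hsum h0
    have htr' : Transcendental F h⁻¹ := fun H ↦ htr (by simpa using H.inv)
    obtain ⟨W, hWF, hWh⟩ := exists_valuationSubring_of_transcendental htr'
    have hWh' : 1 < W.valuation h := by
      by_contra! hcon
      have : W.valuation (h * h⁻¹) < 1 := by
        rw [map_mul, mul_comm]; exact mul_lt_one_of_lt_of_le hWh hcon
      simp [h0] at this
    refine absurd hWh' (not_lt.mpr ?_)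
    rcases W.mem_or_inv_mem y with hyW | hyW
    · have hyW' := (W.valuation_le_one_iff _).mpr hyW
      have haW : ∀ j, W.valuation (a j) ≤ 1 := fun j ↦ by
        refine valuation_le_one_of_isIntegral_adjoin W (hkF W hWF) ?_ (ha j)
        rintro _ ⟨j, rfl⟩
        simpa only [map_mul] using mul_le_one' hyW' (hzF W hWF j)
      refine Valuation.map_sum_le _ fun j _ ↦ ?_
      rw [map_mul]
      exact mul_le_one' (hzF W hWF j) (Valuation.map_sub_le _ (haW j) (hkF W hWF _))
    · exact hinf c W (hkF W hWF) ((W.valuation_le_one_iff _).mpr hyW) (hzF W hWF)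
  refine ⟨c, fun j hj ↦ ?_, ?_⟩
  · by_contra hcj
    have h1 : V.valuation (algebraMap k K (c j) * algebraMap k K (c j)⁻¹) < 1 := by
      rw [map_mul]
      refine mul_lt_one_of_lt_of_le ?_ (hkF V hVF _)
      simpa [hj, Valuation.map_neg] using hc j
    rw [← map_mul, mul_inv_cancel₀ hcj, map_one, map_one] at h1
    exact lt_irrefl _ h1
  · rw [← sub_eq_zero, ← Finset.sum_sub_distrib, ← h0, hdef]
    exact Finset.sum_congr rfl fun j _ ↦ by ring

theorem isIntegral_adjoin_of_forall_valuationSubring {k K : Type*} [Field k] [Field K]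
    [Algebra k K] {s : Set K} {a : K}
    (h : ∀ V : ValuationSubring K, (∀ c : k, V.valuation (algebraMap k K c) ≤ 1) →
      (∀ y ∈ s, V.valuation y ≤ 1) → V.valuation a ≤ 1) :
    IsIntegral (Algebra.adjoin k s) a := by
  have hmem : a ∈ (integralClosure (Subring.closure (Algebra.adjoin k s : Set K)) K).toSubring := by
    rw [← iInf_valuationSubring_superset, Subring.mem_iInf]
    rintro ⟨V, hV⟩
    refine (V.valuation_le_one_iff _).mp (h V (fun c ↦ ?_) fun y hy ↦ ?_)
    · exact (V.valuation_le_one_iff _).mpr (hV ((Algebra.adjoin k s).algebraMap_mem c))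
    · exact (V.valuation_le_one_iff _).mpr (hV (Algebra.subset_adjoin hy))
  obtain ⟨p, hp, hpa⟩ := hmem
  have hle : Subring.closure (Algebra.adjoin k s : Set K) ≤ (Algebra.adjoin k s).toSubring :=
    Subring.closure_le.mpr fun _ hx ↦ hx
  refine ⟨p.map (Subring.inclusion hle), hp.map _, ?_⟩
  rw [Polynomial.eval₂_map]
  exact hpa

theorem transcendental_div_of_algebraicIndependent {k K ι : Type*} [Field k] [Field K]
    [Algebra k K] [Fintype ι] {x0 : K} {x : ι → K} (i0 : ι)
    (hind : AlgebraicIndependent k (fun o : Option ι ↦ o.elim x0 x)) :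
    Transcendental (IntermediateField.adjoin k (Set.range fun j ↦ x j / x i0)) (x i0 / x0) := by
  classical
  intro halg
  set z := fun j ↦ x j / x i0 with hz
  have hx0 : x0 ≠ 0 := hind.ne_zero none
  have hxi : x i0 ≠ 0 := hind.ne_zero (some i0)
  have hzi : z i0 = 1 := div_self hxi
  let M := AlgebraicIndependent.matroid k K
  have hclos : ∀ (t : Set K) (b : K), b ∈ M.closure t ↔ IsAlgebraic (Algebra.adjoin k t) b := by
    intro t b
    rw [AlgebraicIndependent.matroid_closure_eq]
    rfl
  let s : Set K := insert (x i0) (z '' {j | j ≠ i0})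
  have hscl : ∀ b ∈ s, b ∈ M.closure s := fun b hb ↦ M.mem_closure_of_mem hb
  have hzs : Set.range z ⊆ M.closure s := by
    rintro _ ⟨j, rfl⟩
    by_cases hj : j = i0
    · rw [hj, hzi, hclos]
      exact isAlgebraic_one
    · exact hscl _ (Or.inr ⟨j, hj, rfl⟩)
  have hy : x i0 / x0 ∈ M.closure s := by
    have h1 : x i0 / x0 ∈ M.closure (Set.range z) := by
      rw [hclos]
      exact IntermediateField.isAlgebraic_adjoin_iff.mp halg
    exact M.closure_subset_closure_of_subset_closure hzs h1
  have hxs : Set.range (fun o : Option ι ↦ o.elim x0 x) ⊆ M.closure s := by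
    rintro _ ⟨_ | j, rfl⟩
    · have h1 := (hclos _ _).mp (hscl (x i0) (Set.mem_insert _ _))
      have h2 := (hclos _ _).mp hy
      rw [hclos]
      have h3 := h1.mul h2.inv
      rwa [inv_div, mul_div_cancel₀ _ hxi] at h3
    · have h1 := (hclos _ _).mp (hscl (x i0) (Set.mem_insert _ _))
      have h2 := (hclos _ _).mp (hzs ⟨j, rfl⟩)
      rw [hclos]
      have h3 := h1.mul h2
      rwa [hz, mul_div_cancel₀ _ hxi] at h3
  have hI : M.Indep (Set.range (fun o : Option ι ↦ o.elim x0 x)) := hind.to_subtype_range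
  have hcard := hI.encard_le_eRk_of_subset hxs
  rw [M.eRk_closure_eq] at hcard
  have hcard2 := hcard.trans (M.eRk_le_encard s)
  have h1 : (Set.range (fun o : Option ι ↦ o.elim x0 x)).encard = Fintype.card ι + 1 := by
    rw [← Set.image_univ, hind.injective.encard_image, Set.encard_univ]
    simp
  have h2 : s.encard ≤ Fintype.card ι := by
    have h3 : (z '' {j | j ≠ i0}).encard ≤ (Fintype.card ι - 1 : ℕ) := by
      refine (Set.encard_image_le _ _).trans ?_
      have : {j | j ≠ i0} = ((Finset.univ.erase i0 : Finset ι) : Set ι) := by ext; simp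
      rw [this, Set.encard_coe_eq_coe_finsetCard, Finset.card_erase_of_mem (Finset.mem_univ _)]
      rfl
    refine (Set.encard_insert_le _ _).trans ((add_le_add_left h3 1).trans ?_)
    have := Fintype.card_pos_iff.mpr ⟨i0⟩
    norm_cast
    omega
  rw [h1] at hcard2
  have := hcard2.trans h2
  norm_cast at this
  omega

theorem exists_eq_sum_of_mem_ideal {k K σ ι : Type*} [Field k] [IsAlgClosed k] [Field K]
    [Algebra k K] [Fintype ι] (i0 : ι) (X : σ → K) (x0 : K) (x : ι → K)
    (hind : AlgebraicIndependent k (fun o : Option ι ↦ o.elim x0 x))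
    (hval : ∀ V : ValuationSubring K, (∀ c : k, V.valuation (algebraMap k K c) ≤ 1) →
      ∃ o : Option ι, ∀ i, V.valuation (X i) ≤ V.valuation (o.elim x0 x))
    (f : K) (hf : f ∈ Submodule.span k (Set.range X)) (a : ι → K)
    (ha : ∀ j, a j ∈ Algebra.adjoin k (Set.range fun i ↦ X i / x0))
    (hfa : f = ∑ j, x j * a j) :
    ∃ c : ι → k, (∀ j, a j = 0 → c j = 0) ∧ f = ∑ j, algebraMap k K (c j) * x j := by
  have hx0 : x0 ≠ 0 := hind.ne_zero none
  have hxi : x i0 ≠ 0 := hind.ne_zero (some i0)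
  have hdiv : ∀ (V : ValuationSubring K) (p q : K), q ≠ 0 →
      (V.valuation (p / q) ≤ 1 ↔ V.valuation p ≤ V.valuation q) := by
    intro V p q hq
    rw [map_div₀, div_le_one₀ ((V.valuation.pos_iff).mpr hq)]
  have hyz : ∀ j, x i0 / x0 * (x j / x i0) = x j / x0 := fun j ↦ by field_simp
  have hz : f / x i0 = ∑ j, x j / x i0 * a j := by
    rw [hfa, Finset.sum_div]
    exact Finset.sum_congr rfl fun j _ ↦ by ring
  obtain ⟨c, hc0, hc⟩ := sum_mul_mem_span_of_integral (x i0 / x0) (fun j ↦ x j / x i0) a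
    (transcendental_div_of_algebraicIndependent i0 hind) (fun j ↦ by
      refine isIntegral_adjoin_of_forall_valuationSubring fun V hV hVy ↦ ?_
      have hxx : ∀ j, V.valuation (x j) ≤ V.valuation x0 := fun j ↦
        (hdiv V _ _ hx0).mp (by simpa only [hyz] using hVy _ ⟨j, rfl⟩)
      have hX : ∀ i, V.valuation (X i) ≤ V.valuation x0 := by
        obtain ⟨_ | j, ho⟩ := hval V hV
        · exact ho
        · exact fun i ↦ (ho i).trans (hxx j)
      refine valuation_le_one_of_isIntegral_adjoin V hV (s := Set.range fun i ↦ X i / x0) ?_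
        (isIntegral_algebraMap (x := (⟨a j, ha j⟩ : Algebra.adjoin k _)))
      rintro _ ⟨i, rfl⟩
      exact (hdiv V _ _ hx0).mpr (hX i))
    (fun c V hV hVy hVz ↦ by
      have hxx : ∀ j, V.valuation (x j) ≤ V.valuation (x i0) := fun j ↦
        (hdiv V _ _ hxi).mp (hVz j)
      have hxx0 : V.valuation x0 ≤ V.valuation (x i0) := (hdiv V _ _ hxi).mp (by simpa using hVy)
      have hX : ∀ i, V.valuation (X i) ≤ V.valuation (x i0) := by
        obtain ⟨_ | j, ho⟩ := hval V hV
        · exact fun i ↦ (ho i).trans hxx0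
        · exact fun i ↦ (ho i).trans (hxx j)
      have hfV : V.valuation f ≤ V.valuation (x i0) := by
        clear hfa hz
        induction hf using Submodule.span_induction with
        | mem y hy => obtain ⟨i, rfl⟩ := hy; exact hX i
        | zero => simp
        | add y z _ _ hy hz => exact Valuation.map_add_le _ hy hz
        | smul r y _ hy =>
          rw [Algebra.smul_def, map_mul]
          exact (mul_le_of_le_one_left' (hV r)).trans hy
      have : ∑ j, x j / x i0 * (a j - algebraMap k K (c j)) =
          f / x i0 - ∑ j, x j / x i0 * algebraMap k K (c j) := by
        rw [hz, ← Finset.sum_sub_distrib]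
        exact Finset.sum_congr rfl fun j _ ↦ by ring
      rw [this]
      refine Valuation.map_sub_le _ ((hdiv V _ _ hxi).mpr hfV) (Valuation.map_sum_le _ fun j _ ↦ ?_)
      rw [map_mul]
      exact mul_le_one' (hVz j) (hV _))
  refine ⟨c, hc0, ?_⟩
  rw [← hz, div_eq_iff hxi, Finset.sum_mul] at hc
  rw [hc]
  exact Finset.sum_congr rfl fun j _ ↦ by field_simp

theorem ringKrullDim_le_of_ringHom_isIntegral {P R : Type*} [CommRing P] [CommRing R]
    (f : P →+* R) (hf : f.IsIntegral) : ringKrullDim R ≤ ringKrullDim P := by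
  let := f.toAlgebra
  have : Algebra.IsIntegral P R := ⟨hf⟩
  refine Order.krullDim_le_of_strictMono (PrimeSpectrum.comap f) fun p q hpq ↦ ?_
  exact Ideal.IsIntegral.comap_lt_comap (R := P) (I := p.asIdeal) (J := q.asIdeal) hpq

theorem algebraicIndependent_of_forall_valuation_le {k K σ τ : Type*} [Field k] [Field K]
    [Algebra k K] [Fintype τ] (X : σ → K) (x : τ → K)
    (hx : ∀ o, x o ∈ Algebra.adjoin k (Set.range X))
    (hval : ∀ V : ValuationSubring K, (∀ c : k, V.valuation (algebraMap k K c) ≤ 1) →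
      ∃ o, ∀ i, V.valuation (X i) ≤ V.valuation (x o))
    (hdim : (Fintype.card τ : WithBot ℕ∞) ≤ ringKrullDim (Algebra.adjoin k (Set.range X))) :
    AlgebraicIndependent k x := by
  have hle : Algebra.adjoin k (Set.range x) ≤ Algebra.adjoin k (Set.range X) :=
    Algebra.adjoin_le (Set.range_subset_iff.mpr hx)
  have hint (y : K) (hy : y ∈ Algebra.adjoin k (Set.range X)) :
      IsIntegral (Algebra.adjoin k (Set.range x)) y := by
    have : Algebra.adjoin k (Set.range X) ≤
        (integralClosure (Algebra.adjoin k (Set.range x)) K).restrictScalars k := by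
      refine Algebra.adjoin_le ?_
      rintro _ ⟨i, rfl⟩
      refine isIntegral_adjoin_of_forall_valuationSubring fun V hV hV' ↦ ?_
      obtain ⟨o, ho⟩ := hval V hV
      exact (ho i).trans (hV' _ ⟨o, rfl⟩)
    exact this hy
  have hdim' := ringKrullDim_le_of_ringHom_isIntegral (Subalgebra.inclusion hle).toRingHom (by
    rintro ⟨y, hy⟩
    obtain ⟨p, hp, hp'⟩ := hint y hy
    refine ⟨p, hp, Subtype.ext ?_⟩
    rw [← Subalgebra.coe_val, ← AlgHom.coe_toRingHom, Polynomial.hom_eval₂]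
    exact hp')
  by_contra hind
  rw [algebraicIndependent_iff_injective_aeval, injective_iff_map_eq_zero] at hind
  push Not at hind
  obtain ⟨p, hp, hp0⟩ := hind
  let F : MvPolynomial τ k →ₐ[k] Algebra.adjoin k (Set.range x) :=
    (aeval x).codRestrict _ fun q ↦ by
      rw [Algebra.adjoin_range_eq_range_aeval]
      exact ⟨q, rfl⟩
  have hF : Function.Surjective F := by
    rintro ⟨y, hy⟩
    have hy' := hy
    rw [Algebra.adjoin_range_eq_range_aeval] at hy'
    obtain ⟨q, hq⟩ := hy'
    exact ⟨q, Subtype.ext hq⟩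
  have h1 := ringKrullDim_succ_le_of_surjective F.toRingHom hF
    (mem_nonZeroDivisors_of_ne_zero hp0) (Subtype.ext hp)
  rw [MvPolynomial.ringKrullDim_of_isNoetherianRing, ringKrullDim_eq_zero_of_field, zero_add,
    Nat.card_eq_fintype_card] at h1
  have h2 := (add_le_add_left (hdim.trans hdim') 1).trans h1
  norm_cast at h2
  omega

theorem aeval_mul_left_of_isHomogeneous {σ k K : Type*} [CommSemiring k] [CommSemiring K]
    [Algebra k K] {p : MvPolynomial σ k} {n : ℕ} (hp : p.IsHomogeneous n) (t : K) (y : σ → K) :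
    aeval (fun i ↦ t * y i) p = t ^ n * aeval y p := by
  simp only [aeval_def, eval₂_eq, Finset.mul_sum]
  refine Finset.sum_congr rfl fun d hd ↦ ?_
  have h1 : ∑ i ∈ d.support, d i = n := by
    have := hp (mem_support_iff.mp hd)
    simpa [Finsupp.weight_apply, Finsupp.sum] using this
  rw [← h1, ← Finset.prod_pow_eq_pow_sum]
  simp only [mul_pow, Finset.prod_mul_distrib]
  ring

theorem exists_valuation_le_of_no_common_zero {σ k K τ : Type*} [Finite σ] [Field k] [Field K]
    [Algebra k K] (X : σ → K) (hX : ∃ s, X s ≠ 0) (l : τ → MvPolynomial σ k)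
    (hl : ∀ o, (l o).IsHomogeneous 1)
    (hzero : ∀ p : ProjectiveSpectrum (homogeneousSubmodule σ k),
      (∀ q n, q.IsHomogeneous n → aeval X q = 0 → q ∈ p.asHomogeneousIdeal) →
      ∃ o, l o ∉ p.asHomogeneousIdeal)
    (V : ValuationSubring K) (hV : ∀ c : k, V.valuation (algebraMap k K c) ≤ 1) :
    ∃ o, ∀ i, V.valuation (X i) ≤ V.valuation (aeval X (l o)) := by
  obtain ⟨s0, hs0⟩ := hX
  have : Nonempty σ := ⟨s0⟩
  obtain ⟨s, hs⟩ := Finite.exists_max fun i ↦ V.valuation (X i)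
  have hXs : X s ≠ 0 := fun h ↦ by
    have := hs s0
    rw [h, map_zero, le_zero_iff, Valuation.zero_iff] at this
    exact hs0 this
  have hvs : 0 < V.valuation (X s) := zero_lt_iff.mpr (by simpa using hXs)
  have hmem (i : σ) : X i / X s ∈ V := by
    rw [← V.valuation_le_one_iff, map_div₀]
    exact div_le_one_of_le₀ (hs i) zero_le
  let c : k →+* V := (algebraMap k K).codRestrict V.toSubring fun c ↦
    (V.valuation_le_one_iff _).mp (hV c)
  let φ : MvPolynomial σ k →+* V := eval₂Hom c fun i ↦ ⟨X i / X s, hmem i⟩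
  have hφ (q : MvPolynomial σ k) : (φ q : K) = aeval (fun i ↦ (X s)⁻¹ * X i) q := by
    have : (V.subtype.comp φ) = (aeval (R := k) (fun i ↦ (X s)⁻¹ * X i)).toRingHom := by
      apply MvPolynomial.ringHom_ext
      · intro r
        simp [φ, c]
      · intro i
        simp [φ, div_eq_inv_mul]
    exact RingHom.congr_fun this q
  let 𝔭 : Ideal (MvPolynomial σ k) := RingHom.ker ((IsLocalRing.residue V).comp φ)
  have h𝔭 : 𝔭.IsPrime := RingHom.ker_isPrime _
  have hmem𝔭 (q : MvPolynomial σ k) : q ∈ 𝔭 ↔ V.valuation (φ q : K) < 1 := by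
    rw [RingHom.mem_ker, RingHom.comp_apply, IsLocalRing.residue_eq_zero_iff,
      V.valuation_lt_one_iff]
  let P : ProjectiveSpectrum (homogeneousSubmodule σ k) :=
    { asHomogeneousIdeal := 𝔭.homogeneousCore _
      isPrime := h𝔭.homogeneousCore
      not_irrelevant_le := fun h ↦ by
        have h1 : (MvPolynomial.X s : MvPolynomial σ k) ∈
            HomogeneousIdeal.irrelevant (homogeneousSubmodule σ k) := by
          rw [HomogeneousIdeal.mem_irrelevant_iff]
          exact DirectSum.decompose_of_mem_ne _
            ((mem_homogeneousSubmodule _ _).mpr (isHomogeneous_X k s)) one_ne_zero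
        have h2 := Ideal.toIdeal_homogeneousCore_le _ 𝔭 (h h1)
        rw [hmem𝔭, hφ] at h2
        simp [hXs] at h2 }
  have hP (q : MvPolynomial σ k) (n : ℕ) (hq : q.IsHomogeneous n) :
      q ∈ P.asHomogeneousIdeal ↔ V.valuation ((X s)⁻¹ ^ n * aeval X q) < 1 := by
    rw [← aeval_mul_left_of_isHomogeneous hq, ← hφ, ← hmem𝔭]
    exact ⟨fun h ↦ Ideal.toIdeal_homogeneousCore_le _ 𝔭 h, fun h ↦
      Ideal.mem_homogeneousCore_of_homogeneous_of_mem ⟨n, hq⟩ h⟩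
  obtain ⟨o, ho⟩ := hzero P fun q n hq h ↦ by
    rw [hP q n hq, h]; simp
  refine ⟨o, fun i ↦ (hs i).trans ?_⟩
  rw [hP _ 1 (hl o), pow_one, not_lt, map_mul, map_inv₀] at ho
  rwa [← div_eq_inv_mul, one_le_div₀ hvs] at ho

theorem asHomogeneousIdeal_lt_ker_constantCoeff {σ k : Type*} [Field k]
    (p : ProjectiveSpectrum (homogeneousSubmodule σ k)) :
    p.asHomogeneousIdeal.toIdeal < RingHom.ker (constantCoeff (σ := σ) (R := k)) := by
  refine lt_of_le_of_ne (fun q hq ↦ ?_) fun h ↦ p.not_irrelevant_le fun q hq ↦ ?_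
  · by_contra hne
    rw [RingHom.mem_ker, constantCoeff_eq] at hne
    have h1 : GradedRing.proj (homogeneousSubmodule σ k) 0 q ∈ p.asHomogeneousIdeal.toIdeal :=
      p.asHomogeneousIdeal.isHomogeneous 0 hq
    have h2 : GradedRing.proj (homogeneousSubmodule σ k) 0 q = C (coeff 0 q) := by
      rw [← homogeneousComponent_zero, ← decomposition.decompose'_apply]
      rfl
    rw [h2] at h1
    exact p.isPrime.ne_top (Ideal.eq_top_of_isUnit_mem _ h1 ((IsUnit.mk0 _ hne).map C))
  · have h1 : GradedRing.proj (homogeneousSubmodule σ k) 0 q = C (coeff 0 q) := by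
      rw [← homogeneousComponent_zero, ← decomposition.decompose'_apply]
      rfl
    rw [HomogeneousIdeal.mem_irrelevant_iff, h1, C_eq_zero] at hq
    change q ∈ p.asHomogeneousIdeal.toIdeal
    rwa [h, RingHom.mem_ker, constantCoeff_eq]

theorem topologicalKrullDim_add_one_le_ringKrullDim_quotient {σ k Y : Type*} [Field k]
    [TopologicalSpace Y] [QuasiSober Y] [Nonempty Y]
    {f : Y → ProjectiveSpectrum (homogeneousSubmodule σ k)} (hf : Topology.IsInducing f)
    (I : Ideal (MvPolynomial σ k)) (hI : ∀ y, I ≤ (f y).asHomogeneousIdeal.toIdeal) :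
    topologicalKrullDim Y + 1 ≤ ringKrullDim (MvPolynomial σ k ⧸ I) := by
  classical
  have : Nonempty (TopologicalSpace.IrreducibleCloseds Y) :=
    ⟨⟨closure {Classical.arbitrary Y}, isIrreducible_singleton.closure, isClosed_closure⟩⟩
  rw [ringKrullDim_quotient, topologicalKrullDim, ← Order.krullDim_withBot,
    ← Order.krullDim_orderDual (α := PrimeSpectrum.zeroLocus _)]
  let g (T : TopologicalSpace.IrreducibleCloseds Y) :
      PrimeSpectrum.zeroLocus (R := MvPolynomial σ k) I :=
    ⟨⟨(f T.2.genericPoint).asHomogeneousIdeal.toIdeal, (f T.2.genericPoint).isPrime⟩, hI _⟩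
  let b : PrimeSpectrum.zeroLocus (R := MvPolynomial σ k) I :=
    ⟨⟨RingHom.ker (constantCoeff (σ := σ) (R := k)), RingHom.ker_isPrime _⟩,
      (hI (Classical.arbitrary Y)).trans (asHomogeneousIdeal_lt_ker_constantCoeff _).le⟩
  have hg (T T' : TopologicalSpace.IrreducibleCloseds Y) : g T' ≤ g T ↔ T ≤ T' := by
    have h1 := T.2.isGenericPoint_genericPoint T.3
    have h2 := T'.2.isGenericPoint_genericPoint T'.3
    change f T'.2.genericPoint ≤ f T.2.genericPoint ↔ (T : Set Y) ⊆ T'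
    rw [ProjectiveSpectrum.le_iff_mem_closure, ← specializes_iff_mem_closure, hf.specializes_iff,
      specializes_iff_mem_closure, h2.def]
    exact (h1.mem_closed_set_iff T'.3)
  refine Order.krullDim_le_of_strictMono
    (fun T ↦ OrderDual.toDual (WithBot.recBotCoe (C := fun _ ↦ _) b g T)) ?_
  intro T T' hT
  rw [OrderDual.toDual_lt_toDual]
  induction T' using WithBot.recBotCoe with
  | bot => exact absurd hT (by simp)
  | coe T' =>
    induction T using WithBot.recBotCoe with
    | bot => exact asHomogeneousIdeal_lt_ker_constantCoeff _
    | coe T =>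
      rw [WithBot.coe_lt_coe] at hT
      simpa only [lt_iff_le_not_ge, WithBot.recBotCoe_coe, hg] using hT

theorem exists_X_notMem_asHomogeneousIdeal {σ k : Type*} [Field k]
    (p : ProjectiveSpectrum (homogeneousSubmodule σ k)) : ∃ i, X i ∉ p.asHomogeneousIdeal := by
  by_contra! h
  refine (asHomogeneousIdeal_lt_ker_constantCoeff p).not_ge fun q hq ↦ ?_
  have h1 : q ∈ Ideal.span (X '' (Set.univ : Set σ)) := by
    refine mem_ideal_span_X_image.mpr fun d hd ↦ ?_
    by_contra! h0
    have hd0 : d = 0 := Finsupp.ext fun i ↦ h0 i (Set.mem_univ i)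
    rw [RingHom.mem_ker, constantCoeff_eq] at hq
    exact mem_support_iff.mp hd (hd0 ▸ hq)
  rw [Set.image_univ] at h1
  exact (Ideal.span_le.mpr (Set.range_subset_iff.mpr h)) h1

theorem exists_linear_forms_no_common_zero {σ k : Type*} [Finite σ] [Field k] [Infinite k]
    (n : ℕ) (I : Ideal (MvPolynomial σ k)) (hI : I.IsHomogeneous (homogeneousSubmodule σ k))
    (hn : ∀ s : LTSeries (ProjectiveSpectrum (homogeneousSubmodule σ k)),
      I ≤ s.head.asHomogeneousIdeal.toIdeal → s.length < n) :
    ∃ l : Fin n → MvPolynomial σ k, (∀ i, (l i).IsHomogeneous 1) ∧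
      ∀ p : ProjectiveSpectrum (homogeneousSubmodule σ k), I ≤ p.asHomogeneousIdeal.toIdeal →
        ∃ i, l i ∉ p.asHomogeneousIdeal := by
  induction n generalizing I with
  | zero =>
    exact ⟨Fin.elim0, fun i ↦ i.elim0, fun p hp ↦ absurd (hn (RelSeries.singleton _ p) hp) (by simp)⟩
  | succ n ih =>
    let S : Set (Ideal (MvPolynomial σ k)) := {P ∈ I.minimalPrimes | ∃ i, X i ∉ P}
    have hSfin : S.Finite := I.finite_minimalPrimes_of_isNoetherianRing.subset fun P hP ↦ hP.1
    let E := homogeneousSubmodule σ k 1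
    let W (P : Ideal (MvPolynomial σ k)) : Submodule k E :=
      (P.restrictScalars k).comap E.subtype
    have hmem (i : σ) : X i ∈ E := (mem_homogeneousSubmodule _ _).mpr (isHomogeneous_X k i)
    have htop : ⊤ ∉ (hSfin.image W).toFinset := by
      rw [Set.Finite.mem_toFinset]
      rintro ⟨P, ⟨_, i, hi⟩, hP⟩
      have : (⟨X i, hmem i⟩ : E) ∈ W P := hP ▸ Submodule.mem_top
      exact hi this
    have hne := Subspace.biUnion_ne_univ_of_top_notMem htop
    rw [Set.ne_univ_iff_exists_notMem] at hne
    obtain ⟨⟨l, hl⟩, hlS⟩ := hne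
    have hlS' (P) (hP : P ∈ S) : l ∉ P := fun h ↦ hlS <|
      Set.mem_biUnion ((hSfin.image W).mem_toFinset.mpr ⟨P, hP, rfl⟩) h
    have hI' : (I ⊔ Ideal.span {l}).IsHomogeneous (homogeneousSubmodule σ k) := by
      refine hI.sup (Ideal.homogeneous_span _ _ ?_)
      rintro _ rfl
      exact ⟨1, hl⟩
    obtain ⟨l', hl', hzero⟩ := ih (I ⊔ Ideal.span {l}) hI' fun s hs ↦ by
      obtain ⟨hsI, hsl⟩ := sup_le_iff.mp hs
      have := s.head.isPrime
      obtain ⟨P, hP, hPs⟩ := Ideal.exists_minimalPrimes_le hsI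
      have hPp : P.IsPrime := hP.1.1
      obtain ⟨i, hi⟩ := exists_X_notMem_asHomogeneousIdeal s.head
      have hlP := hlS' P ⟨hP, i, fun h ↦ hi (hPs h)⟩
      have hcore := Ideal.toIdeal_homogeneousCore_le (homogeneousSubmodule σ k) P
      let Q : ProjectiveSpectrum (homogeneousSubmodule σ k) :=
        { asHomogeneousIdeal := P.homogeneousCore _
          isPrime := hPp.homogeneousCore
          not_irrelevant_le := fun h ↦ s.head.not_irrelevant_le (h.trans (hcore.trans hPs)) }
      have hQ : Q < s.head := lt_of_le_not_ge (hcore.trans hPs) fun h ↦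
        hlP (hcore (h (hsl (Ideal.mem_span_singleton_self l))))
      have hIQ : I ≤ Q.asHomogeneousIdeal.toIdeal := by
        rw [← hI.toIdeal_homogeneousCore_eq_self]
        exact Ideal.homogeneousCore_mono _ hP.1.2
      have := hn (s.cons Q hQ) hIQ
      rw [RelSeries.cons_length] at this
      omega
    refine ⟨Fin.cons l l', fun i ↦ ?_, fun p hp ↦ ?_⟩
    · refine Fin.cases ?_ (fun i ↦ ?_) i
      · exact hl
      · exact hl' i
    · by_cases hlp : l ∈ p.asHomogeneousIdeal
      · obtain ⟨i, hi⟩ := hzero p (sup_le hp (Ideal.span_le.mpr (by simpa using hlp)))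
        exact ⟨i.succ, hi⟩
      · exact ⟨0, hlp⟩

theorem length_le_topologicalKrullDim {σ k Y : Type*} [Field k] [TopologicalSpace Y]
    {f : Y → ProjectiveSpectrum (homogeneousSubmodule σ k)} (hf : Topology.IsInducing f)
    (s : LTSeries (ProjectiveSpectrum (homogeneousSubmodule σ k)))
    (hs : ∀ p, s.head ≤ p → p ∈ Set.range f) :
    (s.length : WithBot ℕ∞) ≤ topologicalKrullDim Y := by
  choose y hy using fun i ↦ hs (s i) (s.head_le i)
  rw [topologicalKrullDim, ← Order.krullDim_orderDual]
  let g (y : Y) : TopologicalSpace.IrreducibleCloseds Y :=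
    ⟨closure {y}, isIrreducible_singleton.closure, isClosed_closure⟩
  have hg (y y' : Y) : g y ≤ g y' ↔ f y' ≤ f y := by
    rw [ProjectiveSpectrum.le_iff_mem_closure, ← specializes_iff_mem_closure, hf.specializes_iff,
      specializes_iff_closure_subset]
    rfl
  refine Order.LTSeries.length_le_krullDim ⟨s.length, fun i ↦ OrderDual.toDual (g (y i)), fun i ↦ ?_⟩
  change OrderDual.toDual (g (y i.castSucc)) < OrderDual.toDual (g (y i.succ))
  rw [OrderDual.toDual_lt_toDual, lt_iff_le_not_ge, hg, hg, hy, hy, ← lt_iff_le_not_ge]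
  exact s.step i

/-- The linear form on affine space attached to an element of the dual space. -/
noncomputable def linearForm {σ k : Type*} [Finite σ] [Field k] :
    Module.Dual k (σ → k) →ₗ[k] MvPolynomial σ k :=
  letI := Fintype.ofFinite σ
  letI := Classical.decEq σ
  ∑ i, (LinearMap.toSpanSingleton k (MvPolynomial σ k) (X i)).comp
    (Module.Dual.eval k (σ → k) (Pi.single i 1))

theorem isHomogeneous_linearForm {σ k : Type*} [Finite σ] [Field k]
    (φ : Module.Dual k (σ → k)) : (linearForm φ).IsHomogeneous 1 := by
  rw [linearForm, LinearMap.sum_apply]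
  refine IsHomogeneous.sum _ _ _ fun i _ ↦ ?_
  exact (homogeneousSubmodule σ k 1).smul_mem _ (isHomogeneous_X k i)

theorem eval_linearForm {σ k : Type*} [Finite σ] [Field k]
    (φ : Module.Dual k (σ → k)) (w : σ → k) : eval w (linearForm φ) = φ w := by
  let := Fintype.ofFinite σ
  let := Classical.decEq σ
  conv_rhs => rw [pi_eq_sum_univ' w]
  simp only [linearForm, LinearMap.sum_apply, map_sum, map_smul]
  refine Finset.sum_congr rfl fun i _ ↦ ?_
  simp only [LinearMap.comp_apply, LinearMap.toSpanSingleton_apply, Module.Dual.eval_apply,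
    smul_eval, eval_X, smul_eq_mul]
  rw [mul_comm]

theorem exists_linearForm_eq {σ k : Type*} [Finite σ] [Field k] {l : MvPolynomial σ k}
    (hl : l.IsHomogeneous 1) : ∃ φ : Module.Dual k (σ → k), linearForm φ = l := by
  let := Fintype.ofFinite σ
  let := Classical.decEq σ
  have h : l ∈ Submodule.span k (Set.range (X : σ → MvPolynomial σ k)) := by
    rw [← homogeneousSubmodule_one_eq_span_X]; exact hl
  suffices hle : Submodule.span k (Set.range (X : σ → MvPolynomial σ k)) ≤
      LinearMap.range linearForm from hle h
  refine Submodule.span_le.mpr ?_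
  rintro _ ⟨i, rfl⟩
  refine ⟨LinearMap.proj i, ?_⟩
  simp only [linearForm, LinearMap.sum_apply]
  rw [Finset.sum_eq_single i]
  · simp [LinearMap.toSpanSingleton_apply]
  · intro j _ hj
    simp [LinearMap.toSpanSingleton_apply, hj.symm]
  · simp

theorem aeval_div_mem_adjoin {σ k K : Type*} [Field k] [Field K] [Algebra k K] (x : σ → K) (x0 : K)
    {l : MvPolynomial σ k} (hl : l.IsHomogeneous 1) :
    aeval x l / x0 ∈ Algebra.adjoin k (Set.range fun i ↦ x i / x0) := by
  have h := aeval_mul_left_of_isHomogeneous hl x0⁻¹ x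
  rw [pow_one, inv_mul_eq_div] at h
  rw [← h, Algebra.adjoin_range_eq_range_aeval]
  simp only [inv_mul_eq_div]
  exact ⟨l, rfl⟩

set_option maxHeartbeats 400000 in
theorem exists_linear_form_chart {σ k K : Type*} [Fintype σ] [Field k] [IsAlgClosed k] [Field K]
    [Algebra k K] {m : ℕ} (hm : 1 ≤ m) (x : σ → K) (hx : ∃ s, x s ≠ 0)
    (hnd : ∀ l : MvPolynomial σ k, l.IsHomogeneous 1 → aeval x l = 0 → l = 0)
    (hhom : (RingHom.ker (aeval (R := k) x)).IsHomogeneous (homogeneousSubmodule σ k))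
    (hdim : (m : WithBot ℕ∞) + 1 ≤
      ringKrullDim (MvPolynomial σ k ⧸ RingHom.ker (aeval (R := k) x)))
    (W : Submodule k (σ → k)) (hW : Fintype.card σ ≤ Module.finrank k W + m)
    (hseries : ∀ s : LTSeries (ProjectiveSpectrum (homogeneousSubmodule σ k)),
      RingHom.ker (aeval (R := k) x) ≤ s.head.asHomogeneousIdeal.toIdeal →
      (∀ l : MvPolynomial σ k, l.IsHomogeneous 1 → (∀ w ∈ W, eval w l = 0) →
        l ∈ s.head.asHomogeneousIdeal) →
      s.length ≤ Module.finrank k W + m - Fintype.card σ) :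
    ∃ l₀ : MvPolynomial σ k, l₀.IsHomogeneous 1 ∧ aeval x l₀ ≠ 0 ∧
      ∀ f : MvPolynomial σ k, f.IsHomogeneous 1 →
      ∀ y : Algebra.adjoin k (Set.range fun i ↦ x i / aeval x l₀),
        (y : K) = aeval x f / aeval x l₀ →
        y ∈ Ideal.span {a : Algebra.adjoin k (Set.range fun i ↦ x i / aeval x l₀) |
          ∃ l : MvPolynomial σ k, l.IsHomogeneous 1 ∧ (∀ w ∈ W, eval w l = 0) ∧
            (a : K) = aeval x l / aeval x l₀} →
        ∀ w ∈ W, eval w f = 0 := by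
  classical
  have : Infinite k := IsAlgClosed.instInfinite
  let c := Module.finrank k W.dualAnnihilator
  have : Module.Free k W.dualAnnihilator := by
    let : AddCommGroup (Module.Dual k (σ → k)) := inferInstance
    exact Module.Free.of_divisionRing k (W.dualAnnihilator : Submodule k (Module.Dual k (σ → k)))
  let b : Module.Basis (Fin c) k W.dualAnnihilator := Module.finBasis k _
  have hc : Module.finrank k W + c = Fintype.card σ := by
    have := Subspace.finrank_add_finrank_dualAnnihilator_eq W
    rwa [Module.finrank_fintype_fun_eq_card] at this
  let lA (j : Fin c) : MvPolynomial σ k := linearForm (b j : Module.Dual k (σ → k))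
  have hlA (j) : (lA j).IsHomogeneous 1 := isHomogeneous_linearForm _
  have hlAW (j) (w) (hw : w ∈ W) : eval w (lA j) = 0 := by
    rw [eval_linearForm]
    exact (Submodule.mem_dualAnnihilator _).mp (b j).2 w hw
  have hspan (l : MvPolynomial σ k) (hl : l.IsHomogeneous 1) (hlW : ∀ w ∈ W, eval w l = 0) :
      ∃ a : Fin c → k, l = ∑ j, a j • lA j := by
    obtain ⟨φ, rfl⟩ := exists_linearForm_eq hl
    have hφ : φ ∈ W.dualAnnihilator := (Submodule.mem_dualAnnihilator _).mpr fun w hw ↦ by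
      rw [← eval_linearForm]; exact hlW w hw
    refine ⟨b.repr ⟨φ, hφ⟩, ?_⟩
    have h := congrArg (fun z : W.dualAnnihilator ↦ linearForm (z : Module.Dual k (σ → k)))
      (b.sum_repr ⟨φ, hφ⟩)
    simp only [Submodule.coe_sum, map_sum, Submodule.coe_smul, map_smul] at h
    exact h.symm
  let I := RingHom.ker (aeval (R := k) x)
  obtain ⟨l', hl', hzero⟩ := exists_linear_forms_no_common_zero (m - c + 1)
    (I ⊔ Ideal.span (Set.range lA))
    (hhom.sup (Ideal.homogeneous_span _ _ (by rintro _ ⟨j, rfl⟩; exact ⟨1, hlA j⟩)))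
    fun s hs ↦ by
      obtain ⟨h1, h2⟩ := sup_le_iff.mp hs
      have := hseries s h1 fun l hl hlW ↦ by
        obtain ⟨a, rfl⟩ := hspan l hl hlW
        change _ ∈ s.head.asHomogeneousIdeal.toIdeal
        refine Ideal.sum_mem _ fun j _ ↦ ?_
        rw [MvPolynomial.smul_eq_C_mul]
        exact Ideal.mul_mem_left _ _ (h2 (Ideal.subset_span ⟨j, rfl⟩))
      omega
  let ι := Fin c ⊕ Fin (m - c)
  let L : Option ι → MvPolynomial σ k := fun o ↦ o.elim (l' 0) (Sum.elim lA fun i ↦ l' i.succ)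
  have hL (o) : (L o).IsHomogeneous 1 := by
    rcases o with _ | j | i
    exacts [hl' 0, hlA j, hl' _]
  have hval := exists_valuation_le_of_no_common_zero x hx L hL fun p hp ↦ by
    by_contra! hLp
    have hle : I ⊔ Ideal.span (Set.range lA) ≤ p.asHomogeneousIdeal.toIdeal := by
      refine sup_le (fun q hq ↦ ?_) (Ideal.span_le.mpr ?_)
      · rw [← DirectSum.sum_support_decompose (homogeneousSubmodule σ k) q]
        refine Ideal.sum_mem _ fun n _ ↦ hp _ n ?_ ?_
        · exact (DirectSum.decompose (homogeneousSubmodule σ k) q n).2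
        · exact hhom n hq
      · rintro _ ⟨j, rfl⟩
        exact hLp (some (Sum.inl j))
    obtain ⟨i, hi⟩ := hzero p hle
    revert hi
    exact Fin.cases (fun h ↦ h (hLp none)) (fun i h ↦ h (hLp (some (Sum.inr i)))) i
  have hind : AlgebraicIndependent k (fun o ↦ aeval x (L o)) := by
    refine algebraicIndependent_of_forall_valuation_le x _ (fun o ↦ ?_) hval ?_
    · rw [Algebra.adjoin_range_eq_range_aeval]
      exact ⟨_, rfl⟩
    · have hcard : Fintype.card (Option ι) = m + 1 := by
        simp only [ι, Fintype.card_option, Fintype.card_sum, Fintype.card_fin]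
        omega
      rw [hcard, Algebra.adjoin_range_eq_range_aeval,
        ← ringKrullDim_eq_of_ringEquiv (Ideal.quotientKerEquivRange (aeval (R := k) x)).toRingEquiv]
      exact_mod_cast hdim
  have hL0 : aeval x (l' 0) ≠ 0 := hind.ne_zero none
  refine ⟨l' 0, hl' 0, hL0, fun f hf y hy hyJ ↦ ?_⟩
  let gen (j : Fin c) : Algebra.adjoin k (Set.range fun i ↦ x i / aeval x (l' 0)) :=
    ⟨_, aeval_div_mem_adjoin x _ (hlA j)⟩
  have hyJ' : y ∈ Ideal.span (Set.range gen) := by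
    refine Ideal.span_le.mpr ?_ hyJ
    rintro a ⟨l, hl, hlW, hla⟩
    obtain ⟨r, rfl⟩ := hspan l hl hlW
    have : a = ∑ j, r j • gen j := by
      apply Subtype.ext
      rw [hla]
      simp [gen, Finset.sum_div, smul_div_assoc]
    rw [this]
    refine Ideal.sum_mem _ fun j _ ↦ ?_
    rw [Algebra.smul_def]
    exact Ideal.mul_mem_left _ _ (Ideal.subset_span ⟨j, rfl⟩)
  obtain ⟨a, ha⟩ := (Submodule.mem_span_range_iff_exists_fun _).mp hyJ'
  have hsum : aeval x f = ∑ j, aeval x (lA j) * (a j : K) := by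
    have h := congrArg Subtype.val ha
    rw [hy, eq_div_iff hL0, AddSubmonoidClass.coe_finsetSum, Finset.sum_mul] at h
    rw [← h]
    refine Finset.sum_congr rfl fun j _ ↦ ?_
    change (a j : K) * (aeval x (lA j) / aeval x (l' 0)) * aeval x (l' 0) = _
    rw [mul_assoc, div_mul_cancel₀ _ hL0, mul_comm]
  have hne : Nonempty ι := by
    rw [← Fintype.card_pos_iff]
    simp only [ι, Fintype.card_sum, Fintype.card_fin]
    omega
  have hfx : aeval x f ∈ Submodule.span k (Set.range x) := by
    have h := Submodule.mem_map_of_mem (f := (aeval (R := k) x).toLinearMap)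
      ((homogeneousSubmodule_one_eq_span_X (R := k) (σ := σ)).le hf)
    rw [Submodule.map_span, ← Set.range_comp] at h
    convert! h using 3
    ext i
    simp
  obtain ⟨r, hr0, hr⟩ := exists_eq_sum_of_mem_ideal (k := k) hne.some x (aeval x (l' 0))
    (fun i ↦ aeval x (L (some i))) (by
      convert hind using 2 with o
      rcases o with _ | o <;> rfl) (fun V hV ↦ by
      obtain ⟨o, ho⟩ := hval V hV
      refine ⟨o, fun i ↦ (ho i).trans_eq ?_⟩
      rcases o with _ | o <;> rfl) (aeval x f) hfx
    (Sum.elim (fun j ↦ (a j : K)) 0) (by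
      rintro (j | i)
      · exact (a j).2
      · exact Subalgebra.zero_mem _) (by
      rw [hsum, Fintype.sum_sum_type]
      simp [L])
  have hfe : f - ∑ j, r (Sum.inl j) • lA j = 0 := by
    refine hnd _ ?_ ?_
    · refine (homogeneousSubmodule σ k 1).sub_mem hf (Submodule.sum_mem _ fun j _ ↦ ?_)
      exact Submodule.smul_mem _ _ (hlA j)
    · rw [map_sub, sub_eq_zero, hr, Fintype.sum_sum_type]
      have hr' (i : Fin (m - c)) : r (Sum.inr i) = 0 := hr0 _ rfl
      simp [hr', L, Algebra.smul_def]
  intro w hw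
  rw [sub_eq_zero.mp hfe]
  simp [hlAW _ w hw, smul_eval]

section Chart

variable {σ k : Type} [Field k] {l : MvPolynomial σ k} (hl : l ∈ homogeneousSubmodule σ k 1)

/-- The ring homomorphism from the degree zero part of the localization at `l` induced by a
homomorphism on polynomials sending `l` to `1`. -/
noncomputable def chartHom {T : Type*} [CommRing T] (φ : MvPolynomial σ k →+* T) (hφ : φ l = 1) :
    HomogeneousLocalization.Away (homogeneousSubmodule σ k) l →+* T :=
  (IsLocalization.Away.lift (S := Localization.Away l) l (g := φ) (hφ ▸ isUnit_one)).comp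
    (algebraMap (HomogeneousLocalization.Away (homogeneousSubmodule σ k) l) (Localization.Away l))

theorem chartHom_isLocalizationElem {T : Type*} [CommRing T] (φ : MvPolynomial σ k →+* T)
    (hφ : φ l = 1) {q : MvPolynomial σ k} {n : ℕ} (hq : q ∈ homogeneousSubmodule σ k n) :
    chartHom φ hφ (HomogeneousLocalization.Away.isLocalizationElem hl hq) = φ q := by
  rw [chartHom, RingHom.comp_apply, HomogeneousLocalization.algebraMap_apply,
    HomogeneousLocalization.Away.isLocalizationElem, HomogeneousLocalization.Away.val_mk,
    Localization.mk_eq_mk', IsLocalization.Away.lift, IsLocalization.lift_mk'_spec]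
  simp [hφ]

/-- The morphism to projective space given by homogeneous coordinates for which `l` takes the
value `1`. -/
noncomputable def chartMap {T : Type} [CommRing T] (φ : MvPolynomial σ k →+* T) (hφ : φ l = 1) :
    Spec (CommRingCat.of T) ⟶ Proj (homogeneousSubmodule σ k) :=
  Spec.map (CommRingCat.ofHom (chartHom φ hφ)) ≫ Proj.awayι _ l hl one_pos

theorem specMap_chartMap {T T' : Type} [CommRing T] [CommRing T'] (φ : MvPolynomial σ k →+* T)
    (hφ : φ l = 1) (g : T →+* T') :
    Spec.map (CommRingCat.ofHom g) ≫ chartMap hl φ hφ =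
      chartMap hl (g.comp φ) (by simp [hφ]) := by
  rw [chartMap, chartMap, ← Category.assoc, ← Spec.map_comp, ← CommRingCat.ofHom_comp]
  congr 3
  rw [chartHom, chartHom, ← RingHom.comp_assoc]
  congr 1
  refine IsLocalization.ringHom_ext (Submonoid.powers l) ?_
  ext <;> simp

theorem mem_chartMap_iff {T : Type} [CommRing T] (φ : MvPolynomial σ k →+* T)
    (hφ : φ l = 1) (t : Spec (CommRingCat.of T)) {q : MvPolynomial σ k} {n : ℕ}
    (hn : 0 < n) (hq : q ∈ homogeneousSubmodule σ k n) :
    q ∈ (chartMap hl φ hφ t).asHomogeneousIdeal ↔ φ q ∈ t.asIdeal := by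
  have h := congrArg (fun O ↦ Spec.map (CommRingCat.ofHom (chartHom φ hφ)) t ∈ O)
    (Proj.awayι_preimage_basicOpen (homogeneousSubmodule σ k) hl one_pos hq hn)
  rw [← chartHom_isLocalizationElem hl φ hφ hq, ← not_iff_not]
  exact h.to_iff

theorem mem_chartMap_of_eq_zero {T : Type} [CommRing T] (φ : MvPolynomial σ k →+* T)
    (hφ : φ l = 1) (t : Spec (CommRingCat.of T)) {q : MvPolynomial σ k} {n : ℕ}
    (hq : q ∈ homogeneousSubmodule σ k n) (h0 : φ q = 0) :
    q ∈ (chartMap hl φ hφ t).asHomogeneousIdeal := by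
  have h1 : q * l ∈ (chartMap hl φ hφ t).asHomogeneousIdeal := by
    rw [mem_chartMap_iff hl φ hφ t n.succ_pos (SetLike.mul_mem_graded hq hl), map_mul, h0, zero_mul]
    exact t.asIdeal.zero_mem
  refine ((chartMap hl φ hφ t).isPrime.mem_or_mem h1).resolve_right fun h2 ↦ ?_
  have h3 := (mem_chartMap_iff hl φ hφ t one_pos hl).mp h2
  rw [hφ] at h3
  exact t.isPrime.ne_top ((Ideal.eq_top_iff_one _).mpr h3)

end Chart

theorem exists_lift_of_isReduced {S X Z : Scheme} [IsReduced S] (i : Z ⟶ X) [IsClosedImmersion i]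
    (g : S ⟶ X) (h : Set.range g ⊆ Set.range i) : ∃ g' : S ⟶ Z, g' ≫ i = g := by
  have : Surjective (pullback.snd i g) := by
    refine ⟨Set.range_eq_univ.mp ?_⟩
    rw [Scheme.Pullback.range_snd, Set.preimage_eq_univ_iff]
    exact h
  have := isIso_of_isClosedImmersion_of_surjective (pullback.snd i g)
  exact ⟨inv (pullback.snd i g) ≫ pullback.fst i g, by
    rw [Category.assoc, pullback.condition, IsIso.inv_hom_id_assoc]⟩

theorem eq_zero_of_chartMap_factors {σ k : Type} [Field k] {l : MvPolynomial σ k}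
    (hl : l ∈ homogeneousSubmodule σ k 1) {B : Scheme} [IsReduced B]
    (i : B ⟶ Proj (homogeneousSubmodule σ k)) {T : Type} [CommRing T]
    (φ : MvPolynomial σ k →+* T) (hφ : φ l = 1) (g : Spec (CommRingCat.of T) ⟶ B)
    (hg : g ≫ i = chartMap hl φ hφ) {f : MvPolynomial σ k}
    (hf : f ∈ homogeneousSubmodule σ k 1) (hfB : ∀ b : B, f ∈ (i b).asHomogeneousIdeal) :
    φ f = 0 := by
  let ι := Proj.awayι _ l hl one_pos
  let c := CommRingCat.ofHom (chartHom φ hφ)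
  let s := HomogeneousLocalization.Away.isLocalizationElem hl hf
  have : IsReduced (pullback i ι) := isReduced_of_isOpenImmersion (pullback.fst i ι)
  have hlift := pullback.lift_snd g (Spec.map c) hg
  have h0 : (pullback.snd i ι).appTop ((Scheme.ΓSpecIso _).inv s) = 0 := by
    rw [← basicOpen_eq_bot_iff, ← Scheme.preimage_basicOpen_top, eq_bot_iff]
    intro y hy
    have hO := (basicOpen_eq_of_affine
        (R := CommRingCat.of (HomogeneousLocalization.Away (homogeneousSubmodule σ k) l)) s).trans
      (Proj.awayι_preimage_basicOpen (homogeneousSubmodule σ k) hl one_pos hf one_pos).symm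
    rw [hO] at hy
    have hy' : (pullback.snd i ι ≫ ι) y ∈ Proj.basicOpen (homogeneousSubmodule σ k) f := hy
    rw [← pullback.condition] at hy'
    exact (Proj.mem_basicOpen _ _ _).mp hy' (hfB _)
  have h1 : (Spec.map c).appTop ((Scheme.ΓSpecIso _).inv s) = 0 := by
    rw [← hlift, Scheme.Hom.comp_appTop, CommRingCat.comp_apply, h0, map_zero]
  have h2 := ConcreteCategory.congr_hom (Scheme.ΓSpecIso_inv_naturality c) s
  rw [CommRingCat.comp_apply, CommRingCat.comp_apply, h1] at h2
  have h3 : c s = 0 := by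
    refine (ConcreteCategory.bijective_of_isIso (Scheme.ΓSpecIso (CommRingCat.of T)).inv).1 ?_
    rw [h2, map_zero]
  rw [← chartHom_isLocalizationElem hl φ hφ hf]
  exact h3

theorem exists_substitution_of_submodule {σ k : Type*} [Finite σ] [Field k] [Infinite k]
    (W : Submodule k (σ → k)) : ∃ ρ : MvPolynomial σ k →ₐ[k] MvPolynomial σ k,
      (∀ l : MvPolynomial σ k, (∀ w ∈ W, eval w l = 0) → ρ l = 0) ∧
      ∀ i, (ρ (X i) - X i).IsHomogeneous 1 ∧ ∀ w ∈ W, eval w (ρ (X i) - X i) = 0 := by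
  obtain ⟨e, he⟩ := W.subtype.exists_leftInverse_of_injective W.ker_subtype
  let ρ : MvPolynomial σ k →ₐ[k] MvPolynomial σ k :=
    aeval fun i ↦ linearForm ((LinearMap.proj i).comp (W.subtype.comp e))
  have hρ (w : σ → k) (q : MvPolynomial σ k) : eval w (ρ q) = eval (e w : σ → k) q := by
    have : (eval w).comp ρ.toRingHom = eval (e w : σ → k) := by
      apply MvPolynomial.ringHom_ext
      · intro r
        simp [ρ]
      · intro i
        simp [ρ, eval_linearForm]
    exact RingHom.congr_fun this q
  refine ⟨ρ, fun l hlW ↦ ?_, fun i ↦ ⟨?_, fun w hw ↦ ?_⟩⟩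
  · refine MvPolynomial.funext fun w ↦ ?_
    rw [hρ, map_zero]
    exact hlW _ (e w).2
  · refine (homogeneousSubmodule σ k 1).sub_mem ?_ (isHomogeneous_X k i)
    simp only [ρ, aeval_X]
    exact isHomogeneous_linearForm _
  · have hew : e w = ⟨w, hw⟩ := LinearMap.congr_fun he ⟨w, hw⟩
    rw [map_sub, hρ, hew, sub_self]

theorem exists_lift_chartMap_of_isReduced {σ k : Type} [Field k] {l : MvPolynomial σ k}
    (hl : l ∈ homogeneousSubmodule σ k 1) {Z : Scheme} (i : Z ⟶ Proj (homogeneousSubmodule σ k))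
    [IsClosedImmersion i] {T : Type} [CommRing T] [_root_.IsReduced T]
    (φ : MvPolynomial σ k →+* T) (hφ : φ l = 1)
    (hZ : ∀ p : Proj (homogeneousSubmodule σ k),
      (∀ q n, q ∈ homogeneousSubmodule σ k n → φ q = 0 → q ∈ p.asHomogeneousIdeal) →
        p ∈ Set.range i) :
    ∃ g : Spec (CommRingCat.of T) ⟶ Z, g ≫ i = chartMap hl φ hφ := by
  refine exists_lift_of_isReduced i _ ?_
  rintro _ ⟨t, rfl⟩
  exact hZ _ fun q n hq h0 ↦ mem_chartMap_of_eq_zero hl φ hφ t hq h0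

theorem exists_lift_chartMap_of_linear {σ k : Type} [Finite σ] [Field k] [Infinite k]
    {l₀ : MvPolynomial σ k} (hl₀ : l₀ ∈ homogeneousSubmodule σ k 1) {Z : Scheme}
    (i : Z ⟶ Proj (homogeneousSubmodule σ k)) [IsClosedImmersion i] (W : Submodule k (σ → k))
    (hZ : ∀ p : Proj (homogeneousSubmodule σ k),
      (∀ l ∈ homogeneousSubmodule σ k 1, (∀ w ∈ W, eval w l = 0) → l ∈ p.asHomogeneousIdeal) →
        p ∈ Set.range i)
    {T : Type} [CommRing T] (ψ : MvPolynomial σ k →+* T) (hψ : ψ l₀ = 1)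
    (hψW : ∀ l ∈ homogeneousSubmodule σ k 1, (∀ w ∈ W, eval w l = 0) → ψ l = 0) :
    ∃ g : Spec (CommRingCat.of T) ⟶ Z, g ≫ i = chartMap hl₀ ψ hψ := by
  obtain ⟨ρ, hρ, hρX⟩ := exists_substitution_of_submodule W
  have hψρ : ψ.comp ρ.toRingHom = ψ := by
    apply MvPolynomial.ringHom_ext
    · intro r
      simp
    · intro j
      have := hψW _ (hρX j).1 (hρX j).2
      rwa [map_sub, sub_eq_zero] at this
  have hψρ' (q) : ψ (ρ q) = ψ q := RingHom.congr_fun hψρ q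
  let L := Localization.Away (ρ l₀)
  have : _root_.IsReduced L :=
    isReduced_localizationPreserves (Submonoid.powers (ρ l₀)) L inferInstance
  let u : L := IsLocalization.Away.invSelf (ρ l₀)
  let φ : MvPolynomial σ k →ₐ[k] L :=
    aeval fun j ↦ u * algebraMap (MvPolynomial σ k) L (ρ (X j))
  have hφ (q) (n : ℕ) (hq : q ∈ homogeneousSubmodule σ k n) :
      φ q = u ^ n * algebraMap _ L (ρ q) := by
    rw [aeval_mul_left_of_isHomogeneous hq]
    congr 1
    have : aeval (R := k) (fun j : σ ↦ algebraMap (MvPolynomial σ k) L (ρ (X j))) =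
        (IsScalarTower.toAlgHom k (MvPolynomial σ k) L).comp ρ := by
      ext j
      simp
    exact AlgHom.congr_fun this q
  have hφ₀ : φ.toRingHom l₀ = 1 := by
    refine (hφ l₀ 1 hl₀).trans ?_
    rw [pow_one, mul_comm]
    exact IsLocalization.Away.mul_invSelf _
  obtain ⟨g, hg⟩ := exists_lift_chartMap_of_isReduced hl₀ i φ.toRingHom hφ₀ fun p hp ↦
    hZ p fun l hl hlW ↦ hp l 1 hl (by
      refine (hφ l 1 hl).trans ?_
      rw [hρ l hlW, map_zero, mul_zero])
  let θ : L →+* T := IsLocalization.Away.lift (ρ l₀) (g := ψ) (by rw [hψρ', hψ]; exact isUnit_one)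
  have hθ (q) : θ (algebraMap _ L q) = ψ q := IsLocalization.Away.lift_eq _ _ _
  have hθu : θ u = 1 := by
    have h := congrArg θ (IsLocalization.Away.mul_invSelf (S := L) (ρ l₀))
    rwa [map_mul, hθ, hψρ', hψ, one_mul, map_one] at h
  have hθφ : θ.comp φ.toRingHom = ψ := by
    apply MvPolynomial.ringHom_ext
    · intro r
      have : φ (C r) = algebraMap (MvPolynomial σ k) L (C r) := by
        rw [← MvPolynomial.algebraMap_eq, AlgHom.commutes, IsScalarTower.algebraMap_apply k
          (MvPolynomial σ k) L]
      change θ (φ (C r)) = _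
      rw [this, hθ]
    · intro j
      change θ (φ (X j)) = _
      rw [aeval_X, map_mul, hθu, one_mul, hθ, hψρ']
  refine ⟨Spec.map (CommRingCat.ofHom θ) ≫ g, ?_⟩
  rw [Category.assoc, hg, specMap_chartMap]
  congr 1

theorem exists_affine_chart_of_point {σ k : Type} [Fintype σ] [Field k] [IsAlgClosed k]
    {m : ℕ} (hm : 1 ≤ m) (ξ : ProjectiveSpectrum (homogeneousSubmodule σ k))
    (hnd : ∀ l : MvPolynomial σ k, l.IsHomogeneous 1 → l ∈ ξ.asHomogeneousIdeal → l = 0)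
    (hdim : (m : WithBot ℕ∞) + 1 ≤
      ringKrullDim (MvPolynomial σ k ⧸ ξ.asHomogeneousIdeal.toIdeal))
    (W : Submodule k (σ → k)) (hW : Fintype.card σ ≤ Module.finrank k W + m)
    (hseries : ∀ s : LTSeries (ProjectiveSpectrum (homogeneousSubmodule σ k)), ξ ≤ s.head →
      (∀ l : MvPolynomial σ k, l.IsHomogeneous 1 → (∀ w ∈ W, eval w l = 0) →
        l ∈ s.head.asHomogeneousIdeal) →
      s.length ≤ Module.finrank k W + m - Fintype.card σ) :
    ∃ (K : Type) (_ : Field K) (_ : Algebra k K) (S : Subalgebra k K)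
      (φ : MvPolynomial σ k →+* S) (l₀ : MvPolynomial σ k),
      l₀.IsHomogeneous 1 ∧ φ l₀ = 1 ∧
      (∀ q n, q.IsHomogeneous n → q ∈ ξ.asHomogeneousIdeal → φ q = 0) ∧
      ∀ f : MvPolynomial σ k, f.IsHomogeneous 1 →
        φ f ∈ Ideal.span (φ '' {l | l.IsHomogeneous 1 ∧ ∀ w ∈ W, eval w l = 0}) →
        ∀ w ∈ W, eval w f = 0 := by
  let I := ξ.asHomogeneousIdeal.toIdeal
  have : I.IsPrime := ξ.isPrime
  let R := MvPolynomial σ k ⧸ I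
  let K := FractionRing R
  let x : σ → K := fun i ↦ algebraMap R K (Ideal.Quotient.mk I (X i))
  have hx (q : MvPolynomial σ k) : aeval x q = algebraMap R K (Ideal.Quotient.mk I q) := by
    have : aeval (R := k) x = (IsScalarTower.toAlgHom k R K).comp (Ideal.Quotient.mkₐ k I) := by
      ext j
      simp [x]
      rfl
    exact AlgHom.congr_fun this q
  have hx0 (q : MvPolynomial σ k) : aeval x q = 0 ↔ q ∈ I := by
    rw [hx, map_eq_zero_iff _ (IsFractionRing.injective R K), Ideal.Quotient.eq_zero_iff_mem]
  have hker : RingHom.ker (aeval (R := k) x) = I := Ideal.ext hx0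
  obtain ⟨i, hi⟩ := exists_X_notMem_asHomogeneousIdeal ξ
  obtain ⟨l₀, hl₀, hne, H⟩ := exists_linear_form_chart (k := k) hm x
    ⟨i, fun h ↦ hi ((hx0 _).mp (by rwa [aeval_X]))⟩
    (fun l hl h ↦ hnd l hl ((hx0 l).mp h))
    (by rw [hker]; exact ξ.asHomogeneousIdeal.isHomogeneous) (by rw [hker]; exact hdim) W hW
    (fun s hs ↦ hseries s (by rw [hker] at hs; exact hs))
  let S := Algebra.adjoin k (Set.range fun i ↦ x i / aeval x l₀)
  let φ : MvPolynomial σ k →ₐ[k] S :=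
    aeval fun i ↦ ⟨x i / aeval x l₀, Algebra.subset_adjoin ⟨i, rfl⟩⟩
  have hφ (q) (n : ℕ) (hq : q.IsHomogeneous n) :
      (φ q : K) = (aeval x l₀)⁻¹ ^ n * aeval x q := by
    rw [← aeval_mul_left_of_isHomogeneous hq]
    have : S.val.comp φ = aeval fun i ↦ (aeval x l₀)⁻¹ * x i := by
      ext i
      simp [φ, div_eq_inv_mul]
    exact AlgHom.congr_fun this q
  have hφ₁ (q) (hq : q.IsHomogeneous 1) : (φ q : K) = aeval x q / aeval x l₀ := by
    rw [hφ q 1 hq, pow_one, div_eq_inv_mul]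
  refine ⟨K, inferInstance, inferInstance, S, φ.toRingHom, l₀, hl₀, ?_, ?_, ?_⟩
  · refine Subtype.ext ((hφ₁ l₀ hl₀).trans ?_)
    rw [div_self hne, OneMemClass.coe_one]
  · intro q n hq hqξ
    refine Subtype.ext ((hφ q n hq).trans ?_)
    rw [(hx0 q).mpr hqξ, mul_zero, ZeroMemClass.coe_zero]
  · intro f hf hfJ
    refine H f hf (φ f) (hφ₁ f hf) (Ideal.span_mono ?_ hfJ)
    rintro _ ⟨l, ⟨hl, hlW⟩, rfl⟩
    exact ⟨l, hl, hlW, hφ₁ l hl⟩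

theorem range_eq_of_isClosedImmersion {σ k : Type} [Field k] {U : Scheme}
    [IrreducibleSpace U] (i : U ⟶ Proj (homogeneousSubmodule σ k)) [IsClosedImmersion i] :
    Set.range i = {p | (i (genericPoint U)).asHomogeneousIdeal ≤ p.asHomogeneousIdeal} := by
  have hcl := i.isClosedEmbedding
  have h := (genericPoint_spec U).image hcl.continuous
  rw [Set.image_univ, hcl.isClosed_range.closure_eq] at h
  rw [← h]
  exact Set.ext fun p ↦ (ProjectiveSpectrum.le_iff_mem_closure _ _ p).symm

theorem eval_eq_zero_of_factors {σ k : Type} [Fintype σ] [Field k] [IsAlgClosed k]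
    {m : ℕ} (hm : 1 ≤ m) {U A B : Scheme} (iU : U ⟶ Proj (homogeneousSubmodule σ k))
    [IsClosedImmersion iU] [IrreducibleSpace U] (hdim : topologicalKrullDim U = m)
    (hnd : ∀ l : MvPolynomial σ k, l.IsHomogeneous 1 →
      (∀ y : U, l ∈ (iU y).asHomogeneousIdeal) → l = 0)
    (W : Submodule k (σ → k)) (iA : A ⟶ Proj (homogeneousSubmodule σ k)) [IsClosedImmersion iA]
    (hA : Set.range iA = {p | ∀ l ∈ homogeneousSubmodule σ k 1,
      (∀ w ∈ W, eval w l = 0) → l ∈ p.asHomogeneousIdeal})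
    (hW : Fintype.card σ ≤ Module.finrank k W + m)
    (hproper : topologicalKrullDim ↥(pullback iA iU) =
      (Module.finrank k W + m - Fintype.card σ : ℕ))
    [IsReduced B] (iB : B ⟶ Proj (homogeneousSubmodule σ k)) (g : pullback iA iU ⟶ B)
    (hg : g ≫ iB = pullback.fst iA iU ≫ iA) {f : MvPolynomial σ k} (hf : f.IsHomogeneous 1)
    (hfB : ∀ b : B, f ∈ (iB b).asHomogeneousIdeal) : ∀ w ∈ W, eval w f = 0 := by
  let ξ := iU (genericPoint U)
  have hU : Set.range iU = {p | ξ.asHomogeneousIdeal ≤ p.asHomogeneousIdeal} :=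
    range_eq_of_isClosedImmersion iU
  have hξ (y : U) : ξ.asHomogeneousIdeal ≤ (iU y).asHomogeneousIdeal := by
    have : iU y ∈ Set.range iU := ⟨y, rfl⟩
    rwa [hU] at this
  have hdimR := topologicalKrullDim_add_one_le_ringKrullDim_quotient
    iU.isClosedEmbedding.isInducing ξ.asHomogeneousIdeal.toIdeal hξ
  rw [hdim] at hdimR
  obtain ⟨K, _, _, S, φ, l₀, hl₀, hφ₀, hφξ, H⟩ := exists_affine_chart_of_point hm ξ
    (fun l hl h ↦ hnd l hl fun y ↦ hξ y h) hdimR W hW (by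
      intro s hs hsW
      have h := length_le_topologicalKrullDim
        (pullback.fst iA iU ≫ iA).isClosedEmbedding.isInducing s (by
          intro p hp
          refine (Set.ext_iff.mp (Scheme.Pullback.range_fst_comp iA iU) p).mpr ?_
          rw [hA, hU]
          exact ⟨fun l hl hlW ↦ hp (hsW l hl hlW), hs.trans hp⟩)
      rw [hproper] at h
      exact_mod_cast h)
  obtain ⟨gU, hgU⟩ := exists_lift_chartMap_of_isReduced hl₀ iU φ hφ₀ (by
    intro p hp
    rw [hU]
    intro q hq
    classical
    rw [← DirectSum.sum_support_decompose (homogeneousSubmodule σ k) q]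
    exact sum_mem fun n _ ↦ hp _ n (Subtype.prop _)
      (hφξ _ n (DirectSum.decompose (homogeneousSubmodule σ k) q n).prop
        (ξ.asHomogeneousIdeal.isHomogeneous n hq)))
  let J := Ideal.span (φ '' {l | l.IsHomogeneous 1 ∧ ∀ w ∈ W, eval w l = 0})
  let ψ := (Ideal.Quotient.mk J).comp φ
  have hψ : ψ l₀ = 1 := by simp [ψ, hφ₀]
  obtain ⟨gA, hgA⟩ := exists_lift_chartMap_of_linear hl₀ iA W
    (fun p hp ↦ by rw [hA]; exact hp) ψ hψ fun l hl hlW ↦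
      Ideal.Quotient.eq_zero_iff_mem.mpr (Ideal.subset_span ⟨l, ⟨hl, hlW⟩, rfl⟩)
  let c := pullback.lift gA (Spec.map (CommRingCat.ofHom (Ideal.Quotient.mk J)) ≫ gU) (by
    rw [hgA, Category.assoc, hgU]
    exact (specMap_chartMap hl₀ φ hφ₀ _).symm)
  refine H f hf (Ideal.Quotient.eq_zero_iff_mem.mp ?_)
  refine eq_zero_of_chartMap_factors hl₀ iB ψ hψ (c ≫ g) ?_ hf hfB
  rw [Category.assoc, hg, pullback.lift_fst_assoc, hgA]


/-- Lemma 1.1: let `U ⊂ ℙ^N` be the reduced image of a finite morphism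
`π` from a smooth projective integral variety `U'` of dimension `m ≥ 1` over `ℂ`
(projectivity encoded by a closed immersion over `ℂ` into some `ℙ^K`), irreducible,
`m`-dimensional, and nondegenerate.  Let `A` be the (reduced) linear subspace of `ℙ^N`
given by `W_A ⊆ ℂ^{N+1}`, meeting `U` properly and nontrivially:
`dim (A ∩ U) = dim A + m − N ≥ 0`, and let `B ⊊ A` be the linear subspace given by
`W_B < W_A`.  Then `B ∩ U` (a scheme-theoretic fiber product) is a proper closed
subscheme of `A ∩ U`: the canonical inclusion over `ℙ^N` is a closed immersion and
not an isomorphism. -/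
theorem stmt_2 (N m : ℕ) (hm : 1 ≤ m)
    (U' : Scheme) (sU' : U' ⟶ Spec (CommRingCat.of ℂ)) [IsIntegral U']
    (hsmooth : IsSmooth sU')
    (hproj : ∃ (K : ℕ) (ι : U' ⟶ ProjSpace K),
      IsClosedImmersion ι ∧ ι ≫ ProjSpace.structMap K = sU')
    (hdimU' : topologicalKrullDim ↥U' = m)
    (π : U' ⟶ ProjSpace N) (hπ : IsFinite π) (hπℂ : π ≫ ProjSpace.structMap N = sU')
    (U : Scheme) (iU : U ⟶ ProjSpace N) [IsClosedImmersion iU] [IsReduced U]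
    [IrreducibleSpace ↥U]
    (himage : Set.range iU.base = Set.range π.base)
    (hdimU : topologicalKrullDim ↥U = m)
    (hnondeg : ¬∃ l ∈ homogeneousSubmodule (Fin (N + 1)) ℂ 1, l ≠ 0 ∧
      ∀ x : ↥U, l ∈ (iU.base x).asHomogeneousIdeal)
    (WA WB : Submodule ℂ (Fin (N + 1) → ℂ)) (hBA : WB < WA)
    (A : Scheme) (iA : A ⟶ ProjSpace N) [IsClosedImmersion iA] [IsReduced A]
    (hA : Set.range iA.base = linearSupport N WA)
    (B : Scheme) (iB : B ⟶ ProjSpace N) [IsClosedImmersion iB] [IsReduced B]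
    (hB : Set.range iB.base = linearSupport N WB)
    (hnontriv : N + 1 ≤ Module.finrank ℂ WA + m)
    (hproper : topologicalKrullDim ↥(pullback iA iU) =
      (Module.finrank ℂ WA + m - (N + 1) : ℕ)) :
    ∃ j : pullback iB iU ⟶ pullback iA iU,
      j ≫ pullback.fst iA iU ≫ iA = pullback.fst iB iU ≫ iB ∧
      IsClosedImmersion j ∧ ¬IsIso j := by
  obtain ⟨b, hb⟩ := exists_lift_of_isReduced iA iB (by
    refine hB.le.trans (le_trans ?_ hA.ge)
    exact fun p hp l hl hlA ↦ hp l hl fun w hw ↦ hlA w (hBA.le hw))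
  let j : pullback iB iU ⟶ pullback iA iU :=
    pullback.lift (pullback.fst iB iU ≫ b) (pullback.snd iB iU)
      (by rw [Category.assoc, hb, pullback.condition])
  have hj : j ≫ pullback.fst iA iU ≫ iA = pullback.fst iB iU ≫ iB := by
    rw [pullback.lift_fst_assoc, Category.assoc, hb]
  refine ⟨j, hj, ?_, fun _ ↦ ?_⟩
  · have : IsClosedImmersion (j ≫ pullback.fst iA iU ≫ iA) := hj ▸ inferInstance
    exact IsClosedImmersion.of_comp j (pullback.fst iA iU ≫ iA)
  obtain ⟨w, hwA, hwB⟩ := SetLike.exists_of_lt hBA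
  obtain ⟨φ, hφw, hφB⟩ := WB.exists_le_ker_of_notMem hwB
  refine hφw ?_
  rw [← eval_linearForm φ w]
  refine eval_eq_zero_of_factors hm iU hdimU ?_ WA iA hA (by simpa using hnontriv)
    (by simpa using hproper) iB (inv j ≫ pullback.fst iB iU) ?_ (isHomogeneous_linearForm φ)
    (fun y ↦ ?_) w hwA
  · intro l hl h
    by_contra hl0
    exact hnondeg ⟨l, hl, hl0, h⟩
  · rw [Category.assoc, IsIso.inv_comp_eq, hj]
  · have hy : iB y ∈ linearSupport N WB := hB.le ⟨y, rfl⟩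
    exact hy _ (isHomogeneous_linearForm φ) fun v hv ↦ (eval_linearForm φ v).trans (hφB hv)
end

section
/- Let U′ be a smooth projective variety over ℂ of dimension m ≥ 1 and let π : U′ → ℙ^N_ℂ be a finite morphism whose image U (with its reduced structure) is an irreducible closed subvariety of dimension m that is nondegenerate, i.e. not contained in any hyperplane of ℙ^N. Then for EVERY hyperplane H ⊂ ℙ^N, the scheme-theoretic intersection H ∩ U is nondegenerate in H: there is no linear subspace B ⊂ ℙ^N of dimension N − 2 containing H ∩ U as a closed subscheme. In particular, if H ∩ U is reduced then it is nondegenerate in H in the usual sense. -/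
open AlgebraicGeometry MvPolynomial CategoryTheory CategoryTheory.Limits

attribute [local instance] MvPolynomial.gradedAlgebra

namespace AlgebraicGeometry

/-- A morphism from a reduced scheme factors through every closed subscheme containing its
image set-theoretically. -/
theorem IsClosedImmersion.exists_lift_of_isReduced {Z H Y : Scheme} [IsReduced Z] (i : H ⟶ Y)
    [IsClosedImmersion i] (f : Z ⟶ Y) (hf : Set.range f.base ⊆ Set.range i.base) :
    ∃ q : Z ⟶ H, q ≫ i = f := by
  have : Surjective (pullback.snd i f) := by
    refine ⟨Set.range_eq_univ.mp ?_⟩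
    rw [Scheme.Pullback.range_snd, Set.eq_univ_iff_forall]
    exact fun z ↦ hf ⟨z, rfl⟩
  have := isIso_of_isClosedImmersion_of_surjective (pullback.snd i f)
  exact ⟨inv (pullback.snd i f) ≫ pullback.fst i f, by
    rw [Category.assoc, pullback.condition, IsIso.inv_hom_id_assoc]⟩

theorem IsAffineOpen.SpecMap_fromSpec_app_eq_zero_iff {Y : Scheme} {W : Y.Opens}
    (hW : IsAffineOpen W) {B : CommRingCat} (ψ : Γ(Y, W) ⟶ B) (s : Γ(Y, W)) :
    (Spec.map ψ ≫ hW.fromSpec).app W s = 0 ↔ ψ s = 0 := by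
  have hpre : ⊤ = (Spec.map ψ ≫ hW.fromSpec) ⁻¹ᵁ W := by
    rw [Scheme.Hom.comp_preimage, hW.fromSpec_preimage_self]
    rfl
  have key : (Spec.map ψ ≫ hW.fromSpec).app W =
      ψ ≫ (Scheme.ΓSpecIso B).inv ≫ (Spec B).presheaf.map (eqToHom hpre.symm).op := by
    rw [Scheme.Hom.comp_app, hW.fromSpec_app_self, Category.assoc, Scheme.Hom.naturality]
    exact (Scheme.ΓSpecIso_inv_naturality_assoc ψ _).symm
  rw [key, CommRingCat.comp_apply]
  exact map_eq_zero_iff ((Scheme.ΓSpecIso B).inv ≫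
    (Spec B).presheaf.map (eqToHom hpre.symm).op).hom
      (ConcreteCategory.bijective_of_isIso _).injective

/-- If the function `s` cuts out a reduced closed subscheme of the affine open `W` whose points
lie on the closed subscheme `H`, then every function on `W` vanishing on `H ∩ U` is a multiple
of `s` on `U`. -/
theorem IsAffineOpen.app_dvd_app_of_pullback {Y U H : Scheme} {W : Y.Opens} (hW : IsAffineOpen W)
    (iU : U ⟶ Y) (iH : H ⟶ Y) [IsAffineHom iU] [IsClosedImmersion iH] {s t : Γ(Y, W)}
    (hs : _root_.IsReduced (Γ(Y, W) ⧸ Ideal.span {s}))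
    (hH : ∀ x ∈ W, x ∉ Y.basicOpen s → x ∈ Set.range iH.base)
    (ht : (pullback.fst iH iU ≫ iH).app W t = 0) : iU.app W s ∣ iU.app W t := by
  have hV : IsAffineOpen (iU ⁻¹ᵁ W) := hW.preimage iU
  let I : Ideal Γ(Y, W) := Ideal.span {s}
  let J : Ideal Γ(U, iU ⁻¹ᵁ W) := Ideal.span {iU.app W s}
  have hIJ : I ≤ J.comap (iU.app W).hom :=
    (Ideal.span_singleton_le_iff_mem _).mpr (Ideal.mem_span_singleton_self _)
  have : IsReduced (Spec (.of (Γ(Y, W) ⧸ I))) := (affine_isReduced_iff _).mpr hs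
  let mkI : Γ(Y, W) ⟶ .of (Γ(Y, W) ⧸ I) := CommRingCat.ofHom (Ideal.Quotient.mk I)
  let mkJ : Γ(U, iU ⁻¹ᵁ W) ⟶ .of (Γ(U, iU ⁻¹ᵁ W) ⧸ J) :=
    CommRingCat.ofHom (Ideal.Quotient.mk J)
  let φ : CommRingCat.of (Γ(Y, W) ⧸ I) ⟶ .of (Γ(U, iU ⁻¹ᵁ W) ⧸ J) :=
    CommRingCat.ofHom (Ideal.quotientMap J (iU.app W).hom hIJ)
  have hφ : mkI ≫ φ = iU.app W ≫ mkJ := by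
    ext
    rfl
  have hzero : (Spec.map mkI ≫ hW.fromSpec).app W s = 0 :=
    (hW.SpecMap_fromSpec_app_eq_zero_iff _ _).mpr
      (Ideal.Quotient.eq_zero_iff_mem.mpr (Ideal.mem_span_singleton_self _))
  obtain ⟨q, hq⟩ := IsClosedImmersion.exists_lift_of_isReduced iH (Spec.map mkI ≫ hW.fromSpec) (by
    rintro _ ⟨x, rfl⟩
    refine hH _ ?_ fun hx ↦ ?_
    · rw [← SetLike.mem_coe, ← hW.range_fromSpec]
      exact ⟨_, rfl⟩
    · have hx' : x ∈ (Spec.map mkI ≫ hW.fromSpec) ⁻¹ᵁ Y.basicOpen s := hx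
      rw [Scheme.preimage_basicOpen, hzero, Scheme.basicOpen_zero] at hx'
      exact hx')
  have hU : Spec.map (iU.app W) ≫ hW.fromSpec = hV.fromSpec ≫ iU := by
    rw [← hW.SpecMap_appLE_fromSpec iU hV le_rfl, Scheme.Hom.app_eq_appLE]
  let w := pullback.lift (f := iH) (g := iU) (Spec.map φ ≫ q) (Spec.map mkJ ≫ hV.fromSpec) (by
    rw [Category.assoc, hq, Category.assoc, ← hU, ← Spec.map_comp_assoc, ← Spec.map_comp_assoc, hφ])
  have hw : w ≫ pullback.fst iH iU ≫ iH = Spec.map (iU.app W ≫ mkJ) ≫ hW.fromSpec := by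
    rw [pullback.lift_fst_assoc, Category.assoc, hq, ← Spec.map_comp_assoc, hφ]
  have hzero' : (Spec.map (iU.app W ≫ mkJ) ≫ hW.fromSpec).app W t = 0 := by
    rw [← hw, Scheme.Hom.comp_app]
    exact (congrArg (w.app _) ht).trans (map_zero _)
  rw [hW.SpecMap_fromSpec_app_eq_zero_iff] at hzero'
  exact Ideal.mem_span_singleton.mp (Ideal.Quotient.eq_zero_iff_mem.mp hzero')

end AlgebraicGeometry

namespace ProjSpace

open HomogeneousLocalization

/-- The coordinate ring of projective `N`-space, with its grading by degree. -/
local notation "𝒮" N => homogeneousSubmodule (Fin (N + 1)) ℂ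

variable {N : ℕ}

theorem X_mem (i : Fin (N + 1)) : (X i : MvPolynomial (Fin (N + 1)) ℂ) ∈ (𝒮 N) 1 :=
  isHomogeneous_X _ _

/-- The standard affine chart `D₊(Xᵢ)`. -/
noncomputable abbrev chart (i : Fin (N + 1)) : (ProjSpace N).Opens :=
  Proj.basicOpen (𝒮 N) (X i)

theorem isAffineOpen_chart (i : Fin (N + 1)) : IsAffineOpen (chart i) :=
  Proj.isAffineOpen_basicOpen _ _ (X_mem i) one_pos

theorem iSup_chart : ⨆ i : Fin (N + 1), chart i = ⊤ := by
  refine Proj.iSup_basicOpen_eq_top' _ _ (fun i ↦ ⟨1, X_mem i⟩) (eq_top_iff.mpr fun p _ ↦ ?_)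
  induction p using MvPolynomial.induction_on with
  | C a =>
    exact Subalgebra.algebraMap_mem _ (⟨C a, isHomogeneous_C _ a⟩ : (𝒮 N) 0)
  | add p q hp hq => exact add_mem (hp trivial) (hq trivial)
  | mul_X p i hp => exact mul_mem (hp trivial) (Algebra.subset_adjoin ⟨i, rfl⟩)

/-- The linear form `l` divided by `Xᵢ`, in the degree zero part of the localization. -/
noncomputable def awayRatio (l : (𝒮 N) 1) (i : Fin (N + 1)) : Away (𝒮 N) (X i) :=
  Away.mk (𝒮 N) (X_mem i) 1 l.1 (by simp)

/-- The linear form `l` divided by `Xᵢ`, as a function on the chart `D₊(Xᵢ)`. -/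
noncomputable def ratio (l : (𝒮 N) 1) (i : Fin (N + 1)) : Γ(ProjSpace N, chart i) :=
  Proj.awayToSection (𝒮 N) (X i) (awayRatio l i)

theorem ratio_sub (h l : (𝒮 N) 1) (i : Fin (N + 1)) :
    ratio (h - l) i = ratio h i - ratio l i := by
  rw [eq_sub_iff_add_eq, ratio, ratio, ratio, ← map_add]
  congr 1
  ext
  rw [val_add, awayRatio, awayRatio, awayRatio, Away.val_mk, Away.val_mk, Away.val_mk,
    Localization.add_mk_self, Submodule.coe_sub, sub_add_cancel]

theorem basicOpen_ratio (l : (𝒮 N) 1) (i : Fin (N + 1)) :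
    (ProjSpace N).basicOpen (ratio l i) = chart i ⊓ Proj.basicOpen (𝒮 N) l.1 := by
  ext x
  by_cases hx : x ∈ chart i
  swap
  · exact iff_of_false (fun h ↦ hx ((ProjSpace N).basicOpen_le _ h)) (fun h ↦ hx h.1)
  have key := congrArg (fun φ ↦ φ (awayRatio l i))
    (ProjectiveSpectrum.Proj.awayToSection_germ (𝒮 N) (X i) x hx)
  have := x.isPrime
  have hunit : IsUnit ((ProjSpace N).presheaf.germ (chart i) x hx (ratio l i)) ↔
      IsUnit (mapId (𝒮 N) (Q := x.asHomogeneousIdeal.toIdeal.primeCompl)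
        (Submonoid.powers_le.mpr hx) (awayRatio l i)) := by
    refine (iff_of_eq (congrArg IsUnit key)).trans ?_
    exact isUnit_map_iff (AlgebraicGeometry.Proj.stalkIso' (𝒮 N) x).symm
      (mapId (𝒮 N) (Submonoid.powers_le.mpr hx) (awayRatio l i))
  rw [SetLike.mem_coe, Scheme.mem_basicOpen _ _ _ hx, hunit, ← isUnit_iff_isUnit_val]
  change IsUnit (Localization.mk l.1 _) ↔ x ∈ chart i ∧ l.1 ∉ x.asHomogeneousIdeal
  rw [Localization.mk_eq_mk', IsLocalization.AtPrime.isUnit_mk'_iff _ x.asHomogeneousIdeal.toIdeal]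
  exact ⟨fun h ↦ ⟨hx, h⟩, fun h ↦ h.2⟩

theorem ratio_mul_ratio (h l : (𝒮 N) 1) (i j : Fin (N + 1)) :
    (ProjSpace N).presheaf.map (homOfLE (inf_le_left : chart i ⊓ chart j ≤ _)).op (ratio h i) *
      (ProjSpace N).presheaf.map (homOfLE (inf_le_right : chart i ⊓ chart j ≤ _)).op (ratio l j) =
    (ProjSpace N).presheaf.map (homOfLE (inf_le_left : chart i ⊓ chart j ≤ _)).op (ratio l i) *
      (ProjSpace N).presheaf.map (homOfLE (inf_le_right : chart i ⊓ chart j ≤ _)).op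
        (ratio h j) := by
  apply Subtype.ext
  ext ⟨x, hx⟩
  change (mapId (𝒮 N) (Submonoid.powers_le.mpr hx.1) (awayRatio h i) *
      mapId (𝒮 N) (Submonoid.powers_le.mpr hx.2) (awayRatio l j)).val =
    (mapId (𝒮 N) (Submonoid.powers_le.mpr hx.1) (awayRatio l i) *
      mapId (𝒮 N) (Submonoid.powers_le.mpr hx.2) (awayRatio h j)).val
  rw [val_mul, val_mul]
  change Localization.mk h.1 _ * Localization.mk l.1 _ =
    Localization.mk l.1 _ * Localization.mk h.1 _
  rw [Localization.mk_mul, Localization.mk_mul, mul_comm h.1]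

theorem structMap_ratio (c : ℂ) (l : (𝒮 N) 1) (i : Fin (N + 1)) :
    (ProjSpace N).presheaf.map (homOfLE (le_top : chart i ≤ ⊤)).op
      ((structMap N).appTop ((Scheme.ΓSpecIso (.of ℂ)).inv c)) * ratio l i = ratio (c • l) i := by
  have key :
      (structMap N).appTop ≫ (ProjSpace N).presheaf.map (homOfLE (le_top : chart i ≤ ⊤)).op =
        (Scheme.ΓSpecIso (.of ℂ)).hom ≫ CommRingCat.ofHom
          ((fromZeroRingHom (𝒮 N) (Submonoid.powers (X i))).comp (algebraMap ℂ ((𝒮 N) 0))) ≫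
            Proj.awayToSection (𝒮 N) (X i) := by
    have h1 := Proj.awayι_toSpecZero (𝒮 N) (X i) (X_mem i) one_pos
    rw [Proj.awayι, Category.assoc, Iso.inv_comp_eq, Proj.basicOpenIsoSpec_hom,
      Proj.basicOpenToSpec, Category.assoc, ← Spec.map_comp] at h1
    have h2 : (chart i).ι ≫ structMap N = (chart i).toSpecΓ ≫ Spec.map (CommRingCat.ofHom
        ((fromZeroRingHom (𝒮 N) (Submonoid.powers (X i))).comp (algebraMap ℂ ((𝒮 N) 0))) ≫
          Proj.awayToSection (𝒮 N) (X i)) := by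
      rw [structMap, reassoc_of% h1, ← Spec.map_comp]
      rfl
    have h3 := congrArg Scheme.Hom.appTop h2
    rw [Scheme.Hom.comp_appTop, Scheme.Hom.comp_appTop, Scheme.Opens.toSpecΓ_appTop,
      Scheme.ΓSpecIso_naturality_assoc, Scheme.Opens.ι_appTop] at h3
    rw [← cancel_mono (chart i).topIso.inv]
    simp only [Category.assoc] at h3 ⊢
    rw [← h3, Scheme.Opens.topIso_inv]
    exact congrArg ((structMap N).appTop ≫ ·) ((ProjSpace N).presheaf.map_comp _ _).symm
  have h1 := congrArg (fun φ ↦ φ ((Scheme.ΓSpecIso (.of ℂ)).inv c)) key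
  simp only [CommRingCat.comp_apply] at h1
  rw [h1, Iso.inv_hom_id_apply, CommRingCat.comp_apply, ratio, ratio, ← map_mul]
  congr 1
  ext
  change (fromZeroRingHom (𝒮 N) (Submonoid.powers (X i)) (algebraMap ℂ ((𝒮 N) 0) c) *
    awayRatio l i).val = _
  rw [val_mul, awayRatio, awayRatio, Away.val_mk, Away.val_mk]
  change Localization.mk (C c) 1 * _ = _
  rw [Localization.mk_mul, one_mul, ← smul_eq_C_mul]
  rfl

theorem prime_of_mem_one {h : MvPolynomial (Fin (N + 1)) ℂ} (hh : h ∈ (𝒮 N) 1) (h0 : h ≠ 0) :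
    Prime h := by
  refine (irreducible_of_totalDegree_eq_one (IsHomogeneous.totalDegree hh h0) ?_).prime
  intro x hx
  rw [isUnit_iff_ne_zero]
  rintro rfl
  exact h0 (MvPolynomial.ext _ _ fun i ↦ by simpa using hx i)

theorem isRadical_span_awayRatio (h : (𝒮 N) 1) (hh : h ≠ 0) (i : Fin (N + 1)) :
    (Ideal.span {awayRatio h i}).IsRadical := by
  have hp : Prime h.1 := prime_of_mem_one h.2 (by simpa using hh)
  rintro a ⟨n, ha⟩
  rw [Ideal.mem_span_singleton'] at ha ⊢
  obtain ⟨b, hb⟩ := ha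
  obtain ⟨k, f, hf, rfl⟩ := Away.mk_surjective (𝒮 N) (X_mem i) a
  obtain ⟨m, g, hg, rfl⟩ := Away.mk_surjective (𝒮 N) (X_mem i) b
  have hdvd : h.1 ∣ f * X i := by
    have hb' := congrArg HomogeneousLocalization.val hb
    rw [val_mul, val_pow, awayRatio, Away.val_mk, Away.val_mk, Away.val_mk, Localization.mk_mul,
      Localization.mk_pow, Localization.mk_eq_mk_iff, Localization.r_iff_exists] at hb'
    obtain ⟨⟨_, c, rfl⟩, hc⟩ := hb'
    have hdvd : h.1 ∣ X i ^ c * ((X i ^ m * X i ^ 1) * f ^ n) :=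
      ⟨X i ^ c * ((X i ^ k) ^ n * g), by
        have := hc.symm
        simp only [Submonoid.coe_mul, SubmonoidClass.coe_pow] at this
        rw [this]
        ring⟩
    have hX (e : ℕ) (he : h.1 ∣ X i ^ e) : h.1 ∣ f * X i :=
      (hp.dvd_of_dvd_pow he).mul_left f
    rcases hp.dvd_or_dvd hdvd with h1 | h1
    · exact hX _ h1
    rcases hp.dvd_or_dvd h1 with h1 | h1
    · exact hX (m + 1) (by simpa [pow_add] using h1)
    · exact (hp.dvd_of_dvd_pow h1).mul_right _
  obtain ⟨q, hq⟩ := hdvd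
  have hk : f * X i ∈ (𝒮 N) (1 + k) := by
    rw [add_comm 1 k]
    exact SetLike.mul_mem_graded (by simpa using hf) (X_mem i)
  have hq' : h.1 * (DirectSum.decompose (𝒮 N) q k).1 = f * X i := by
    have := DirectSum.coe_decompose_mul_add_of_left_mem (𝒮 N) (j := k) (b := q) h.2
    rw [← hq, DirectSum.decompose_of_mem_same _ hk] at this
    exact this.symm
  refine ⟨Away.mk (𝒮 N) (X_mem i) k ((DirectSum.decompose (𝒮 N) q k).1)
    (by simp), ?_⟩
  ext
  rw [val_mul, awayRatio, Away.val_mk, Away.val_mk, Away.val_mk, Localization.mk_mul,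
    Localization.mk_eq_mk_iff, Localization.r_iff_exists]
  refine ⟨1, ?_⟩
  simp only [Submonoid.coe_mul, Submonoid.coe_one]
  linear_combination X i ^ k * hq'

theorem isReduced_quotient_ratio (h : (𝒮 N) 1) (hh : h ≠ 0) (i : Fin (N + 1)) :
    _root_.IsReduced (Γ(ProjSpace N, chart i) ⧸ Ideal.span {ratio h i}) := by
  rw [← Ideal.isRadical_iff_quotient_reduced]
  let e := (Proj.basicOpenIsoAway (𝒮 N) (X i) (X_mem i) one_pos).commRingCatIsoToRingEquiv
  have he : Ideal.span {ratio h i} = (Ideal.span {awayRatio h i}).comap e.symm := by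
    rw [Ideal.comap_symm, Ideal.map_span, Set.image_singleton]
    rfl
  rw [he]
  exact (isRadical_span_awayRatio h hh i).comap _

instance : UniversallyClosed (structMap N) := by
  have : IsScalarTower ℂ ((𝒮 N) 0) (MvPolynomial (Fin (N + 1)) ℂ) :=
    ⟨fun c a b ↦ Algebra.smul_mul_assoc c a.1 b⟩
  have : Algebra.FiniteType ((𝒮 N) 0) (MvPolynomial (Fin (N + 1)) ℂ) :=
    .of_restrictScalars_finiteType ℂ _ _
  have : IsClosedImmersion
      (Spec.map (CommRingCat.ofHom (algebraMap ℂ ((𝒮 N) 0)))) := by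
    refine IsClosedImmersion.spec_of_surjective _ ?_
    rintro ⟨p, hp⟩
    refine ⟨p.coeff 0, Subtype.ext ?_⟩
    exact (totalDegree_eq_zero_iff_eq_C.mp (Nat.le_zero.mp (IsHomogeneous.totalDegree_le hp))).symm
  unfold structMap
  infer_instance

theorem app_ratio_eq_zero_iff {Z : Scheme} [IsReduced Z] (f : Z ⟶ ProjSpace N)
    (l : (𝒮 N) 1) (i : Fin (N + 1)) :
    f.app (chart i) (ratio l i) = 0 ↔
      ∀ z : Z, f.base z ∈ chart i → l.1 ∈ (f.base z).asHomogeneousIdeal := by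
  rw [← basicOpen_eq_bot_iff, ← Scheme.preimage_basicOpen, basicOpen_ratio, eq_bot_iff]
  refine forall_congr' fun z ↦ ?_
  change (_ ∧ l.1 ∉ _ → False) ↔ _
  tauto

theorem app_ratio_dvd {U H : Scheme} (iU : U ⟶ ProjSpace N) (iH : H ⟶ ProjSpace N)
    [IsClosedImmersion iU] [IsClosedImmersion iH] (h l : (𝒮 N) 1) (h0 : h ≠ 0)
    (hH : ∀ x : ↥(ProjSpace N), h.1 ∈ x.asHomogeneousIdeal → x ∈ Set.range iH.base)
    (i : Fin (N + 1)) (hl : (pullback.fst iH iU ≫ iH).app (chart i) (ratio l i) = 0) :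
    iU.app (chart i) (ratio h i) ∣ iU.app (chart i) (ratio l i) := by
  refine (isAffineOpen_chart i).app_dvd_app_of_pullback iU iH (isReduced_quotient_ratio h h0 i)
    (fun x hx hxs ↦ hH x ?_) hl
  rw [basicOpen_ratio] at hxs
  exact not_not.mp fun h ↦ hxs ⟨hx, h⟩

theorem res_app_ratio_ne_zero {U : Scheme} [IsIntegral U] (iU : U ⟶ ProjSpace N) (h : (𝒮 N) 1)
    (hh : ∃ x : U, h.1 ∉ (iU.base x).asHomogeneousIdeal) (i : Fin (N + 1)) {V : U.Opens}
    (hV : V ≤ iU ⁻¹ᵁ chart i) [Nonempty V] :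
    U.presheaf.map (homOfLE hV).op (iU.app (chart i) (ratio h i)) ≠ 0 := by
  intro h0
  rw [map_eq_zero_iff _ (map_injective_of_isIntegral U (homOfLE hV)), app_ratio_eq_zero_iff] at h0
  obtain ⟨x, hx⟩ := hh
  obtain ⟨v⟩ := ‹Nonempty V›
  obtain ⟨y, hy, hy'⟩ := nonempty_preirreducible_inter (iU ⁻¹ᵁ chart i).isOpen
    (iU ⁻¹ᵁ Proj.basicOpen (𝒮 N) h.1).isOpen ⟨v.1, hV v.2⟩ ⟨x, hx⟩
  exact hy' (h0 y hy)

/-- If the ratio of the linear forms `l` and `h` is regular on `U`, then it is constant there. -/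
theorem exists_sub_smul_mem {U : Scheme} [IsIntegral U] (iU : U ⟶ ProjSpace N)
    [IsClosedImmersion iU] (h l : (𝒮 N) 1)
    (hh : ∃ x : U, h.1 ∉ (iU.base x).asHomogeneousIdeal)
    (hdvd : ∀ i, iU.app (chart i) (ratio h i) ∣ iU.app (chart i) (ratio l i)) :
    ∃ c : ℂ, ∀ x : U, (l - c • h).1 ∈ (iU.base x).asHomogeneousIdeal := by
  choose g hg using hdvd
  have hcompat : TopCat.Presheaf.IsCompatible U.presheaf (fun i ↦ iU ⁻¹ᵁ chart i) g := by
    intro i j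
    change U.presheaf.map (homOfLE (inf_le_left : iU ⁻¹ᵁ chart i ⊓ iU ⁻¹ᵁ chart j ≤ _)).op (g i) =
      U.presheaf.map (homOfLE (inf_le_right : iU ⁻¹ᵁ chart i ⊓ iU ⁻¹ᵁ chart j ≤ _)).op (g j)
    rcases isEmpty_or_nonempty (iU ⁻¹ᵁ chart i ⊓ iU ⁻¹ᵁ chart j).toScheme with hemp | hne
    · have hbot : iU ⁻¹ᵁ chart i ⊓ iU ⁻¹ᵁ chart j = ⊥ :=
        eq_bot_iff.mpr fun x hx ↦ hemp.elim ⟨x, hx⟩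
      have : Subsingleton Γ(U, iU ⁻¹ᵁ chart i ⊓ iU ⁻¹ᵁ chart j) := by
        rw [hbot]
        infer_instance
      exact Subsingleton.elim _ _
    have hi := res_app_ratio_ne_zero iU h hh i
      (inf_le_left : iU ⁻¹ᵁ chart i ⊓ iU ⁻¹ᵁ chart j ≤ _)
    have hj := res_app_ratio_ne_zero iU h hh j
      (inf_le_right : iU ⁻¹ᵁ chart i ⊓ iU ⁻¹ᵁ chart j ≤ _)
    have hcross := congrArg (iU.app (chart i ⊓ chart j)) (ratio_mul_ratio h l i j)
    rw [map_mul, map_mul] at hcross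
    simp only [← CommRingCat.comp_apply, Scheme.Hom.naturality] at hcross
    simp only [CommRingCat.comp_apply, hg, map_mul] at hcross
    refine mul_left_cancel₀ (mul_ne_zero hi hj) ?_
    refine (mul_right_comm _ _ _).trans (hcross.symm.trans (mul_assoc _ _ _).symm)
  obtain ⟨G, hG, -⟩ := U.sheaf.existsUnique_gluing' (fun i ↦ iU ⁻¹ᵁ chart i) ⊤
    (fun i ↦ homOfLE le_top) (by
      rw [← Scheme.Hom.preimage_iSup, iSup_chart]
      exact le_rfl) g hcompat
  have hconst : Function.Bijective
      ((Scheme.ΓSpecIso (.of ℂ)).inv ≫ (iU ≫ structMap N).appTop).hom := by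
    refine IsAlgClosed.ringHom_bijective_of_isIntegral _ ?_
    exact RingHom.isIntegral_respectsIso.2 (e := (Scheme.ΓSpecIso _).symm.commRingCatIsoToRingEquiv)
      _ (isIntegral_appTop_of_universallyClosed (iU ≫ structMap N))
  obtain ⟨c, hc⟩ := hconst.2 G
  refine ⟨c, fun x ↦ ?_⟩
  obtain ⟨i, hi⟩ := TopologicalSpace.Opens.mem_iSup.mp
    (iSup_chart (N := N).ge (Set.mem_univ (iU.base x)))
  refine (app_ratio_eq_zero_iff iU (l - c • h) i).mp ?_ x hi
  have hGi : U.presheaf.map (homOfLE (le_top : iU ⁻¹ᵁ chart i ≤ ⊤)).op G = g i := hG i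
  rw [ratio_sub, map_sub, ← structMap_ratio, map_mul, hg, ← hGi, ← hc, sub_eq_zero, mul_comm]
  congr 1
  have := congrArg (fun φ ↦ φ ((structMap N).appTop ((Scheme.ΓSpecIso (.of ℂ)).inv c)))
    (iU.naturality (homOfLE (le_top : chart i ≤ ⊤)).op)
  rw [Scheme.Hom.comp_appTop]
  exact this.symm

/-- The linear form on `ℂ^{N+1}` attached to a linear functional. -/
noncomputable def formOfDual : Module.Dual ℂ (Fin (N + 1) → ℂ) →ₗ[ℂ] (𝒮 N) 1 :=
  ∑ i, (Module.Dual.eval ℂ _ (Pi.single i 1)).smulRight ⟨X i, X_mem i⟩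

theorem eval_formOfDual (d : Module.Dual ℂ (Fin (N + 1) → ℂ)) (w : Fin (N + 1) → ℂ) :
    eval w (formOfDual d).1 = d w := by
  conv_rhs => rw [← (Pi.basisFun ℂ (Fin (N + 1))).sum_repr w]
  simp [formOfDual, LinearMap.sum_apply, smul_eval, mul_comm]

theorem formOfDual_injective : Function.Injective (formOfDual (N := N)) := fun d e h ↦
  LinearMap.ext fun w ↦ by rw [← eval_formOfDual, h, eval_formOfDual]

theorem formOfDual_surjective : Function.Surjective (formOfDual (N := N)) := by
  rintro ⟨l, hl⟩
  have hl' := hl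
  rw [homogeneousSubmodule_one_eq_span_X, Submodule.mem_span_range_iff_exists_fun] at hl'
  obtain ⟨c, rfl⟩ := hl'
  refine ⟨∑ i, c i • LinearMap.proj i, Subtype.ext ?_⟩
  simp [formOfDual, LinearMap.sum_apply, Pi.single_apply]

/-- The linear forms vanishing on a hyperplane are the multiples of a single one. -/
theorem exists_form_of_hyperplane {W : Submodule ℂ (Fin (N + 1) → ℂ)}
    (hW : Module.finrank ℂ W = N) : ∃ h : (𝒮 N) 1, h ≠ 0 ∧
      ∀ l : (𝒮 N) 1, (∀ w ∈ W, eval w l.1 = 0) → ∃ c : ℂ, c • h = l := by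
  have h1 : Module.finrank ℂ W.dualAnnihilator = 1 := by
    have := Subspace.finrank_add_finrank_dualAnnihilator_eq W
    rw [Module.finrank_fin_fun] at this
    lia
  obtain ⟨d, hd, hgen⟩ := finrank_eq_one_iff'.mp h1
  refine ⟨formOfDual d.1, ?_, fun l hl ↦ ?_⟩
  · rw [Ne, map_eq_zero_iff _ formOfDual_injective]
    simpa using hd
  · obtain ⟨e, rfl⟩ := formOfDual_surjective l
    have he : e ∈ W.dualAnnihilator := (Submodule.mem_dualAnnihilator e).mpr fun w hw ↦ by
      rw [← eval_formOfDual, hl w hw]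
    obtain ⟨c, hc⟩ := hgen ⟨e, he⟩
    exact ⟨c, by rw [← map_smul, ← Submodule.coe_smul, hc]⟩

theorem exists_form_ne_smul {W : Submodule ℂ (Fin (N + 1) → ℂ)}
    (hW : Module.finrank ℂ W < N) (h : (𝒮 N) 1) :
    ∃ l : (𝒮 N) 1, (∀ w ∈ W, eval w l.1 = 0) ∧ ∀ c : ℂ, l ≠ c • h := by
  obtain ⟨d, rfl⟩ := formOfDual_surjective h
  have hlt : ¬W.dualAnnihilator ≤ Submodule.span ℂ {d} := fun hle ↦ by
    have h1 := Subspace.finrank_add_finrank_dualAnnihilator_eq W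
    have h2 := (Submodule.finrank_mono hle).trans (finrank_span_le_card {d})
    simp only [Module.finrank_fin_fun, Set.toFinset_singleton, Finset.card_singleton] at h1 h2
    lia
  obtain ⟨e, he, hed⟩ := SetLike.not_le_iff_exists.mp hlt
  refine ⟨formOfDual e, fun w hw ↦ ?_, fun c hc ↦ hed ?_⟩
  · rw [eval_formOfDual, (Submodule.mem_dualAnnihilator e).mp he w hw]
  · rw [← map_smul] at hc
    exact Submodule.mem_span_singleton.mpr ⟨c, (formOfDual_injective hc).symm⟩

instance : Subsingleton ↥(ProjSpace 0) := by
  suffices h : ∀ x : ↥(ProjSpace 0), x.asHomogeneousIdeal = ⊥ from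
    ⟨fun x y ↦ ProjectiveSpectrum.ext ((h x).trans (h y).symm)⟩
  intro x
  have hx : X 0 ∉ x.asHomogeneousIdeal := by
    obtain ⟨i, hi⟩ := TopologicalSpace.Opens.mem_iSup.mp (iSup_chart (N := 0).ge (Set.mem_univ x))
    rwa [Fin.fin_one_eq_zero i] at hi
  refine eq_bot_iff.mpr fun p hp ↦ ?_
  suffices h : ∀ k, (DirectSum.decompose (𝒮 0) p k).1 = 0 by
    have h0 : p = 0 := (DirectSum.decompose (𝒮 0)).injective (DFinsupp.ext fun k ↦ by
      rw [DirectSum.decompose_zero]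
      exact Subtype.ext (h k))
    rw [h0]
    exact zero_mem _
  intro k
  have hk := x.asHomogeneousIdeal.isHomogeneous k hp
  generalize (DirectSum.decompose (𝒮 0) p k) = q at hk ⊢
  have hq : q.1 = C (q.1.coeff (Finsupp.single 0 k)) * X 0 ^ k := by
    ext d
    rw [C_mul_X_pow_eq_monomial, coeff_monomial]
    split_ifs with hd
    · rw [hd]
    · refine IsHomogeneous.coeff_eq_zero q.2 fun hdeg ↦ hd ?_
      ext a
      rw [Fin.fin_one_eq_zero a, Finsupp.single_eq_same, ← hdeg, Finsupp.degree_eq_sum]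
      simp
  by_contra h0
  rw [hq] at h0 hk
  have := x.isPrime
  rcases this.mem_or_mem hk with hc | hX
  · have hu := Ideal.mul_mem_left x.asHomogeneousIdeal.toIdeal
      (C (q.1.coeff (Finsupp.single 0 k))⁻¹) hc
    rw [← C_mul, inv_mul_cancel₀ (fun h ↦ h0 (by rw [h, C_0, zero_mul])), C_1] at hu
    exact this.ne_top ((Ideal.eq_top_iff_one _).mpr hu)
  · exact hx (this.mem_of_pow_mem _ hX)

theorem pos_of_topologicalKrullDim_pos {U : Scheme} (iU : U ⟶ ProjSpace N)
    [IsClosedImmersion iU] (hU : 0 < topologicalKrullDim ↥U) : 0 < N := by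
  rcases Nat.eq_zero_or_pos N with rfl | hN
  · have : Subsingleton U := iU.isClosedEmbedding.injective.subsingleton
    exact absurd hU (topologicalKrullDim_zero_of_discreteTopology U).not_gt
  · exact hN

/-- If `H` contains all points of the hyperplane `h = 0` and the linear form `l` vanishes on the
scheme `H ∩ U`, then some nonzero combination of `h` and `l` vanishes on `U`. -/
theorem exists_mem_of_app_eq_zero {U H : Scheme} [IsIntegral U] (iU : U ⟶ ProjSpace N)
    (iH : H ⟶ ProjSpace N) [IsClosedImmersion iU] [IsClosedImmersion iH] (h l : (𝒮 N) 1)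
    (h0 : h ≠ 0) (hl : ∀ c : ℂ, l ≠ c • h)
    (hH : ∀ x : ↥(ProjSpace N), h.1 ∈ x.asHomogeneousIdeal → x ∈ Set.range iH.base)
    (hHU : ∀ i, (pullback.fst iH iU ≫ iH).app (chart i) (ratio l i) = 0) :
    ∃ f ∈ (𝒮 N) 1, f ≠ 0 ∧ ∀ x : U, f ∈ (iU.base x).asHomogeneousIdeal := by
  by_cases hh : ∃ x : U, h.1 ∉ (iU.base x).asHomogeneousIdeal
  · obtain ⟨c, hc⟩ := exists_sub_smul_mem iU h l hh
      fun i ↦ app_ratio_dvd iU iH h l h0 hH i (hHU i)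
    refine ⟨_, (l - c • h).2, fun hz ↦ hl c (sub_eq_zero.mp (Subtype.ext hz)), hc⟩
  · push Not at hh
    exact ⟨h.1, h.2, fun hz ↦ h0 (Subtype.ext hz), hh⟩

end ProjSpace

/-- with `U ⊂ ℙ^N` the reduced, irreducible, nondegenerate,
`m`-dimensional (`m ≥ 1`) image of a finite morphism `π` from a smooth projective
integral variety `U'` over `ℂ`, for EVERY hyperplane `H ⊂ ℙ^N` (the reduced linear
subscheme attached to a codimension-1 subspace `W_H ⊂ ℂ^{N+1}`), the scheme-theoretic
intersection `H ∩ U` (a fiber product) is nondegenerate in `H`: it does not factor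
through any linear subspace `B` of projective dimension `N − 2` (i.e. with
`dim W_B = N − 1`).  In particular if `H ∩ U` is reduced, its point set is contained
in no such `B`. -/
theorem stmt_3 (N m : ℕ) (hm : 1 ≤ m)
    (U' : Scheme) (sU' : U' ⟶ Spec (CommRingCat.of ℂ)) [IsIntegral U']
    (hsmooth : IsSmooth sU')
    (hproj : ∃ (K : ℕ) (ι : U' ⟶ ProjSpace K),
      IsClosedImmersion ι ∧ ι ≫ ProjSpace.structMap K = sU')
    (hdimU' : topologicalKrullDim ↥U' = m)
    (π : U' ⟶ ProjSpace N) (hπ : IsFinite π) (hπℂ : π ≫ ProjSpace.structMap N = sU')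
    (U : Scheme) (iU : U ⟶ ProjSpace N) [IsClosedImmersion iU] [IsReduced U]
    [IrreducibleSpace ↥U]
    (himage : Set.range iU.base = Set.range π.base)
    (hdimU : topologicalKrullDim ↥U = m)
    (hnondeg : ¬∃ l ∈ homogeneousSubmodule (Fin (N + 1)) ℂ 1, l ≠ 0 ∧
      ∀ x : ↥U, l ∈ (iU.base x).asHomogeneousIdeal)
    (WH : Submodule ℂ (Fin (N + 1) → ℂ)) (hWH : Module.finrank ℂ WH = N)
    (H : Scheme) (iH : H ⟶ ProjSpace N) [IsClosedImmersion iH] [IsReduced H]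
    (hH : Set.range iH.base = linearSupport N WH) :
    (¬∃ (WB : Submodule ℂ (Fin (N + 1) → ℂ)) (_ : Module.finrank ℂ WB = N - 1)
        (B : Scheme) (iB : B ⟶ ProjSpace N) (_ : IsClosedImmersion iB)
        (_ : IsReduced B) (_ : Set.range iB.base = linearSupport N WB)
        (j : pullback iH iU ⟶ B), j ≫ iB = pullback.fst iH iU ≫ iH) ∧
    (IsReduced (pullback iH iU) →
      ¬∃ WB : Submodule ℂ (Fin (N + 1) → ℂ), Module.finrank ℂ WB = N - 1 ∧
        Set.range (pullback.fst iH iU ≫ iH).base ⊆ linearSupport N WB) := by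
  have : IsIntegral U := isIntegral_of_irreducibleSpace_of_isReduced U
  have hN : 0 < N := ProjSpace.pos_of_topologicalKrullDim_pos iU (by
    rw [hdimU]
    exact_mod_cast hm)
  obtain ⟨h, h0, hgen⟩ := ProjSpace.exists_form_of_hyperplane hWH
  have hH' : ∀ x : ↥(ProjSpace N), h.1 ∈ x.asHomogeneousIdeal → x ∈ Set.range iH.base := by
    intro x hx
    rw [hH]
    intro l hl hlW
    obtain ⟨c, hc⟩ := hgen ⟨l, hl⟩ hlW
    obtain rfl : c • h.1 = l := congrArg Subtype.val hc
    rw [smul_eq_C_mul]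
    exact Ideal.mul_mem_left x.asHomogeneousIdeal.toIdeal _ hx
  have hB (WB : Submodule ℂ (Fin (N + 1) → ℂ)) (hWB : Module.finrank ℂ WB = N - 1) :
      ∃ l : homogeneousSubmodule (Fin (N + 1)) ℂ 1, (∀ w ∈ WB, eval w l.1 = 0) ∧
        ∃ i, (pullback.fst iH iU ≫ iH).app (ProjSpace.chart i) (ProjSpace.ratio l i) ≠ 0 := by
    obtain ⟨l, hlW, hl⟩ := ProjSpace.exists_form_ne_smul (by lia : Module.finrank ℂ WB < N) h
    refine ⟨l, hlW, ?_⟩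
    by_contra! hHU
    exact hnondeg (ProjSpace.exists_mem_of_app_eq_zero iU iH h l h0 hl hH' hHU)
  refine ⟨?_, ?_⟩
  · rintro ⟨WB, hWB, B, iB, _, _, hBW, j, hj⟩
    obtain ⟨l, hlW, i, hi⟩ := hB WB hWB
    refine hi ?_
    have hBl : iB.app (ProjSpace.chart i) (ProjSpace.ratio l i) = 0 :=
      (ProjSpace.app_ratio_eq_zero_iff iB l i).mpr fun z _ ↦
        (hBW ▸ Set.mem_range_self z : iB.base z ∈ linearSupport N WB) l.1 l.2 hlW
    rw [← hj, Scheme.Hom.comp_app]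
    exact (congrArg (j.app _) hBl).trans (map_zero _)
  · rintro _ ⟨WB, hWB, hsub⟩
    obtain ⟨l, hlW, i, hi⟩ := hB WB hWB
    exact hi ((ProjSpace.app_ratio_eq_zero_iff _ l i).mpr fun z _ ↦
      hsub (Set.mem_range_self z) l.1 l.2 hlW)
end

section
/- Let n ≥ 3 and k ≥ 1 be integers, and let L_j denote the ℂ-vector space of homogeneous polynomials of degree j in x₀,…,xₙ. Let K ⊆ L_k be a ℂ-linear subspace of codimension c ≤ 2. Then there exist nonzero linear forms l₁,…,l_{k−1} ∈ L₁ such that, setting f = l₁⋯l_{k−1} (with f = 1 when k = 1), the slice f·L₁ = {f·l : l ∈ L₁} satisfies dim_ℂ(K ∩ f·L₁) = n + 1 − c; that is, any subspace of codimension at most 2 meets a general slice properly. -/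
open MvPolynomial

/-- Two independent linear maps that are dependent at every point take values in a common
line. -/
lemma exists_common_line_of_pointwise_dependent {F E M : Type*} [Field F] [AddCommGroup E]
    [Module F E] [AddCommGroup M] [Module F M] {a b : E →ₗ[F] M}
    (hab : ∀ s t : F, s • a + t • b = 0 → s = 0 ∧ t = 0)
    (h : ∀ x, ¬ LinearIndependent F ![a x, b x]) :
    ∃ u : M, ∀ x, (∃ s : F, s • u = a x) ∧ ∃ t : F, t • u = b x := by
  have ha : a ≠ 0 := fun h0 => one_ne_zero (hab 1 0 (by simp [h0])).1
  have hb : ∀ x, a x ≠ 0 → ∃ s : F, s • a x = b x := fun x hx => by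
    simpa [LinearIndependent.pair_iff' hx] using h x
  by_cases H : ∃ l m, LinearIndependent F ![a l, a m]
  · exfalso
    obtain ⟨l, m, hlm⟩ := H
    have hl : a l ≠ 0 := hlm.ne_zero 0
    have hm : a m ≠ 0 := hlm.ne_zero 1
    have hind := LinearIndependent.pair_iff.1 hlm
    obtain ⟨r, hr⟩ := hb l hl
    obtain ⟨s, hs⟩ := hb m hm
    have hlm0 : a (l + m) ≠ 0 := fun h0 => by
      have := hind 1 1 (by simpa using h0)
      simp at this
    obtain ⟨t, ht⟩ := hb (l + m) hlm0
    have hrs := hind (t - r) (t - s) (by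
      rw [map_add, map_add, ← hr, ← hs] at ht
      calc (t - r) • a l + (t - s) • a m = t • (a l + a m) - (r • a l + s • a m) := by module
        _ = 0 := sub_eq_zero.2 ht)
    have hsr : s = r := by linear_combination hrs.1 - hrs.2
    subst hsr
    suffices hsab : s • a = b from
      one_ne_zero (neg_eq_zero.1 (hab s (-1) (by rw [hsab]; module)).2)
    refine LinearMap.ext fun x => ?_
    by_contra hx
    -- `a y` lies on the line through `b x - s • a x` whenever `b y - s • a y = b x - s • a x`.
    have key : ∀ y, b y - s • a y = b x - s • a x → ∃ w : F, w • (b x - s • a x) = a y := by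
      intro y hy
      by_cases hy0 : a y = 0
      · exact ⟨0, by simp [hy0]⟩
      obtain ⟨w, hw⟩ := hb y hy0
      have hws : w - s ≠ 0 := fun h0 => hx (by
        rw [← hw, ← sub_smul, h0, zero_smul] at hy
        simpa using (sub_eq_zero.1 hy.symm).symm)
      exact ⟨(w - s)⁻¹, by rw [← hy, ← hw, ← sub_smul, inv_smul_smul₀ hws]⟩
    obtain ⟨w₀, h₀⟩ := key x rfl
    obtain ⟨w₁, h₁⟩ := key (x + l) (by simp only [map_add, ← hr]; module)
    obtain ⟨w₂, h₂⟩ := key (x + m) (by simp only [map_add, ← hs]; module)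
    have hal : (w₁ - w₀) • (b x - s • a x) = a l := by rw [sub_smul, h₁, h₀]; simp
    have ham : (w₂ - w₀) • (b x - s • a x) = a m := by rw [sub_smul, h₂, h₀]; simp
    have := hind (w₂ - w₀) (-(w₁ - w₀)) (by rw [← hal, ← ham]; module)
    exact hm (by rw [← ham, this.1, zero_smul])
  · push Not at H
    obtain ⟨l, hl⟩ : ∃ l, a l ≠ 0 := by
      by_contra! h0
      exact ha (LinearMap.ext h0)
    have hline : ∀ x, ∃ s : F, s • a l = a x := fun x => by
      simpa [LinearIndependent.pair_iff' hl] using H l x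
    have hlineb : ∀ x, a x ≠ 0 → ∃ t : F, t • a l = b x := fun x hx => by
      obtain ⟨s, hs⟩ := hline x
      obtain ⟨t, ht⟩ := hb x hx
      exact ⟨t * s, by rw [mul_smul, hs, ht]⟩
    refine ⟨a l, fun x => ⟨hline x, ?_⟩⟩
    by_cases hx : a x = 0
    · obtain ⟨s, hs⟩ := hlineb l hl
      obtain ⟨t, ht⟩ := hlineb (x + l) (by simpa [hx] using hl)
      exact ⟨t - s, by rw [sub_smul, hs, ht]; simp⟩
    · exact hlineb x hx

section Powers

variable {F A : Type*} [Field F] [CommRing A] [Algebra F A] {L : Submodule F A}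

/-- A functional vanishing on all products `l * g`, `l ∈ L`, `g ∈ L ^ k`, vanishes on
`L ^ (k + 1)`. -/
lemma eq_zero_of_forall_mul_eq_zero {k : ℕ} {φ : A →ₗ[F] F}
    (h : ∀ l ∈ L, ∀ g ∈ L ^ k, φ (l * g) = 0) : ∀ p ∈ L ^ (k + 1), φ p = 0 := by
  intro p hp
  rw [pow_succ'] at hp
  have hle : L * L ^ k ≤ LinearMap.ker φ := Submodule.mul_le.2 h
  exact hle hp

/-- The functional `g ↦ φ (l * g)` on `L ^ k`, as a linear function of `l ∈ L`. -/
noncomputable def mulFunctional (L : Submodule F A) (k : ℕ) (φ : A →ₗ[F] F) :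
    L →ₗ[F] (↥(L ^ k) →ₗ[F] F) :=
  LinearMap.mk₂ F (fun l g => φ (l * g)) (by simp [add_mul]) (by simp) (by simp [mul_add])
    (by simp)

lemma mulFunctional_apply (k : ℕ) (φ : A →ₗ[F] F) (l : L) :
    mulFunctional L k φ l = (φ ∘ₗ LinearMap.mulLeft F (l : A)).domRestrict (L ^ k) := rfl

/-- Two functionals independent on `L ^ (k + 2)` remain independent on `l * L ^ (k + 1)` for some
`l ∈ L`. -/
lemma exists_linearIndependent_mulFunctional_pair {k : ℕ} {φ ψ : A →ₗ[F] F}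
    (h : LinearIndependent F ![φ.domRestrict (L ^ (k + 2)), ψ.domRestrict (L ^ (k + 2))]) :
    ∃ l : L, LinearIndependent F
      ![mulFunctional L (k + 1) φ l, mulFunctional L (k + 1) ψ l] := by
  by_contra! H
  rw [LinearIndependent.pair_iff] at h
  have hdep : ∀ s t : F, (∀ l ∈ L, ∀ g ∈ L ^ (k + 1), s * φ (l * g) + t * ψ (l * g) = 0) →
      s = 0 ∧ t = 0 := fun s t hst => h s t <| by
    ext ⟨p, hp⟩
    simpa using eq_zero_of_forall_mul_eq_zero (φ := s • φ + t • ψ) (by simpa using hst) p hp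
  obtain ⟨u, hu⟩ := exists_common_line_of_pointwise_dependent
    (fun s t hst => hdep s t fun l hl g hg =>
      LinearMap.congr_fun (LinearMap.congr_fun hst ⟨l, hl⟩) ⟨g, hg⟩) H
  choose α hα using fun l => (hu l).1
  choose β hβ using fun l => (hu l).2
  have hφ : ∀ l : L, ∀ g : ↥(L ^ (k + 1)), φ (l * g) = α l * u g := fun l g =>
    (LinearMap.congr_fun (hα l) g).symm
  have hψ : ∀ l : L, ∀ g : ↥(L ^ (k + 1)), ψ (l * g) = β l * u g := fun l g =>
    (LinearMap.congr_fun (hβ l) g).symm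
  have hmul : ∀ (l : L) (g : ↥(L ^ k)), (l * g : A) ∈ L ^ (k + 1) := fun l g => by
    rw [pow_succ']
    exact Submodule.mul_mem_mul l.2 g.2
  by_cases hu0 : ∀ (l : L) (g : ↥(L ^ k)), u ⟨l * g, hmul l g⟩ = 0
  · obtain ⟨v, hv⟩ := u.exists_extend
    have hvu : ∀ g : ↥(L ^ (k + 1)), v g = u g := fun g => LinearMap.congr_fun hv g
    have hzero : ∀ g : ↥(L ^ (k + 1)), u g = 0 := fun g => by
      rw [← hvu]
      exact eq_zero_of_forall_mul_eq_zero
        (fun l hl g hg => (hvu ⟨_, hmul ⟨l, hl⟩ ⟨g, hg⟩⟩).trans (hu0 ⟨l, hl⟩ ⟨g, hg⟩)) _ g.2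
    exact one_ne_zero (hdep 1 0 fun l hl g hg => by
      simp [hφ ⟨l, hl⟩ ⟨g, hg⟩, hzero]).1
  · push Not at hu0
    obtain ⟨m, g, hmg⟩ := hu0
    have hα_symm : ∀ l : L, α l * u ⟨m * g, hmul m g⟩ = α m * u ⟨l * g, hmul l g⟩ := fun l => by
      rw [← hφ, ← hφ]
      exact congrArg φ (mul_left_comm _ _ _)
    have hβ_symm : ∀ l : L, β l * u ⟨m * g, hmul m g⟩ = β m * u ⟨l * g, hmul l g⟩ := fun l => by
      rw [← hψ, ← hψ]
      exact congrArg ψ (mul_left_comm _ _ _)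
    have hm := hdep (β m) (-α m) fun l hl p hp => by
      rw [hφ ⟨l, hl⟩ ⟨p, hp⟩, hψ ⟨l, hl⟩ ⟨p, hp⟩]
      apply mul_right_cancel₀ hmg
      linear_combination β m * u ⟨p, hp⟩ * hα_symm ⟨l, hl⟩ - α m * u ⟨p, hp⟩ * hβ_symm ⟨l, hl⟩
    have hαm : α m = 0 := neg_eq_zero.1 hm.2
    exact one_ne_zero (hdep 1 0 fun l hl p hp => by
      have : α ⟨l, hl⟩ = 0 := by simpa [hαm, hmg] using hα_symm ⟨l, hl⟩
      simp [hφ ⟨l, hl⟩ ⟨p, hp⟩, this]).1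

/-- At most two functionals independent on `L ^ (k + 2)` remain independent on `l * L ^ (k + 1)`
for some nonzero `l ∈ L`. -/
lemma exists_ne_zero_linearIndependent_mulLeft {c k : ℕ} (hc : c ≤ 2) (hL : L ≠ ⊥)
    {φ : Fin c → A →ₗ[F] F}
    (h : LinearIndependent F fun i => (φ i).domRestrict (L ^ (k + 2))) :
    ∃ l ∈ L, l ≠ 0 ∧ LinearIndependent F fun i =>
      (φ i ∘ₗ LinearMap.mulLeft F l).domRestrict (L ^ (k + 1)) := by
  obtain rfl | hpos := Nat.eq_zero_or_pos c
  · obtain ⟨l, hl, hl0⟩ := Submodule.exists_mem_ne_zero_of_ne_bot hL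
    exact ⟨l, hl, hl0, linearIndependent_empty_type⟩
  suffices ∃ l : L, LinearIndependent F fun i => mulFunctional L (k + 1) (φ i) l by
    obtain ⟨l, hl⟩ := this
    refine ⟨l, l.2, fun h0 => hl.ne_zero ⟨0, hpos⟩ ?_, hl⟩
    ext g
    simp [mulFunctional_apply, h0]
  obtain rfl | rfl : c = 1 ∨ c = 2 := by omega
  · by_contra! H
    refine h.ne_zero 0 (LinearMap.ext fun p => ?_)
    refine eq_zero_of_forall_mul_eq_zero (fun l hl g hg => ?_) _ p.2
    have := H ⟨l, hl⟩
    rw [linearIndependent_unique_iff, not_not] at this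
    exact LinearMap.congr_fun this ⟨g, hg⟩
  · obtain ⟨l, hl⟩ := exists_linearIndependent_mulFunctional_pair (L := L) (k := k)
      (φ := φ 0) (ψ := φ 1) (by convert h using 1; ext i; fin_cases i <;> rfl)
    exact ⟨l, by convert hl using 1; ext i; fin_cases i <;> rfl⟩

/-- At most two functionals independent on `L ^ (k + 1)` remain independent on `f * L` for some
product `f` of `k` nonzero elements of `L`. -/
lemma exists_prod_linearIndependent_mulLeft {c : ℕ} (hc : c ≤ 2) (hL : L ≠ ⊥) (k : ℕ)
    {φ : Fin c → A →ₗ[F] F}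
    (h : LinearIndependent F fun i => (φ i).domRestrict (L ^ (k + 1))) :
    ∃ l : Fin k → A, (∀ i, l i ∈ L ∧ l i ≠ 0) ∧ LinearIndependent F fun i =>
      (φ i ∘ₗ LinearMap.mulLeft F (∏ j, l j)).domRestrict L := by
  induction k generalizing φ with
  | zero =>
    rw [zero_add, pow_one] at h
    exact ⟨Fin.elim0, fun i => i.elim0, by simpa using h⟩
  | succ k ih =>
    obtain ⟨m, hm, hm0, hind⟩ := exists_ne_zero_linearIndependent_mulLeft hc hL h
    obtain ⟨l, hl, hl'⟩ := ih hind
    refine ⟨Fin.cons m l, Fin.cases ⟨hm, hm0⟩ hl, ?_⟩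
    simpa [Fin.prod_univ_succ, LinearMap.mulLeft_mul, LinearMap.comp_assoc] using hl'

end Powers

/-- The common kernel of `c` independent functionals has codimension `c`. -/
lemma finrank_iInf_ker_of_linearIndependent {F V : Type*} [Field F] [AddCommGroup V] [Module F V]
    [FiniteDimensional F V] {c : ℕ} {φ : Fin c → V →ₗ[F] F} (h : LinearIndependent F φ) :
    Module.finrank F ↥(⨅ i, LinearMap.ker (φ i)) = Module.finrank F V - c := by
  have hker : (Submodule.span F (Set.range φ)).dualCoannihilator = ⨅ i, LinearMap.ker (φ i) := by
    apply SetLike.coe_injective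
    rw [Submodule.coe_dualCoannihilator_span]
    ext x
    simp
  have := Subspace.finrank_add_finrank_dualCoannihilator_eq (Submodule.span F (Set.range φ))
  rw [finrank_span_eq_card h, hker, Fintype.card_fin] at this
  omega

/-- A subspace of `V` of codimension `c` in a finite-dimensional `W ≤ V` is cut out in `W` by `c`
functionals independent on `W`. -/
lemma exists_functionals_of_finrank_quotient {F V : Type*} [Field F] [AddCommGroup V] [Module F V]
    {K W : Submodule F V} [FiniteDimensional F W] {c : ℕ}
    (hc : Module.finrank F (↥W ⧸ K.comap W.subtype) = c) :
    ∃ φ : Fin c → V →ₗ[F] F, LinearIndependent F (fun i => (φ i).domRestrict W) ∧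
      ∀ p ∈ W, p ∈ K ↔ ∀ i, φ i p = 0 := by
  let b := Module.finBasisOfFinrankEq F _ hc
  choose φ hφ using fun i => (b.coord i ∘ₗ (K.comap W.subtype).mkQ).exists_extend
  have hφ' : ∀ i (p : W), φ i p = b.coord i ((K.comap W.subtype).mkQ p) := fun i p =>
    LinearMap.congr_fun (hφ i) p
  refine ⟨φ, ?_, fun p hp => ?_⟩
  · rw [Fintype.linearIndependent_iff]
    intro g hg i
    obtain ⟨p, hp⟩ := (K.comap W.subtype).mkQ_surjective (b i)
    have := LinearMap.congr_fun hg p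
    simpa [hφ', hp, Finsupp.single_apply] using this
  · have : p ∈ K ↔ (K.comap W.subtype).mkQ ⟨p, hp⟩ = 0 := by simp
    rw [this, ← b.forall_coord_eq_zero_iff]
    exact forall_congr' fun i => by rw [hφ' i ⟨p, hp⟩]

/-- The space of linear forms has dimension the number of variables. -/
lemma finrank_homogeneousSubmodule_one (σ F : Type*) [Fintype σ] [Field F] :
    Module.finrank F ↥(homogeneousSubmodule σ F 1) = Fintype.card σ := by
  rw [homogeneousSubmodule_one_eq_span_X]
  exact finrank_span_eq_card (linearIndependent_X σ F)

/-- Any linear subspace `K` of the space `L_k` of degree-`k` forms in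
`n+1` variables (`n ≥ 3`) of codimension `c ≤ 2` meets a suitable (general) slice
`f·L₁`, `f = l₁⋯l_{k-1}` a product of nonzero linear forms, properly:
`dim (K ∩ f·L₁) = n + 1 - c`. -/
theorem stmt_4 (n k : ℕ) (hn : 3 ≤ n) (hk : 1 ≤ k) (c : ℕ) (hc : c ≤ 2)
    (K : Submodule ℂ (MvPolynomial (Fin (n + 1)) ℂ))
    (hKle : K ≤ homogeneousSubmodule (Fin (n + 1)) ℂ k)
    (hcodim :
      Module.finrank ℂ
        (↥(homogeneousSubmodule (Fin (n + 1)) ℂ k) ⧸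
          K.comap (homogeneousSubmodule (Fin (n + 1)) ℂ k).subtype) = c) :
    ∃ l : Fin (k - 1) → MvPolynomial (Fin (n + 1)) ℂ,
      (∀ i, l i ∈ homogeneousSubmodule (Fin (n + 1)) ℂ 1 ∧ l i ≠ 0) ∧
      Module.finrank ℂ
        ↥(K ⊓ (homogeneousSubmodule (Fin (n + 1)) ℂ 1).map
            (LinearMap.mulLeft ℂ (∏ i, l i))) = n + 1 - c := by
  obtain ⟨k, rfl⟩ := Nat.exists_eq_add_of_le' hk
  have hfin : ∀ j, FiniteDimensional ℂ ↥(homogeneousSubmodule (Fin (n + 1)) ℂ j) := fun j =>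
    Module.Finite.iff_fg.2 (homogeneousSubmodule_fg _ ℂ j)
  have hdim := finrank_homogeneousSubmodule_one (Fin (n + 1)) ℂ
  rw [Fintype.card_fin] at hdim
  obtain ⟨φ, hφ, hK⟩ := exists_functionals_of_finrank_quotient hcodim
  have hpow := homogeneousSubmodule_one_pow (σ := Fin (n + 1)) (R := ℂ)
  have hbot : homogeneousSubmodule (Fin (n + 1)) ℂ 1 ≠ ⊥ := fun h => by
    rw [h, finrank_bot] at hdim
    omega
  rw [← hpow (k + 1)] at hφ
  obtain ⟨l, hl, hind⟩ := exists_prod_linearIndependent_mulLeft hc hbot k hφ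
  refine ⟨l, hl, ?_⟩
  set L := homogeneousSubmodule (Fin (n + 1)) ℂ 1
  have hf0 : ∏ i, l i ≠ 0 := Finset.prod_ne_zero_iff.2 fun i _ => (hl i).2
  have hfL : ∀ p ∈ L, (∏ i, l i) * p ∈ homogeneousSubmodule (Fin (n + 1)) ℂ (k + 1) := by
    intro p hp
    rw [← hpow, pow_succ]
    refine Submodule.mul_mem_mul ?_ hp
    rw [hpow]
    simpa using IsHomogeneous.prod Finset.univ l (fun _ => 1) fun i _ => (hl i).1
  have hmap : K ⊓ L.map (LinearMap.mulLeft ℂ (∏ i, l i)) =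
      (⨅ i, LinearMap.ker ((φ i ∘ₗ LinearMap.mulLeft ℂ (∏ j, l j)).domRestrict L)).map
        (LinearMap.mulLeft ℂ (∏ i, l i) ∘ₗ L.subtype) := by
    ext q
    simp only [Submodule.mem_inf, Submodule.mem_map, Submodule.mem_iInf, LinearMap.mem_ker]
    constructor
    · rintro ⟨hq, p, hp, rfl⟩
      exact ⟨⟨p, hp⟩, (hK _ (hfL p hp)).1 hq, rfl⟩
    · rintro ⟨p, hp, rfl⟩
      exact ⟨(hK _ (hfL p p.2)).2 hp, p, p.2, rfl⟩
  have hinj : Function.Injective (LinearMap.mulLeft ℂ (∏ i, l i) ∘ₗ L.subtype) := fun p q hpq =>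
    Subtype.ext (mul_left_cancel₀ hf0 hpq)
  change Module.finrank ℂ ↥(K ⊓ L.map (LinearMap.mulLeft ℂ (∏ i : Fin k, l i))) = n + 1 - c
  rw [hmap, ← (Submodule.equivMapOfInjective _ hinj _).finrank_eq,
    finrank_iInf_ker_of_linearIndependent hind, hdim]
end

section
/- Let n ≥ 3 and k ≥ 2 be integers, and let L_j denote the ℂ-vector space of homogeneous polynomials of degree j in x₀,…,xₙ. Let K ⊆ L_k be a ℂ-linear subspace of codimension c ≤ 3, and suppose K meets every slice improperly: for all nonzero linear forms l₁,…,l_{k−1} ∈ L₁, setting f = l₁⋯l_{k−1}, one has dim_ℂ(K ∩ f·L₁) > n + 1 − c. Then: (1) c = 3; (2) there exist nonzero linear forms l₁,…,l_{k−1} with dim_ℂ(K ∩ f·L₁) = n − 1 (so K meets a general slice in projective codimension 2); and (3) at least one of the following holds: (A) there exist linearly independent linear forms a, b ∈ L₁ with a·L_{k−1} + b·L_{k−1} ⊆ K (i.e. K contains the degree-k part of the homogeneous ideal of the line {a = b = 0} ⊂ ℙⁿ), or (B) there exists a point P ∈ ℙⁿ such that K contains every g ∈ L_k vanishing to order at least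 2 at P, i.e. every g with g(P) = 0 and ∂g/∂x_i(P) = 0 for all i (the degree-k part of the square of the homogeneous ideal of P). -/
open MvPolynomial

namespace ImproperSlices

open Module
open scoped Pointwise

section Generic

variable {𝕜 E W : Type*} [Field 𝕜] [AddCommGroup E] [Module 𝕜 E] [AddCommGroup W] [Module 𝕜 W]

/-- A pencil of `r`-tuples of vectors that is independent at one parameter is independent at all
but finitely many parameters. -/
lemma finite_setOf_not_linearIndependent {r : ℕ} (v w : Fin r → W) (t₀ : 𝕜)
    (h : LinearIndependent 𝕜 fun i => v i + t₀ • w i) :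
    {t : 𝕜 | ¬ LinearIndependent 𝕜 fun i => v i + t • w i}.Finite := by
  obtain ⟨π, hπ⟩ := LinearMap.exists_leftInverse_of_injective _
    (LinearMap.ker_eq_bot.2 h.fintypeLinearCombination_injective)
  let A : Matrix (Fin r) (Fin r) (Polynomial 𝕜) :=
    Matrix.of fun i j => Polynomial.C (π (v i) j) + Polynomial.X * Polynomial.C (π (w i) j)
  have heval : ∀ t, A.det.eval t = Matrix.det (fun i => π (v i + t • w i)) := by
    intro t
    rw [← Polynomial.coe_evalRingHom, RingHom.map_det]
    congr 1
    ext i j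
    simp [A, RingHom.mapMatrix_apply, mul_comm t]
  have hone : A.det.eval t₀ = 1 := by
    rw [heval, ← Matrix.det_one (n := Fin r)]
    congr 1
    ext i j
    have := congrFun (LinearMap.congr_fun hπ (Pi.single i 1)) j
    rw [LinearMap.comp_apply, Fintype.linearCombination_apply_single, one_smul] at this
    simpa [Pi.single_apply, Matrix.one_apply, eq_comm] using this
  have hA : A.det ≠ 0 := by
    intro h0
    simp [h0] at hone
  refine (Polynomial.finite_setOfPred_isRoot hA).subset fun t ht => ?_
  by_contra hroot
  refine ht (LinearIndependent.of_comp π (Matrix.linearIndependent_rows_of_det_ne_zero ?_))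
  rw [Set.mem_ofPred_eq, Polynomial.IsRoot.def, heval] at hroot
  exact hroot

lemma exists_linearIndependent_of_le_finrank_map {r : ℕ} {F : E →ₗ[𝕜] W} {M : Submodule 𝕜 E}
    (h : r ≤ finrank 𝕜 (M.map F)) :
    ∃ m : Fin r → E, (∀ i, m i ∈ M) ∧ LinearIndependent 𝕜 fun i => F (m i) := by
  obtain ⟨f, hf⟩ := exists_linearIndependent_of_le_finrank h
  choose m hm hmf using fun i => (f i).2
  refine ⟨m, hm, ?_⟩
  simp_rw [hmf]
  exact hf.map' (M.map F).subtype (Submodule.ker_subtype _)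

lemma le_finrank_map_of_linearIndependent {r : ℕ} {F : E →ₗ[𝕜] W} {M : Submodule 𝕜 E}
    [FiniteDimensional 𝕜 M] {m : Fin r → E} (hm : ∀ i, m i ∈ M)
    (h : LinearIndependent 𝕜 fun i => F (m i)) : r ≤ finrank 𝕜 (M.map F) := by
  have : LinearIndependent 𝕜 fun i => (⟨F (m i), m i, hm i, rfl⟩ : M.map F) :=
    LinearIndependent.of_comp (M.map F).subtype h
  simpa using this.fintype_card_le_finrank

/-- The rank of a pencil of linear maps is lower semicontinuous in the parameter. -/
lemma finite_setOf_finrank_map_lt {r : ℕ} (F G : E →ₗ[𝕜] W) (M : Submodule 𝕜 E)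
    [FiniteDimensional 𝕜 M] (t₀ : 𝕜) (h : r ≤ finrank 𝕜 (M.map (F + t₀ • G))) :
    {t : 𝕜 | ¬ r ≤ finrank 𝕜 (M.map (F + t • G))}.Finite := by
  obtain ⟨m, hm, hli⟩ := exists_linearIndependent_of_le_finrank_map h
  refine (finite_setOf_not_linearIndependent (fun i => F (m i)) (fun i => G (m i)) t₀
    (by simpa using hli)).subset fun t ht hli' => ht ?_
  exact le_finrank_map_of_linearIndependent hm (by simpa using hli')

lemma finrank_map_add_finrank_le {F : E →ₗ[𝕜] W} {N V : Submodule 𝕜 E} [FiniteDimensional 𝕜 V]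
    (hNV : N ≤ V) (hN : ∀ u ∈ N, F u = 0) :
    finrank 𝕜 (V.map F) + finrank 𝕜 N ≤ finrank 𝕜 V := by
  rw [← LinearMap.finrank_range_add_finrank_ker (F.domRestrict V), LinearMap.range_domRestrict]
  have hle : finrank 𝕜 (N.comap V.subtype) ≤ finrank 𝕜 (F.domRestrict V).ker :=
    Submodule.finrank_mono fun u hu => hN u hu
  rw [(Submodule.comapSubtypeEquivOfLe hNV).finrank_eq] at hle
  omega

lemma finrank_map_inf_ker_add {F : E →ₗ[𝕜] W} {V : Submodule 𝕜 E} [FiniteDimensional 𝕜 V] :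
    finrank 𝕜 (V.map F) + finrank 𝕜 (F.ker ⊓ V : Submodule 𝕜 E) = finrank 𝕜 V := by
  rw [← LinearMap.finrank_range_add_finrank_ker (F.domRestrict V), LinearMap.range_domRestrict]
  have h : (F.ker ⊓ V).comap V.subtype = (F.domRestrict V).ker := by
    ext u
    simp
  rw [← h, (Submodule.comapSubtypeEquivOfLe inf_le_right).finrank_eq]

lemma exists_notMem_ne_zero [Infinite 𝕜] {s : Set 𝕜} (hs : s.Finite) : ∃ t ∉ s, t ≠ 0 := by
  obtain ⟨t, ht⟩ := (hs.union (Set.finite_singleton 0)).exists_notMem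
  exact ⟨t, fun h => ht (Or.inl h), fun h => ht (Or.inr h)⟩

end Generic

section Contract

variable {𝕜 A W : Type*} [Field 𝕜] [CommRing A] [Algebra 𝕜 A] [AddCommGroup W] [Module 𝕜 W]

/-- The contraction of `Φ` by `x`, sending `a` to `Φ (x * a)`. -/
def contract (Φ : A →ₗ[𝕜] W) (x : A) : A →ₗ[𝕜] W := Φ ∘ₗ LinearMap.mulLeft 𝕜 x

@[simp]
lemma contract_apply (Φ : A →ₗ[𝕜] W) (x a : A) : contract Φ x a = Φ (x * a) := rfl

lemma contract_contract (Φ : A →ₗ[𝕜] W) (x y : A) :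
    contract (contract Φ x) y = contract Φ (x * y) := by
  ext a
  simp [mul_assoc]

lemma contract_add_smul (Φ : A →ₗ[𝕜] W) (x y : A) (t : 𝕜) :
    contract Φ (x + t • y) = contract Φ x + t • contract Φ y := by
  ext a
  simp [add_mul]

/-- The rank of a contraction is lower semicontinuous along lines. -/
lemma finite_setOf_finrank_map_contract_lt {r : ℕ} (Φ : A →ₗ[𝕜] W) (x y : A)
    (M : Submodule 𝕜 A) [FiniteDimensional 𝕜 M] (t₀ : 𝕜)
    (h : r ≤ finrank 𝕜 (M.map (contract Φ (x + t₀ • y)))) :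
    {t : 𝕜 | ¬ r ≤ finrank 𝕜 (M.map (contract Φ (x + t • y)))}.Finite := by
  refine (finite_setOf_finrank_map_lt (r := r) (contract Φ x) (contract Φ y) M t₀
    (by rwa [← contract_add_smul])).subset fun t ht => ?_
  rwa [Set.mem_ofPred_eq, ← contract_add_smul]

lemma map_contract_le (Φ : A →ₗ[𝕜] W) {V : Submodule 𝕜 A} {x : A} (hx : x ∈ V) (m : ℕ) :
    (V ^ m).map (contract Φ x) ≤ (V ^ (m + 1)).map Φ := by
  rintro _ ⟨a, ha, rfl⟩
  exact ⟨x * a, by rw [pow_succ']; exact Submodule.mul_mem_mul hx ha, rfl⟩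

/-- A submodule containing all the images of the contractions contains the image. -/
lemma map_pow_succ_le {Φ : A →ₗ[𝕜] W} {V : Submodule 𝕜 A} {m : ℕ} {S : Submodule 𝕜 W}
    (h : ∀ x ∈ V, ∀ a ∈ V ^ m, Φ (x * a) ∈ S) : (V ^ (m + 1)).map Φ ≤ S := by
  rw [Submodule.map_le_iff_le_comap, pow_succ', Submodule.mul_le]
  exact h

/-- The elements `x` with `Φ (x * M) ⊆ S`. -/
def conductor (Φ : A →ₗ[𝕜] W) (M : Submodule 𝕜 A) (S : Submodule 𝕜 W) : Submodule 𝕜 A where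
  carrier := {x | ∀ a ∈ M, Φ (x * a) ∈ S}
  zero_mem' := by simp
  add_mem' hx hy a ha := by
    rw [add_mul, map_add]
    exact S.add_mem (hx a ha) (hy a ha)
  smul_mem' t x hx a ha := by
    rw [smul_mul_assoc, map_smul]
    exact S.smul_mem t (hx a ha)

lemma exists_notMem_conductor {Φ : A →ₗ[𝕜] W} {V : Submodule 𝕜 A} {m : ℕ} {S : Submodule 𝕜 W}
    (h : ¬ (V ^ (m + 1)).map Φ ≤ S) : ∃ x ∈ V, x ∉ conductor Φ (V ^ m) S := by
  by_contra! hx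
  exact h (map_pow_succ_le hx)

instance (V : Submodule 𝕜 A) [FiniteDimensional 𝕜 V] (m : ℕ) :
    FiniteDimensional 𝕜 (V ^ m : Submodule 𝕜 A) :=
  Module.Finite.iff_fg.2 ((Module.Finite.iff_fg.1 inferInstance).pow m)

variable {V : Submodule 𝕜 A} [FiniteDimensional 𝕜 V]

/-- If every contraction of `Φ` by an element of `V` has rank at most one, then so does `Φ`. -/
lemma finrank_map_le_one_of_contract (Φ : A →ₗ[𝕜] W) (m : ℕ)
    (h : ∀ x ∈ V, finrank 𝕜 ((V ^ (m + 1)).map (contract Φ x)) ≤ 1) :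
    finrank 𝕜 ((V ^ (m + 2)).map Φ) ≤ 1 := by
  by_contra! hlt
  obtain ⟨x, hx, hxne⟩ : ∃ x ∈ V, x ∉ conductor Φ (V ^ (m + 1)) ⊥ := by
    refine exists_notMem_conductor fun hle => ?_
    rw [le_bot_iff.1 hle, finrank_bot] at hlt
    omega
  obtain ⟨y, hy, hyne⟩ :
      ∃ y ∈ V, y ∉ conductor Φ (V ^ (m + 1)) ((V ^ (m + 1)).map (contract Φ x)) := by
    refine exists_notMem_conductor fun hle => ?_
    exact absurd ((Submodule.finrank_mono hle).trans (h x hx)) (not_le.2 hlt)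
  have key : ∀ z ∈ V, z ∉ conductor Φ (V ^ (m + 1)) ((V ^ (m + 1)).map (contract Φ x)) →
      ∀ a ∈ V ^ m, Φ (x * (z * a)) = 0 := by
    intro z hz hzne a ha
    have hza : z * a ∈ V ^ (m + 1) := by rw [pow_succ']; exact Submodule.mul_mem_mul hz ha
    have hxa : x * a ∈ V ^ (m + 1) := by rw [pow_succ']; exact Submodule.mul_mem_mul hx ha
    have hinf : (V ^ (m + 1)).map (contract Φ x) ⊓ (V ^ (m + 1)).map (contract Φ z) = ⊥ := by
      rw [← Submodule.finrank_eq_zero (R := 𝕜)]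
      have hlt' : (V ^ (m + 1)).map (contract Φ x) ⊓ (V ^ (m + 1)).map (contract Φ z) <
          (V ^ (m + 1)).map (contract Φ z) := by
        refine lt_of_le_of_ne inf_le_right fun heq => hzne fun b hb => ?_
        exact inf_eq_right.1 heq ⟨b, hb, rfl⟩
      have := Submodule.finrank_lt_finrank_of_lt hlt'
      have := h z hz
      omega
    rw [← Submodule.mem_bot 𝕜, ← hinf]
    exact ⟨⟨z * a, hza, rfl⟩, ⟨x * a, hxa, by simp [mul_left_comm]⟩⟩
  refine hxne fun b hb => ?_
  refine map_pow_succ_le (Φ := contract Φ x) (S := ⊥) (fun z hz a ha => ?_) ⟨b, hb, rfl⟩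
  rw [Submodule.mem_bot, contract_apply]
  by_cases hzc : z ∈ conductor Φ (V ^ (m + 1)) ((V ^ (m + 1)).map (contract Φ x))
  · have hsum := key (z + y) (add_mem hz hy)
      (fun hzy => hyne (by simpa using sub_mem hzy hzc)) a ha
    simpa [add_mul, mul_add, key y hy hyne a ha] using hsum
  · exact key z hz hzc a ha

/-- If every slice of `Φ` has rank at most one, then so does `Φ`. -/
lemma finrank_map_le_one_of_slices (m : ℕ) (Φ : A →ₗ[𝕜] W)
    (h : ∀ f ∈ (V : Set A) ^ m, finrank 𝕜 (V.map (contract Φ f)) ≤ 1) :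
    finrank 𝕜 ((V ^ (m + 1)).map Φ) ≤ 1 := by
  induction m generalizing Φ with
  | zero =>
    have := h 1 (by simp)
    have hΦ : contract Φ 1 = Φ := by ext; simp
    rw [hΦ] at this
    rwa [zero_add, pow_one]
  | succ m ih =>
    refine finrank_map_le_one_of_contract Φ m fun x hx => ih _ fun f hf => ?_
    rw [contract_contract]
    refine h _ ?_
    rw [pow_succ']
    exact Set.mul_mem_mul hx hf

/-- The base locus of a system of rank at least two has codimension at least two. -/
lemma finrank_conductor_inf_add_two_le {Ψ : A →ₗ[𝕜] W} {m : ℕ}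
    (h : 2 ≤ finrank 𝕜 ((V ^ (m + 1)).map Ψ)) :
    finrank 𝕜 (conductor Ψ (V ^ m) ⊥ ⊓ V : Submodule 𝕜 A) + 2 ≤ finrank 𝕜 V := by
  by_contra! hlt
  have : finrank 𝕜 ((V ^ (m + 1)).map Ψ) ≤ 1 := by
    refine finrank_map_le_one_of_slices m Ψ fun f hf => ?_
    have := finrank_map_add_finrank_le (F := contract Ψ f)
      (inf_le_right : conductor Ψ (V ^ m) ⊥ ⊓ V ≤ V) fun u hu => by
        have hfm : f ∈ V ^ m := by
          rw [Submodule.pow_eq_span_pow_set]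
          exact Submodule.subset_span hf
        simpa [mul_comm] using hu.1 f hfm
    omega
  omega

lemma not_linearIndependent_slice {Φ : A →ₗ[𝕜] W} {f : A}
    (h : finrank 𝕜 (V.map (contract Φ f)) ≤ 2) {x y z : A} (hx : x ∈ V) (hy : y ∈ V)
    (hz : z ∈ V) : ¬ LinearIndependent 𝕜 ![Φ (f * x), Φ (f * y), Φ (f * z)] := by
  intro hli
  have := le_finrank_map_of_linearIndependent (F := contract Φ f) (M := V) (m := ![x, y, z])
    (by intro i; fin_cases i <;> simpa) (by
      convert hli using 1
      ext i
      fin_cases i <;> simp)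
  omega

end Contract

section Main

variable {𝕜 A W : Type*} [Field 𝕜] [CharZero 𝕜] [CommRing A] [Algebra 𝕜 A] [AddCommGroup W]
  [Module 𝕜 W] {V : Submodule 𝕜 A} [FiniteDimensional 𝕜 V]

lemma eq_zero_of_not_linearIndependent_pencil {e₁ e₂ e₃ w : W}
    (he : LinearIndependent 𝕜 ![e₃, e₁, e₂]) (hw : w ∈ Submodule.span 𝕜 {e₁, e₂})
    (h : ∀ t : 𝕜, ¬ LinearIndependent 𝕜 ![t • w, e₁ + t • e₂, e₂ + t • e₃]) : w = 0 := by
  obtain ⟨p, q, rfl⟩ := Submodule.mem_span_pair.1 hw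
  rw [Fintype.linearIndependent_iff] at he
  have key : ∀ t : 𝕜, t ≠ 0 → q = t * p := by
    intro t ht
    obtain ⟨g, hg, i, hi⟩ := Fintype.not_linearIndependent_iff.1 (h t)
    have hcoef := he ![g 2 * t, g 0 * t * p + g 1, g 0 * t * q + g 1 * t + g 2] (by
      rw [← hg]
      simp only [Fin.sum_univ_three, Matrix.cons_val]
      module)
    have h0 := hcoef 0
    have h1 := hcoef 1
    have h2 := hcoef 2
    simp only [Matrix.cons_val] at h0 h1 h2
    have hg2 : g 2 = 0 := (mul_eq_zero.1 h0).resolve_right ht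
    have hmul : g 0 * t * (q - t * p) = 0 := by linear_combination h2 - t * h1 - hg2
    rcases mul_eq_zero.1 hmul with hg0 | hq
    · have hg0 : g 0 = 0 := (mul_eq_zero.1 hg0).resolve_right ht
      have hg1 : g 1 = 0 := by simpa [hg0] using h1
      fin_cases i <;> simp_all
    · linear_combination hq
  have hpos := key 1 one_ne_zero
  have hneg := key (-1) (neg_ne_zero.2 one_ne_zero)
  have hp : p = 0 := by
    have : (2 : 𝕜) * p = 0 := by linear_combination hneg - hpos
    simpa using this
  have hq : q = 0 := by simpa [hp] using hpos
  simp [hp, hq]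

/-- Some `a` with `Φ (a * a) ≠ 0` has a contraction of rank at least two. -/
lemma exists_two_le_finrank_map_contract {Φ : A →ₗ[𝕜] W}
    (h3 : 3 ≤ finrank 𝕜 ((V ^ 2).map Φ)) :
    ∃ a ∈ V, 2 ≤ finrank 𝕜 (V.map (contract Φ a)) ∧ Φ (a * a) ≠ 0 := by
  obtain ⟨x, hx, hx2⟩ : ∃ x ∈ V, 2 ≤ finrank 𝕜 (V.map (contract Φ x)) := by
    by_contra! hlt
    have := finrank_map_le_one_of_contract (V := V) Φ 0 fun x hx => by
      rw [zero_add, pow_one]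
      exact Nat.le_of_lt_succ (hlt x hx)
    exact absurd (h3.trans this) (by norm_num)
  by_cases hxx : Φ (x * x) = 0
  swap
  · exact ⟨x, hx, hx2, hxx⟩
  obtain ⟨y, hy, hxy⟩ : ∃ y ∈ V, Φ (x * y) ≠ 0 := by
    by_contra! h0
    have : V.map (contract Φ x) ≤ ⊥ := by
      rintro _ ⟨y, hy, rfl⟩
      exact h0 y hy
    rw [le_bot_iff.1 this, finrank_bot] at hx2
    omega
  have hrank := finite_setOf_finrank_map_contract_lt (r := 2) Φ x y V 0
    (by rwa [zero_smul, add_zero])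
  have hsq := finite_setOf_not_linearIndependent (𝕜 := 𝕜) ![(2 : 𝕜) • Φ (x * y)] ![Φ (y * y)] 0
    (by simpa [linearIndependent_unique_iff] using hxy)
  obtain ⟨t, ht, ht0⟩ := exists_notMem_ne_zero (hrank.union hsq)
  simp only [Set.mem_union, Set.mem_ofPred_eq, not_or, not_not] at ht
  refine ⟨x + t • y, add_mem hx (V.smul_mem t hy), ht.1, ?_⟩
  have hne := ht.2.ne_zero 0
  have hexp : Φ ((x + t • y) * (x + t • y)) = t • ((2 : 𝕜) • Φ (x * y) + t • Φ (y * y)) := by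
    have : (x + t • y) * (x + t • y) =
        x * x + t • ((2 : 𝕜) • (x * y) + t • (y * y)) := by
      simp only [Algebra.smul_def, map_ofNat]
      ring
    rw [this]
    simp [hxx]
  rw [hexp]
  exact smul_ne_zero ht0 (by simpa using hne)

/-- A symmetric bilinear system of rank at least three whose slices have rank at most two has a
base locus of codimension at most two. -/
lemma exists_base_locus_bilinear (Φ : A →ₗ[𝕜] W) (h3 : 3 ≤ finrank 𝕜 ((V ^ 2).map Φ))
    (h : ∀ x ∈ V, finrank 𝕜 (V.map (contract Φ x)) ≤ 2) :
    ∃ U ≤ V, finrank 𝕜 V ≤ finrank 𝕜 U + 2 ∧ ∀ u ∈ U, ∀ v ∈ V, Φ (u * v) = 0 := by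
  obtain ⟨a, ha, ha2, haa⟩ := exists_two_le_finrank_map_contract h3
  obtain ⟨b, hb, hab⟩ : ∃ b ∈ V, Φ (a * b) ∉ Submodule.span 𝕜 {Φ (a * a)} := by
    by_contra! hle
    have hle' : V.map (contract Φ a) ≤ Submodule.span 𝕜 {Φ (a * a)} := by
      rintro _ ⟨y, hy, rfl⟩
      exact hle y hy
    have := (Submodule.finrank_mono hle').trans (finrank_span_singleton haa).le
    omega
  have hli : LinearIndependent 𝕜 ![Φ (a * a), Φ (a * b)] := by
    rw [LinearIndependent.pair_iff' haa]
    intro t ht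
    exact hab (Submodule.mem_span_singleton.2 ⟨t, ht⟩)
  have hrange : Set.range ![Φ (a * a), Φ (a * b)] = {Φ (a * a), Φ (a * b)} := by
    rw [Matrix.range_cons, Matrix.range_cons, Matrix.range_empty, Set.union_empty]
    rfl
  set S := Submodule.span 𝕜 {Φ (a * a), Φ (a * b)} with hS
  have hS2 : finrank 𝕜 S = 2 := by
    rw [hS, ← hrange, finrank_span_eq_card hli, Fintype.card_fin]
  have : FiniteDimensional 𝕜 S := FiniteDimensional.span_of_finite 𝕜 (Set.toFinite _)
  have hcons : ∀ w ∉ S, LinearIndependent 𝕜 ![w, Φ (a * a), Φ (a * b)] := by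
    intro w hw
    exact linearIndependent_finCons.2 ⟨hli, by rwa [hrange]⟩
  have haS : V.map (contract Φ a) = S := by
    refine (Submodule.eq_of_le_of_finrank_le ?_ (by rw [hS2]; exact h a ha)).symm
    rw [hS, Submodule.span_le]
    rintro _ (rfl | rfl)
    exacts [⟨a, ha, rfl⟩, ⟨b, hb, rfl⟩]
  have hmemS : ∀ v ∈ V, Φ (a * v) ∈ S := fun v hv => haS ▸ ⟨v, hv, rfl⟩
  have hker : ∀ u ∈ V, Φ (a * u) = 0 → ∀ l ∈ V, Φ (l * u) ∈ S := by
    intro u hu hau l hl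
    by_contra hlu
    have hfin := finite_setOf_not_linearIndependent (𝕜 := 𝕜)
      ![Φ (l * u), Φ (a * a), Φ (a * b)] ![0, Φ (l * a), Φ (l * b)] 0 (by simpa using hcons _ hlu)
    obtain ⟨t, ht, ht0⟩ := exists_notMem_ne_zero hfin
    simp only [Set.mem_ofPred_eq, not_not] at ht
    refine not_linearIndependent_slice (h (a + t • l) (add_mem ha (V.smul_mem t hl))) hu ha hb ?_
    convert ht.units_smul ![Units.mk0 t ht0, 1, 1] using 1
    ext i
    fin_cases i <;> simp [add_mul, hau, Units.smul_def]
  have hdecomp : ∀ v ∈ V, ∃ x y : 𝕜, ∃ u ∈ V, Φ (a * u) = 0 ∧ v = x • a + y • b + u := by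
    intro v hv
    obtain ⟨x, y, hxy⟩ := Submodule.mem_span_pair.1 (hmemS v hv)
    refine ⟨x, y, v - (x • a + y • b),
      sub_mem hv (add_mem (V.smul_mem x ha) (V.smul_mem y hb)), ?_, by abel⟩
    simp [mul_sub, mul_add, hxy]
  have hbb : Φ (b * b) ∉ S := by
    intro hbb
    have hle : (V ^ (1 + 1)).map Φ ≤ S := by
      refine map_pow_succ_le fun v hv v' hv' => ?_
      rw [pow_one] at hv'
      obtain ⟨x, y, u, hu, hau, rfl⟩ := hdecomp v hv
      have hbv : Φ (b * v') ∈ S := by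
        obtain ⟨x', y', u', hu', hau', rfl⟩ := hdecomp v' hv'
        simp only [mul_add, mul_smul_comm, map_add, map_smul]
        refine add_mem (add_mem (S.smul_mem _ ?_) (S.smul_mem _ hbb)) (hker u' hu' hau' b hb)
        rw [mul_comm]
        exact hmemS b hb
      simp only [add_mul, smul_mul_assoc, map_add, map_smul]
      refine add_mem (add_mem (S.smul_mem _ (hmemS v' hv')) (S.smul_mem _ hbv)) ?_
      rw [mul_comm]
      exact hker u hu hau v' hv'
    have := (h3.trans (Submodule.finrank_mono hle)).trans hS2.le
    omega
  have hbu : ∀ u ∈ V, Φ (a * u) = 0 → Φ (b * u) = 0 := by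
    intro u hu hau
    refine eq_zero_of_not_linearIndependent_pencil (hcons _ hbb) (hker u hu hau b hb) fun t => ?_
    convert not_linearIndependent_slice (h (a + t • b) (add_mem ha (V.smul_mem t hb))) hu ha hb
      using 3
    · simp [add_mul, hau]
    · simp [add_mul, mul_comm b a]
  have huu : ∀ u ∈ V, Φ (a * u) = 0 → ∀ u' ∈ V, Φ (a * u') = 0 → Φ (u * u') = 0 := by
    intro u hu hau u' hu' hau'
    refine eq_zero_of_not_linearIndependent_pencil (hcons _ hbb) (hker u' hu' hau' u hu)
      fun t => ?_
    convert not_linearIndependent_slice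
      (h (a + t • (b + u)) (add_mem ha (V.smul_mem t (add_mem hb hu)))) hu' ha hb using 3
    · simp [add_mul, hau', hbu u' hu' hau']
    · simp [add_mul, mul_comm b a, mul_comm u a, hau, mul_comm u b, hbu u hu hau]
  refine ⟨(contract Φ a).ker ⊓ V, inf_le_right, ?_, ?_⟩
  · have := finrank_map_inf_ker_add (F := contract Φ a) (V := V)
    have := h a ha
    omega
  · rintro u ⟨hau, hu⟩ v hv
    replace hau : Φ (a * u) = 0 := hau
    obtain ⟨x, y, u', hu', hau', rfl⟩ := hdecomp v hv
    simp [mul_add, mul_comm u a, mul_comm u b, hau, hbu u hu hau, huu u hu hau u' hu' hau']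

/-- In degree at least three, a system of rank at least three has a contraction of rank at least
three. -/
lemma exists_three_le_finrank_map_contract {Φ : A →ₗ[𝕜] W} {m : ℕ}
    (h3 : 3 ≤ finrank 𝕜 ((V ^ (m + 3)).map Φ)) :
    ∃ x ∈ V, 3 ≤ finrank 𝕜 ((V ^ (m + 2)).map (contract Φ x)) := by
  by_contra! hlt
  obtain ⟨x, hx, hx2⟩ : ∃ x ∈ V, 2 ≤ finrank 𝕜 ((V ^ (m + 2)).map (contract Φ x)) := by
    by_contra! hlt'
    have := finrank_map_le_one_of_contract (V := V) Φ (m + 1)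
      fun x hx => Nat.le_of_lt_succ (hlt' x hx)
    exact absurd (h3.trans this) (by norm_num)
  set S := (V ^ (m + 2)).map (contract Φ x) with hS
  obtain ⟨y, hy, hyS⟩ : ∃ y ∈ V, y ∉ conductor Φ (V ^ (m + 2)) S := by
    refine exists_notMem_conductor fun hle => ?_
    exact absurd (h3.trans (Submodule.finrank_mono hle)) (not_le.2 (hlt x hx))
  have key : ∀ z ∈ V, z ∉ conductor Φ (V ^ (m + 2)) S →
      finrank 𝕜 ((V ^ (m + 1)).map (contract (contract Φ x) z)) ≤ 1 := by
    intro z hz hzS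
    have hle : (V ^ (m + 1)).map (contract (contract Φ x) z) ≤
        S ⊓ (V ^ (m + 2)).map (contract Φ z) := by
      refine le_inf (map_contract_le _ hz _) ?_
      rw [contract_contract, mul_comm, ← contract_contract]
      exact map_contract_le _ hx _
    have hlt' : S ⊓ (V ^ (m + 2)).map (contract Φ z) < (V ^ (m + 2)).map (contract Φ z) := by
      refine lt_of_le_of_ne inf_le_right fun heq => hzS fun b hb => ?_
      exact inf_eq_right.1 heq ⟨b, hb, rfl⟩
    have := Submodule.finrank_mono hle
    have := Submodule.finrank_lt_finrank_of_lt hlt'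
    have := hlt z hz
    omega
  have hone := finrank_map_le_one_of_contract (V := V) (contract Φ x) m fun z hz => by
    by_contra! hz2
    have hfin := finite_setOf_finrank_map_contract_lt (r := 2) (contract Φ x) z y (V ^ (m + 1)) 0
      (by rwa [zero_smul, add_zero])
    by_cases hzS : z ∈ conductor Φ (V ^ (m + 2)) S
    · obtain ⟨t, ht, ht0⟩ := exists_notMem_ne_zero hfin
      simp only [Set.mem_ofPred_eq, not_not] at ht
      have := key (z + t • y) (add_mem hz (V.smul_mem t hy)) fun hmem => hyS <| by
        have := (Submodule.add_mem_iff_right _ hzS).1 hmem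
        rwa [Submodule.smul_mem_iff _ ht0] at this
      omega
    · exact absurd (key z hz hzS) (not_le.2 hz2)
  exact absurd (hx2.trans hone) (by norm_num)

/-- A system of rank at least three whose slices have rank at most two has a base locus of
codimension at most two. -/
theorem exists_base_locus (m : ℕ) (Φ : A →ₗ[𝕜] W)
    (h3 : 3 ≤ finrank 𝕜 ((V ^ (m + 2)).map Φ))
    (h : ∀ f ∈ (V : Set A) ^ (m + 1), finrank 𝕜 (V.map (contract Φ f)) ≤ 2) :
    ∃ U ≤ V, finrank 𝕜 V ≤ finrank 𝕜 U + 2 ∧ ∀ u ∈ U, ∀ v ∈ V ^ (m + 1), Φ (u * v) = 0 := by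
  induction m generalizing Φ with
  | zero =>
    simpa using exists_base_locus_bilinear Φ h3 fun x hx => h x (by simpa using hx)
  | succ m ih =>
    have ih' : ∀ x ∈ V, 3 ≤ finrank 𝕜 ((V ^ (m + 2)).map (contract Φ x)) →
        ∃ U ≤ V, finrank 𝕜 V ≤ finrank 𝕜 U + 2 ∧
          ∀ u ∈ U, ∀ v ∈ V ^ (m + 1), Φ (x * (u * v)) = 0 := by
      refine fun x hx hx3 => ih (contract Φ x) hx3 fun f hf => ?_
      rw [contract_contract]
      refine h _ ?_
      rw [pow_succ']
      exact Set.mul_mem_mul hx hf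
    obtain ⟨x, hx, hx3⟩ := exists_three_le_finrank_map_contract h3
    obtain ⟨U, hUV, hU, hxU⟩ := ih' x hx hx3
    have good : ∀ z ∈ V, 3 ≤ finrank 𝕜 ((V ^ (m + 2)).map (contract Φ z)) →
        2 ≤ finrank 𝕜 ((V ^ (m + 1)).map (contract (contract Φ x) z)) →
        ∀ u ∈ U, ∀ v ∈ V ^ (m + 1), Φ (z * (u * v)) = 0 := by
      intro z hz hz3 hxz
      obtain ⟨U', hUV', hU', hzU'⟩ := ih' z hz hz3
      have hcodim := finrank_conductor_inf_add_two_le hxz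
      have hle : U ≤ conductor (contract (contract Φ x) z) (V ^ m) ⊥ ⊓ V := by
        refine fun u hu => ⟨fun v hv => ?_, hUV hu⟩
        have := hxU u hu (z * v) (by rw [pow_succ']; exact Submodule.mul_mem_mul hz hv)
        simpa [mul_left_comm] using this
      have hle' : U' ≤ conductor (contract (contract Φ x) z) (V ^ m) ⊥ ⊓ V := by
        refine fun u hu => ⟨fun v hv => ?_, hUV' hu⟩
        have := hzU' u hu (x * v) (by rw [pow_succ']; exact Submodule.mul_mem_mul hx hv)
        rw [Submodule.mem_bot, contract_apply, contract_apply, ← this]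
        congr 1
        ring
      have : FiniteDimensional 𝕜 (conductor (contract (contract Φ x) z) (V ^ m) ⊥ ⊓ V :
          Submodule 𝕜 A) := Submodule.finiteDimensional_of_le inf_le_right
      have heq : U = U' := (Submodule.eq_of_le_of_finrank_le hle (by omega)).trans
        (Submodule.eq_of_le_of_finrank_le hle' (by omega)).symm
      exact heq ▸ hzU'
    obtain ⟨y, hy, hxy⟩ :
        ∃ y ∈ V, 2 ≤ finrank 𝕜 ((V ^ (m + 1)).map (contract (contract Φ x) y)) := by
      by_contra! hlt
      have := finrank_map_le_one_of_contract (V := V) (contract Φ x) m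
        fun y hy => Nat.le_of_lt_succ (hlt y hy)
      omega
    obtain ⟨z, hz, hz3, hxz⟩ : ∃ z ∈ V, 3 ≤ finrank 𝕜 ((V ^ (m + 2)).map (contract Φ z)) ∧
        2 ≤ finrank 𝕜 ((V ^ (m + 1)).map (contract (contract Φ x) z)) := by
      have h₁ := finite_setOf_finrank_map_contract_lt (r := 3) Φ x (y - x) (V ^ (m + 2)) 0
        (by rwa [zero_smul, add_zero])
      have h₂ := finite_setOf_finrank_map_contract_lt (r := 2) (contract Φ x) x (y - x)
        (V ^ (m + 1)) 1 (by rwa [one_smul, add_sub_cancel])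
      obtain ⟨t, ht, -⟩ := exists_notMem_ne_zero (h₁.union h₂)
      simp only [Set.mem_union, Set.mem_ofPred_eq, not_or, not_not] at ht
      exact ⟨x + t • (y - x), add_mem hx (V.smul_mem t (sub_mem hy hx)), ht.1, ht.2⟩
    refine ⟨U, hUV, hU, fun u hu v hv => ?_⟩
    rw [pow_succ'] at hv
    refine Submodule.mul_induction_on hv (fun l hl w hw => ?_) fun p q hp hq => by
      rw [mul_add, map_add, hp, hq, add_zero]
    have h₁ := finite_setOf_finrank_map_contract_lt (r := 3) Φ z l (V ^ (m + 2)) 0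
      (by rwa [zero_smul, add_zero])
    have h₂ := finite_setOf_finrank_map_contract_lt (r := 2) (contract Φ x) z l (V ^ (m + 1)) 0
      (by rwa [zero_smul, add_zero])
    obtain ⟨t, ht, ht0⟩ := exists_notMem_ne_zero (h₁.union h₂)
    simp only [Set.mem_union, Set.mem_ofPred_eq, not_or, not_not] at ht
    have hsum := good (z + t • l) (add_mem hz (V.smul_mem t hl)) ht.1 ht.2 u hu w hw
    rw [add_mul, smul_mul_assoc, map_add, map_smul, good z hz hz3 hxz u hu w hw, zero_add,
      smul_eq_zero] at hsum
    rw [mul_left_comm]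
    exact hsum.resolve_left ht0

end Main

section Slices

variable {n : ℕ}

lemma finrank_homogeneousSubmodule_one :
    finrank ℂ (homogeneousSubmodule (Fin (n + 1)) ℂ 1) = n + 1 := by
  rw [homogeneousSubmodule_one_eq_span_X, finrank_span_eq_card (linearIndependent_X _ ℂ),
    Fintype.card_fin]

instance (k : ℕ) : FiniteDimensional ℂ (homogeneousSubmodule (Fin (n + 1)) ℂ k) :=
  Module.Finite.iff_fg.2 (homogeneousSubmodule_fg (Fin (n + 1)) ℂ k)

lemma finrank_map_contract_mkQ (K : Submodule ℂ (MvPolynomial (Fin (n + 1)) ℂ))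
    {f : MvPolynomial (Fin (n + 1)) ℂ} (hf : f ≠ 0) :
    finrank ℂ ((homogeneousSubmodule (Fin (n + 1)) ℂ 1).map (contract K.mkQ f)) +
      finrank ℂ ↥(K ⊓ (homogeneousSubmodule (Fin (n + 1)) ℂ 1).map (LinearMap.mulLeft ℂ f)) =
      n + 1 := by
  have hslice := LinearMap.finrank_range_add_finrank_ker
    ((LinearMap.mulLeft ℂ f).domRestrict (homogeneousSubmodule (Fin (n + 1)) ℂ 1))
  have hker : ((LinearMap.mulLeft ℂ f).domRestrict
      (homogeneousSubmodule (Fin (n + 1)) ℂ 1)).ker = ⊥ := by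
    rw [LinearMap.ker_eq_bot]
    intro x y hxy
    exact Subtype.ext (mul_left_cancel₀ hf hxy)
  rw [hker, finrank_bot, add_zero, LinearMap.range_domRestrict,
    finrank_homogeneousSubmodule_one] at hslice
  have h := finrank_map_inf_ker_add (F := K.mkQ)
    (V := (homogeneousSubmodule (Fin (n + 1)) ℂ 1).map (LinearMap.mulLeft ℂ f))
  rwa [hslice, Submodule.ker_mkQ, ← Submodule.map_comp] at h

lemma finrank_map_mkQ_homogeneousSubmodule {k : ℕ}
    {K : Submodule ℂ (MvPolynomial (Fin (n + 1)) ℂ)}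
    (hK : K ≤ homogeneousSubmodule (Fin (n + 1)) ℂ k) :
    finrank ℂ ((homogeneousSubmodule (Fin (n + 1)) ℂ k).map K.mkQ) =
      finrank ℂ (↥(homogeneousSubmodule (Fin (n + 1)) ℂ k) ⧸
        K.comap (homogeneousSubmodule (Fin (n + 1)) ℂ k).subtype) := by
  have h₁ := Submodule.finrank_quotient_add_finrank
    (K.comap (homogeneousSubmodule (Fin (n + 1)) ℂ k).subtype)
  have h₂ := finrank_map_inf_ker_add (F := K.mkQ) (V := homogeneousSubmodule (Fin (n + 1)) ℂ k)
  rw [(Submodule.comapSubtypeEquivOfLe hK).finrank_eq] at h₁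
  rw [Submodule.ker_mkQ, inf_eq_left.2 hK] at h₂
  omega

end Slices

end ImproperSlices

open ImproperSlices
open scoped Pointwise

/-- if a subspace `K ⊆ L_k` of codimension `c ≤ 3` meets every slice
`f·L₁` (`f = l₁⋯l_{k-1}` a product of nonzero linear forms) improperly, then `c = 3`,
`K` meets a suitable slice in dimension `n - 1`, and `K` contains either the degree-`k`
part of the ideal of a line (case A) or the degree-`k` part of the square of the ideal
of a point (case B). -/
theorem stmt_5 (n k : ℕ) (hn : 3 ≤ n) (hk : 2 ≤ k) (c : ℕ) (hc : c ≤ 3)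
    (K : Submodule ℂ (MvPolynomial (Fin (n + 1)) ℂ))
    (hKle : K ≤ homogeneousSubmodule (Fin (n + 1)) ℂ k)
    (hcodim :
      Module.finrank ℂ
        (↥(homogeneousSubmodule (Fin (n + 1)) ℂ k) ⧸
          K.comap (homogeneousSubmodule (Fin (n + 1)) ℂ k).subtype) = c)
    (himproper : ∀ l : Fin (k - 1) → MvPolynomial (Fin (n + 1)) ℂ,
      (∀ i, l i ∈ homogeneousSubmodule (Fin (n + 1)) ℂ 1 ∧ l i ≠ 0) →
      n + 1 - c <
        Module.finrank ℂ
          ↥(K ⊓ (homogeneousSubmodule (Fin (n + 1)) ℂ 1).map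
              (LinearMap.mulLeft ℂ (∏ i, l i)))) :
    c = 3 ∧
    (∃ l : Fin (k - 1) → MvPolynomial (Fin (n + 1)) ℂ,
      (∀ i, l i ∈ homogeneousSubmodule (Fin (n + 1)) ℂ 1 ∧ l i ≠ 0) ∧
      Module.finrank ℂ
        ↥(K ⊓ (homogeneousSubmodule (Fin (n + 1)) ℂ 1).map
            (LinearMap.mulLeft ℂ (∏ i, l i))) = n - 1) ∧
    ((∃ a b : MvPolynomial (Fin (n + 1)) ℂ,
        a ∈ homogeneousSubmodule (Fin (n + 1)) ℂ 1 ∧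
        b ∈ homogeneousSubmodule (Fin (n + 1)) ℂ 1 ∧
        LinearIndependent ℂ ![a, b] ∧
        (homogeneousSubmodule (Fin (n + 1)) ℂ (k - 1)).map (LinearMap.mulLeft ℂ a) ⊔
          (homogeneousSubmodule (Fin (n + 1)) ℂ (k - 1)).map (LinearMap.mulLeft ℂ b) ≤ K) ∨
      (∃ P : Fin (n + 1) → ℂ, P ≠ 0 ∧
        ∀ g ∈ homogeneousSubmodule (Fin (n + 1)) ℂ k,
          eval P g = 0 → (∀ i, eval P (pderiv i g) = 0) → g ∈ K)) := by
  obtain ⟨m, rfl⟩ : ∃ m, k = m + 2 := ⟨k - 2, by omega⟩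
  set V := homogeneousSubmodule (Fin (n + 1)) ℂ 1 with hV
  replace himproper : ∀ l : Fin (m + 1) → MvPolynomial (Fin (n + 1)) ℂ,
      (∀ i, l i ∈ V ∧ l i ≠ 0) →
      n + 1 - c < Module.finrank ℂ ↥(K ⊓ V.map (LinearMap.mulLeft ℂ (∏ i, l i))) := himproper
  have hV_finrank : Module.finrank ℂ V = n + 1 := finrank_homogeneousSubmodule_one
  have hrank : Module.finrank ℂ ((V ^ (m + 2)).map K.mkQ) = c := by
    rw [hV, homogeneousSubmodule_one_pow, finrank_map_mkQ_homogeneousSubmodule hKle, hcodim]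
  have hc0 : c ≠ 0 := by
    rintro rfl
    have h := himproper (fun _ => X 0)
      fun _ => ⟨isHomogeneous_X ℂ 0, X_ne_zero 0⟩
    have hf : (∏ _i : Fin (m + 1), (X 0 : MvPolynomial (Fin (n + 1)) ℂ)) ≠ 0 :=
      Finset.prod_ne_zero_iff.2 fun _ _ => X_ne_zero 0
    have := finrank_map_contract_mkQ K hf
    rw [← hV] at this
    omega
  have hmap_zero : V.map (contract K.mkQ (0 : MvPolynomial (Fin (n + 1)) ℂ)) = ⊥ := by
    rw [eq_bot_iff]
    rintro _ ⟨a, -, rfl⟩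
    simp
  have hslice : ∀ l : Fin (m + 1) → V,
      Module.finrank ℂ (V.map (contract K.mkQ (∏ i, (l i : MvPolynomial (Fin (n + 1)) ℂ)))) < c := by
    intro l
    by_cases hl : ∀ i, (l i : MvPolynomial (Fin (n + 1)) ℂ) ≠ 0
    · have h := himproper (fun i => l i) fun i => ⟨(l i).2, hl i⟩
      have := finrank_map_contract_mkQ K
        (Finset.prod_ne_zero_iff.2 fun i (_ : i ∈ Finset.univ) => hl i)
      rw [← hV] at this
      omega
    · push Not at hl
      obtain ⟨i, hi⟩ := hl
      rw [Finset.prod_eq_zero (Finset.mem_univ i) hi, hmap_zero, finrank_bot]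
      omega
  have hprod : ∀ f ∈ (V : Set (MvPolynomial (Fin (n + 1)) ℂ)) ^ (m + 1),
      ∃ l : Fin (m + 1) → V, f = ∏ i, (l i : MvPolynomial (Fin (n + 1)) ℂ) := by
    intro f hf
    obtain ⟨l, rfl⟩ := Set.mem_pow.1 hf
    exact ⟨l, List.prod_ofFn⟩
  have hc1 : 1 < c := by
    by_contra! hle
    have hbot : (V ^ (m + 2)).map K.mkQ ≤ ⊥ := by
      rw [Submodule.map_le_iff_le_comap, pow_succ, Submodule.pow_eq_span_pow_set, Submodule.mul_le]
      intro f hf v hv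
      refine Submodule.span_induction (fun g hg => ?_) (by simp)
        (fun g g' _ _ hg hg' => by rw [add_mul]; exact add_mem hg hg')
        (fun t g _ hg => by rw [smul_mul_assoc]; exact Submodule.smul_mem _ t hg) hf
      obtain ⟨l, rfl⟩ := hprod g hg
      have h0 := hslice l
      have h0 : Module.finrank ℂ
          (V.map (contract K.mkQ (∏ i, (l i : MvPolynomial (Fin (n + 1)) ℂ)))) = 0 := by omega
      rw [Submodule.finrank_eq_zero] at h0
      rw [← h0]
      exact ⟨v, hv, rfl⟩
    rw [le_bot_iff.1 hbot, finrank_bot] at hrank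
    omega
  obtain ⟨f, hf, hf2⟩ : ∃ f ∈ (V : Set (MvPolynomial (Fin (n + 1)) ℂ)) ^ (m + 1),
      1 < Module.finrank ℂ (V.map (contract K.mkQ f)) := by
    by_contra! hle
    exact absurd (finrank_map_le_one_of_slices (m + 1) K.mkQ hle) (by rw [hrank]; omega)
  obtain ⟨l, rfl⟩ := hprod f hf
  have hl2 := hslice l
  obtain rfl : c = 3 := by omega
  have hl0 : ∀ i, (l i : MvPolynomial (Fin (n + 1)) ℂ) ≠ 0 := by
    intro i hi
    rw [Finset.prod_eq_zero (Finset.mem_univ i) hi, hmap_zero, finrank_bot] at hf2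
    omega
  refine ⟨rfl, ⟨fun i => l i, fun i => ⟨(l i).2, hl0 i⟩, ?_⟩, Or.inl ?_⟩
  · have := finrank_map_contract_mkQ K
      (Finset.prod_ne_zero_iff.2 fun i (_ : i ∈ Finset.univ) => hl0 i)
    rw [← hV] at this
    change Module.finrank ℂ ↥(K ⊓ V.map
      (LinearMap.mulLeft ℂ (∏ i : Fin (m + 1), (l i : MvPolynomial (Fin (n + 1)) ℂ)))) = n - 1
    omega
  · obtain ⟨U, hUV, hU, hKU⟩ := exists_base_locus m K.mkQ hrank.ge fun f hf => by
      obtain ⟨l, rfl⟩ := hprod f hf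
      exact Nat.le_of_lt_succ (hslice l)
    have hU2 : 2 ≤ Module.finrank ℂ U := by omega
    obtain ⟨u, hu⟩ := exists_linearIndependent_of_le_finrank hU2
    have hmem : ∀ i, (homogeneousSubmodule (Fin (n + 1)) ℂ (m + 1)).map
        (LinearMap.mulLeft ℂ (u i : MvPolynomial (Fin (n + 1)) ℂ)) ≤ K := by
      rintro i _ ⟨v, hv, rfl⟩
      rw [← homogeneousSubmodule_one_pow] at hv
      simpa using hKU (u i) (u i).2 v hv
    refine ⟨u 0, u 1, hUV (u 0).2, hUV (u 1).2, ?_, sup_le (hmem 0) (hmem 1)⟩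
    have hpair : ![(u 0 : MvPolynomial (Fin (n + 1)) ℂ), u 1] = U.subtype ∘ u := by
      ext1 i
      fin_cases i <;> rfl
    rw [hpair]
    exact hu.map' U.subtype (Submodule.ker_subtype _)
end
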